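/- arXiv:1304.1237 — 2 statements merged into one kernel-verified Lean document; each statement's English description precedes it below -/
import Mathlib

section
/- For every integer n ≥ 3, every minimal Markov basis for A_{n,3} contains exactly C(n,3) + 156·C(n,4) + 210·C(n,5) + 60·C(n,6) moves of degree three, where C(n,k) denotes the binomial coefficient n choose k. -/
/-- The sufficient-statistic map (configuration matrix `A_{n,r}` applied to a
nonnegative integer vector indexed by `S_{n,r}`, the injections from `Fin r` to `Fin n`):
the `(j,k)` coordinate counts, with multiplicity `x σ`, the votes `σ` with `σ j = k`. -/
noncomputable def suffN (n r : ℕ) (x : (Fin r ↪ Fin n) → ℕ) : Fin r × Fin n → ℕ :=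
  fun p => ∑ σ : Fin r ↪ Fin n, if σ p.1 = p.2 then x σ else 0

/-- The configuration matrix `A_{n,r}` applied to an integer vector. -/
noncomputable def suffZ (n r : ℕ) (z : (Fin r ↪ Fin n) → ℤ) : Fin r × Fin n → ℤ :=
  fun p => ∑ σ : Fin r ↪ Fin n, if σ p.1 = p.2 then z σ else 0

/-- The degree of a move `z`: `Σ_σ max(z σ, 0)`. -/
noncomputable def moveDeg (n r : ℕ) (z : (Fin r ↪ Fin n) → ℤ) : ℕ :=
  ∑ σ : Fin r ↪ Fin n, (z σ).toNat

/-- `B` is a Markov basis for `A_{n,r}`: a finite set of moves (elements of the integer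
kernel of `A_{n,r}`) such that any two points of a common fiber are connected by a path
staying in the fiber whose steps are elements of `B ∪ (-B)`. -/
def IsMarkovBasis (n r : ℕ) (B : Finset ((Fin r ↪ Fin n) → ℤ)) : Prop :=
  (∀ z ∈ B, suffZ n r z = 0) ∧
  ∀ x y : (Fin r ↪ Fin n) → ℕ, suffN n r x = suffN n r y →
    ∃ (m : ℕ) (w : ℕ → (Fin r ↪ Fin n) → ℕ),
      w 0 = x ∧ w m = y ∧
      (∀ i ≤ m, suffN n r (w i) = suffN n r x) ∧
      (∀ i < m, (fun σ => (w (i+1) σ : ℤ) - (w i σ : ℤ)) ∈ B ∨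
                (fun σ => (w i σ : ℤ) - (w (i+1) σ : ℤ)) ∈ B)

namespace BirkhoffThree
/-- Boolean test that three natural numbers are pairwise distinct. -/
def distinct₃ (a b c : ℕ) : Bool := !(a.beq b || a.beq c || b.beq c)

def colTable (a0 a1 a2 b0 b1 b2 c0 c1 c2 : ℕ) : List (Bool × ℕ) :=
  [(distinct₃ a0 b0 c0, 195),
   (distinct₃ a0 b0 c1, 780),
   (distinct₃ a0 b0 c2, 3120),
   (distinct₃ a0 b1 c0, 798720),
   (distinct₃ a0 b1 c1, 3194880),
   (distinct₃ a0 b1 c2, 12779520),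
   (distinct₃ a0 b2 c0, 3271557120),
   (distinct₃ a0 b2 c1, 13086228480),
   (distinct₃ a0 b2 c2, 52344913920),
   (distinct₃ a1 b0 c0, 335626240),
   (distinct₃ a1 b0 c1, 553783296),
   (distinct₃ a1 b0 c2, 167813120),
   (distinct₃ a1 b1 c0, 21474836500),
   (distinct₃ a1 b1 c1, 35433480225),
   (distinct₃ a1 b1 c2, 10737418250),
   (distinct₃ a1 b2 c0, 5244160),
   (distinct₃ a1 b2 c1, 8652864),
   (distinct₃ a1 b2 c2, 2622080),
   (distinct₃ a2 b0 c0, 42960158720),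
   (distinct₃ a2 b0 c1, 19332071424),
   (distinct₃ a2 b0 c2, 5370019840),
   (distinct₃ a2 b1 c0, 671091200),
   (distinct₃ a2 b1 c1, 301991040),
   (distinct₃ a2 b1 c2, 83886400),
   (distinct₃ a2 b2 c0, 163880),
   (distinct₃ a2 b2 c1, 73746),
   (distinct₃ a2 b2 c2, 20485)]

def validMask (L : List (Bool × ℕ)) : ℕ :=
  L.foldr (fun e acc => bif e.1 then acc else acc ^^^ (acc &&& e.2)) 68719476735

def spread (L : List (Bool × ℕ)) (V R : ℕ) : ℕ :=
  L.foldr (fun e acc => bif e.1 then (bif (acc &&& e.2).beq 0 then acc else acc ||| (V &&& e.2)) else acc) R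

def closureMask (L : List (Bool × ℕ)) (V R : ℕ) : ℕ :=
  spread L V (spread L V (spread L V R))

def popCount : ℕ → ℕ → ℕ
  | 0, _ => 0
  | k + 1, V => V % 2 + popCount k (V / 2)

def rowSym (a b c : ℕ) : ℕ :=
  bif a.beq b then (bif a.beq c then 6 else 2) else (bif a.beq c || b.beq c then 2 else 1)

def withTable {β : Type} (f : List (Bool × ℕ) → ℕ → β) (d : β) : List ℕ → β
  | [c2, b2, a2, c1, b1, a1, c0, b0, a0] =>
    f (colTable a0 a1 a2 b0 b1 b2 c0 c1 c2) (rowSym a0 a1 a2 * rowSym b0 b1 b2 * rowSym c0 c1 c2)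
  | _ => d

def isConn (c : List ℕ) : Bool :=
  withTable (fun L _ => (closureMask L (validMask L) 1).beq (validMask L)) false c

def weight72 (c : List ℕ) : ℕ :=
  withTable (fun L s => bif (closureMask L (validMask L) 1).beq (validMask L) then 0
    else 12 * s / popCount 36 (validMask L)) 0 c

def twoComp (L : List (Bool × ℕ)) (V R : ℕ) (s : ℕ) : Bool :=
  V.testBit 0 && bif R.beq V then true else
   (spread L V R).beq R && ((R ||| closureMask L V (1 <<< (V ^^^ R).log2)).beq V) 
   && V.testBit (V ^^^ R).log2 && (popCount 36 V * (12 * s / popCount 36 V)).beq (12 * s)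

def chk (c : List ℕ) (k : ℕ) : Bool :=
  withTable (fun L s => twoComp L (validMask L) (closureMask L (validMask L) 1) s) false c
  && (Nat.ble 3 k && Nat.ble k 6 || isConn c)

def leaves : ℕ → List ℕ → ℕ → List (List ℕ × ℕ)
  | 0, c, m => [(c, m)]
  | r + 1, c, m =>
    (List.range (m + 1)).flatMap fun i =>
      bif (c.take (c.length % 3)).elem i then [] else leaves r (i :: c) (max m (i + 1))

/-- The bit mask of the pairs `u` of permutations with `u.1 i = j` and `u.2 i = k`. -/
def columnMask : Fin 3 → Fin 3 → Fin 3 → ℕ :=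
  ![![![195, 780, 3120], ![798720, 3194880, 12779520], ![3271557120, 13086228480, 52344913920]],
      ![![335626240, 553783296, 167813120], ![21474836500, 35433480225, 10737418250], ![5244160, 8652864, 2622080]],
      ![![42960158720, 19332071424, 5370019840], ![671091200, 301991040, 83886400], ![163880, 73746, 20485]]]

def triples : List (Fin 3 × Fin 3 × Fin 3) :=
  [(0, 0, 0), (0, 0, 1), (0, 0, 2), (0, 1, 0), (0, 1, 1), (0, 1, 2), (0, 2, 0), (0, 2, 1), (0, 2, 2),
    (1, 0, 0), (1, 0, 1), (1, 0, 2), (1, 1, 0), (1, 1, 1), (1, 1, 2), (1, 2, 0), (1, 2, 1), (1, 2, 2),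
    (2, 0, 0), (2, 0, 1), (2, 0, 2), (2, 1, 0), (2, 1, 1), (2, 1, 2), (2, 2, 0), (2, 2, 1), (2, 2, 2)]

theorem mem_triples (t : Fin 3 × Fin 3 × Fin 3) : t ∈ triples := by
  revert t; decide

theorem colTable_eq (a0 a1 a2 b0 b1 b2 c0 c1 c2 : ℕ) :
    colTable a0 a1 a2 b0 b1 b2 c0 c1 c2 = triples.map fun t =>
      (distinct₃ (![a0, a1, a2] t.1) (![b0, b1, b2] t.2.1) (![c0, c1, c2] t.2.2),
        columnMask t.1 t.2.1 t.2.2) := rfl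

abbrev PermPair := Equiv.Perm (Fin 3) × Equiv.Perm (Fin 3)

def permCode (p : Equiv.Perm (Fin 3)) : ℕ := 2 * (p 0).val + if p 2 < p 1 then 1 else 0

def code (u : PermPair) : ℕ := 6 * permCode u.1 + permCode u.2

theorem permCode_lt : ∀ p, permCode p < 6 := by decide

theorem permCode_injective : Function.Injective permCode := by
  unfold Function.Injective; decide

theorem exists_permCode : ∀ b : Fin 6, ∃ p, permCode p = b := by decide

theorem code_lt (u : PermPair) : code u < 36 := by
  have := permCode_lt u.1
  have := permCode_lt u.2
  unfold code; omega

theorem code_injective : Function.Injective code := by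
  rintro ⟨p, q⟩ ⟨p', q'⟩ h
  have := permCode_lt q
  have := permCode_lt q'
  simp only [code] at h
  rw [permCode_injective (show permCode p = permCode p' by omega),
    permCode_injective (show permCode q = permCode q' by omega)]

theorem exists_code {b : ℕ} (hb : b < 36) : ∃ u, code u = b := by
  obtain ⟨p, hp⟩ := exists_permCode ⟨b / 6, by omega⟩
  obtain ⟨q, hq⟩ := exists_permCode ⟨b % 6, by omega⟩
  refine ⟨(p, q), ?_⟩
  simp only [code, hp, hq]
  omega

theorem code_one : code 1 = 0 := by decide

theorem columnMask_lt : ∀ i j k, columnMask i j k < 2 ^ 36 := by decide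

theorem testBit_columnMask (i j k : Fin 3) (u : PermPair) :
    (columnMask i j k).testBit (code u) = true ↔ u.1 i = j ∧ u.2 i = k := by
  revert i j k u; decide +kernel

/-- The three entries `w 0 i`, `w 1 j`, `w 2 k` of an array with three rows are distinct. -/
def ColumnOK {α : Type*} (w : Fin 3 → Fin 3 → α) (i j k : Fin 3) : Prop :=
  w 0 i ≠ w 1 j ∧ w 0 i ≠ w 2 k ∧ w 1 j ≠ w 2 k

/-- The pairs of permutations of the last two rows for which every column of the permuted
array has distinct entries. -/
def validSet {α : Type*} (w : Fin 3 → Fin 3 → α) : Set PermPair :=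
  {u | ∀ i, ColumnOK w i (u.1 i) (u.2 i)}

/-- Two valid pairs are adjacent if the permuted arrays have a common column. -/
def LAdj (V : Set PermPair) (u v : PermPair) : Prop :=
  u ∈ V ∧ v ∈ V ∧ ∃ i, u.1 i = v.1 i ∧ u.2 i = v.2 i

def LConn (V : Set PermPair) : PermPair → PermPair → Prop := Relation.ReflTransGen (LAdj V)

theorem LConn.mem {V : Set PermPair} {u v : PermPair} (h : LConn V u v) (hu : u ∈ V) : v ∈ V := by
  cases h with
  | refl => exact hu
  | tail _ h => exact h.2.1

/-- The description of the column table `L` of an array `w`. -/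
structure IsTable {α : Type*} (w : Fin 3 → Fin 3 → α) (L : List (Bool × ℕ)) : Prop where
  exists_mem : ∀ i j k, ∃ e ∈ L, (e.1 = true ↔ ColumnOK w i j k) ∧ e.2 = columnMask i j k
  exists_eq : ∀ e ∈ L, ∃ i j k, (e.1 = true ↔ ColumnOK w i j k) ∧ e.2 = columnMask i j k

theorem nat_beq_eq_false {a b : ℕ} : a.beq b = false ↔ a ≠ b := by
  rw [Ne, ← Nat.beq_eq, Bool.not_eq_true]

theorem distinct₃_iff (a b c : ℕ) : distinct₃ a b c = true ↔ a ≠ b ∧ a ≠ c ∧ b ≠ c := by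
  simp [distinct₃, and_assoc, nat_beq_eq_false]

theorem isTable_colTable (a0 a1 a2 b0 b1 b2 c0 c1 c2 : ℕ) :
    IsTable ![![a0, a1, a2], ![b0, b1, b2], ![c0, c1, c2]]
      (colTable a0 a1 a2 b0 b1 b2 c0 c1 c2) := by
  rw [colTable_eq]
  constructor
  · intro i j k
    exact ⟨_, List.mem_map_of_mem (mem_triples (i, j, k)), distinct₃_iff _ _ _, rfl⟩
  · intro e he
    obtain ⟨⟨i, j, k⟩, -, rfl⟩ := List.mem_map.1 he
    exact ⟨i, j, k, distinct₃_iff _ _ _, rfl⟩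

theorem testBit_validMask (L : List (Bool × ℕ)) (b : ℕ) :
    (validMask L).testBit b = true ↔
      b < 36 ∧ ∀ e ∈ L, e.2.testBit b = true → e.1 = true := by
  induction L with
  | nil =>
    have : validMask [] = 2 ^ 36 - 1 := rfl
    rw [this, Nat.testBit_two_pow_sub_one]
    simp
  | cons e L ih =>
    rcases e with ⟨_ | _, m⟩
    · have : validMask ((false, m) :: L) = validMask L ^^^ (validMask L &&& m) := rfl
      rw [this, Nat.testBit_xor, Nat.testBit_and]
      simp only [List.forall_mem_cons]
      cases h : (validMask L).testBit b <;> cases h' : m.testBit b <;> simp_all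
    · have : validMask ((true, m) :: L) = validMask L := rfl
      rw [this, ih]
      simp

theorem mem_validSet_iff {α : Type*} {w : Fin 3 → Fin 3 → α} {L : List (Bool × ℕ)}
    (hL : IsTable w L) (u : PermPair) :
    u ∈ validSet w ↔ (validMask L).testBit (code u) = true := by
  rw [testBit_validMask]
  constructor
  · refine fun hu => ⟨code_lt u, fun e he hb => ?_⟩
    obtain ⟨i, j, k, h1, h2⟩ := hL.exists_eq e he
    rw [h2, testBit_columnMask] at hb
    rw [h1, ← hb.1, ← hb.2]
    exact hu i
  · rintro ⟨-, h⟩ i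
    obtain ⟨e, he, h1, h2⟩ := hL.exists_mem i (u.1 i) (u.2 i)
    refine h1.1 (h e he ?_)
    rw [h2, testBit_columnMask]
    exact ⟨rfl, rfl⟩

theorem spread_cons (e : Bool × ℕ) (L : List (Bool × ℕ)) (V R : ℕ) :
    spread (e :: L) V R = bif e.1 then (bif (spread L V R &&& e.2).beq 0 then spread L V R
      else spread L V R ||| (V &&& e.2)) else spread L V R := rfl

theorem testBit_spread_cons (e : Bool × ℕ) (L : List (Bool × ℕ)) (V R b : ℕ) :
    (spread (e :: L) V R).testBit b = true ↔ (spread L V R).testBit b = true ∨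
      (e.1 = true ∧ spread L V R &&& e.2 ≠ 0 ∧ V.testBit b = true ∧ e.2.testBit b = true) := by
  rw [spread_cons]
  cases h : e.1
  · simp
  · by_cases h' : spread L V R &&& e.2 = 0
    · simp [h']
    · have : (spread L V R &&& e.2).beq 0 = false := nat_beq_eq_false.2 h'
      simp [this, h']

theorem testBit_spread_of_testBit {L : List (Bool × ℕ)} {V R b : ℕ} (h : R.testBit b = true) :
    (spread L V R).testBit b = true := by
  induction L with
  | nil => exact h
  | cons e L ih => exact (testBit_spread_cons e L V R b).2 (Or.inl ih)

theorem exists_code_of_and_ne_zero {R : ℕ} {i j k : Fin 3} (h : R &&& columnMask i j k ≠ 0) :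
    ∃ u : PermPair, R.testBit (code u) = true ∧ u.1 i = j ∧ u.2 i = k := by
  obtain ⟨b, hb⟩ := Nat.exists_testBit_of_ne_zero h
  rw [Nat.testBit_and, Bool.and_eq_true] at hb
  have hlt : b < 36 := by
    by_contra hge
    rw [Nat.testBit_lt_two_pow (lt_of_lt_of_le (columnMask_lt i j k)
      (Nat.pow_le_pow_right two_pos (not_lt.1 hge)))] at hb
    simp at hb
  obtain ⟨u, rfl⟩ := exists_code hlt
  exact ⟨u, hb.1, (testBit_columnMask i j k u).1 hb.2⟩

theorem spread_subset {V : Set PermPair} {S : Set PermPair} (hS : ∀ u v, u ∈ S → LAdj V u v → v ∈ S)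
    {m R : ℕ} (hm : ∀ u, m.testBit (code u) = true → u ∈ V) {L : List (Bool × ℕ)}
    (hL : ∀ e ∈ L, ∃ i j k, e.2 = columnMask i j k)
    (hR : ∀ u, R.testBit (code u) = true → u ∈ S ∧ u ∈ V) (u : PermPair)
    (hu : (spread L m R).testBit (code u) = true) : u ∈ S ∧ u ∈ V := by
  induction L generalizing u with
  | nil => exact hR u hu
  | cons e L ih =>
    have ih := ih fun e he => hL e (List.mem_cons_of_mem _ he)
    rcases (testBit_spread_cons e L m R (code u)).1 hu with h | ⟨-, h, hV, he⟩
    · exact ih u h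
    · obtain ⟨i, j, k, hijk⟩ := hL e List.mem_cons_self
      rw [hijk] at h he
      obtain ⟨v, hv, hv1, hv2⟩ := exists_code_of_and_ne_zero h
      obtain ⟨hu1, hu2⟩ := (testBit_columnMask i j k u).1 he
      exact ⟨hS v u (ih v hv).1 ⟨(ih v hv).2, hm u hV, i, hv1.trans hu1.symm, hv2.trans hu2.symm⟩,
        hm u hV⟩

theorem closureMask_subset {V : Set PermPair} {S : Set PermPair}
    (hS : ∀ u v, u ∈ S → LAdj V u v → v ∈ S)
    {m R : ℕ} (hm : ∀ u, m.testBit (code u) = true → u ∈ V) {L : List (Bool × ℕ)}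
    (hL : ∀ e ∈ L, ∃ i j k, e.2 = columnMask i j k)
    (hR : ∀ u, R.testBit (code u) = true → u ∈ S ∧ u ∈ V) (u : PermPair)
    (hu : (closureMask L m R).testBit (code u) = true) : u ∈ S ∧ u ∈ V :=
  spread_subset hS hm hL (spread_subset hS hm hL (spread_subset hS hm hL hR)) u hu

theorem testBit_of_spread_fixed {L : List (Bool × ℕ)} {m R : ℕ}
    (h : ∀ b, (spread L m R).testBit b = true → R.testBit b = true) {e : Bool × ℕ} (he : e ∈ L)
    (h1 : e.1 = true) {b b' : ℕ} (hb : R.testBit b = true) (heb : e.2.testBit b = true)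
    (hm : m.testBit b' = true) (heb' : e.2.testBit b' = true) : R.testBit b' = true := by
  induction L with
  | nil => cases he
  | cons e' L ih =>
    have h' : ∀ b, (spread L m R).testBit b = true → R.testBit b = true :=
      fun b hb => h b ((testBit_spread_cons e' L m R b).2 (Or.inl hb))
    rcases List.mem_cons.1 he with rfl | he
    · refine h b' ((testBit_spread_cons e L m R b').2 (Or.inr ⟨h1, fun h0 => ?_, hm, heb'⟩))
      have := congrArg (fun x => x.testBit b) h0
      simp [Nat.testBit_and, testBit_spread_of_testBit hb, heb] at this
    · exact ih h' he

theorem LConn_mem_of_fixed {α : Type*} {w : Fin 3 → Fin 3 → α} {L : List (Bool × ℕ)}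
    (hL : IsTable w L) {R : ℕ} (h : spread L (validMask L) R = R) {u v : PermPair}
    (hu : R.testBit (code u) = true) (huv : LConn (validSet w) u v) :
    R.testBit (code v) = true := by
  induction huv with
  | refl => exact hu
  | @tail x y _ hxy ih =>
    obtain ⟨-, hy, i, h1, h2⟩ := hxy
    obtain ⟨e, he, he1, he2⟩ := hL.exists_mem i (y.1 i) (y.2 i)
    refine testBit_of_spread_fixed (fun b hb => h ▸ hb) he (he1.2 (hy i)) ih ?_
      ((mem_validSet_iff hL y).1 hy) ?_
    · rw [he2, testBit_columnMask]; exact ⟨h1, h2⟩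
    · rw [he2, testBit_columnMask]; exact ⟨rfl, rfl⟩

/-- The graph of valid pairs is disconnected. -/
def LBad (V : Set PermPair) : Prop := ∃ v ∈ V, ¬ LConn V 1 v

theorem LConn_of_testBit_closureMask {α : Type*} {w : Fin 3 → Fin 3 → α} {L : List (Bool × ℕ)}
    (hL : IsTable w L) {R : ℕ} {u : PermPair} (hu : u ∈ validSet w)
    (hR : ∀ b, R.testBit b = true ↔ b = code u) {v : PermPair}
    (hv : (closureMask L (validMask L) R).testBit (code v) = true) : LConn (validSet w) u v := by
  refine (closureMask_subset (S := {v | LConn (validSet w) u v}) (fun x y hx hxy => hx.tail hxy)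
    (fun x hx => (mem_validSet_iff hL x).2 hx)
    (fun e he => ?_) (fun x hx => ?_) v hv).1
  · obtain ⟨i, j, k, -, h⟩ := hL.exists_eq e he
    exact ⟨i, j, k, h⟩
  · rw [hR] at hx
    obtain rfl := code_injective hx
    exact ⟨Relation.ReflTransGen.refl, hu⟩

theorem not_LBad_of_closureMask_eq {α : Type*} {w : Fin 3 → Fin 3 → α} {L : List (Bool × ℕ)}
    (hL : IsTable w L) (h1 : 1 ∈ validSet w) (h : closureMask L (validMask L) 1 = validMask L) :
    ¬ LBad (validSet w) := by
  rintro ⟨v, hv, hn⟩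
  refine hn (LConn_of_testBit_closureMask hL h1 (R := 1) (fun b => ?_) (v := v) ?_)
  · rw [code_one, Nat.testBit_one_eq_true_iff_self_eq_zero]
  · rw [h]; exact (mem_validSet_iff hL v).1 hv

theorem popCount_eq (k V : ℕ) :
    popCount k V = ((Finset.range k).filter fun b => V.testBit b = true).card := by
  induction k generalizing V with
  | zero => rfl
  | succ k ih =>
    rw [popCount, ih, Finset.card_filter, Finset.card_filter, Finset.sum_range_succ']
    simp only [Nat.testBit_succ, Nat.testBit_zero]
    rcases Nat.mod_two_eq_zero_or_one V with h | h <;> simp [h, add_comm]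

theorem popCount_validMask {α : Type*} {w : Fin 3 → Fin 3 → α} {L : List (Bool × ℕ)}
    (hL : IsTable w L) : popCount 36 (validMask L) = (validSet w).ncard := by
  rw [popCount_eq, ← Set.ncard_image_of_injective _ code_injective, ← Set.ncard_coe_finset]
  congr 1
  ext b
  simp only [Finset.coe_filter, Finset.mem_range, Set.mem_ofPred_eq, Set.mem_image]
  constructor
  · rintro ⟨hb, h⟩
    obtain ⟨u, rfl⟩ := exists_code hb
    exact ⟨u, (mem_validSet_iff hL u).2 h, rfl⟩
  · rintro ⟨u, hu, rfl⟩
    exact ⟨code_lt u, (mem_validSet_iff hL u).1 hu⟩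

theorem twoComp_spec {α : Type*} {w : Fin 3 → Fin 3 → α} {L : List (Bool × ℕ)}
    (hL : IsTable w L) {s : ℕ}
    (h : twoComp L (validMask L) (closureMask L (validMask L) 1) s = true) :
    1 ∈ validSet w ∧
    (∃ v₀ ∈ validSet w, ∀ v ∈ validSet w,
      LConn (validSet w) 1 v ∨ LConn (validSet w) v₀ v) ∧
    (closureMask L (validMask L) 1 = validMask L ∧ ¬ LBad (validSet w) ∨
      closureMask L (validMask L) 1 ≠ validMask L ∧ LBad (validSet w) ∧
        popCount 36 (validMask L) * (12 * s / popCount 36 (validMask L)) = 12 * s) := by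
  set V := validMask L with hV
  set R := closureMask L V 1 with hR
  have hone : ∀ b, (1 : ℕ).testBit b = true ↔ b = code 1 := fun b => by
    rw [code_one, Nat.testBit_one_eq_true_iff_self_eq_zero]
  unfold twoComp at h
  rw [Bool.and_eq_true] at h
  obtain ⟨h0, h⟩ := h
  rw [← code_one] at h0
  have h1 : 1 ∈ validSet w := (mem_validSet_iff hL 1).2 h0
  refine ⟨h1, ?_⟩
  by_cases hRV : R = V
  · have hb := not_LBad_of_closureMask_eq hL h1 hRV
    refine ⟨⟨1, h1, fun v hv => Or.inl ?_⟩, Or.inl ⟨hRV, hb⟩⟩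
    by_contra hn
    exact hb ⟨v, hv, hn⟩
  · have hbeq : R.beq V = false := nat_beq_eq_false.2 hRV
    simp only [hbeq, cond_false, Bool.and_eq_true, Nat.beq_eq] at h
    obtain ⟨⟨⟨h2, h3⟩, h4⟩, h5⟩ := h
    have hlt : (V ^^^ R).log2 < 36 := ((testBit_validMask L _).1 h4).1
    obtain ⟨u, hu⟩ := exists_code hlt
    have hne : V ^^^ R ≠ 0 := fun h => hRV (Nat.xor_eq_zero_iff.1 h).symm
    have hbit : (V ^^^ R).testBit (code u) = true := by
      rw [hu]; exact Nat.testBit_log2 hne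
    rw [← hu] at h4
    have huV := (mem_validSet_iff hL u).2 h4
    rw [Nat.testBit_xor, h4] at hbit
    refine ⟨⟨u, huV, fun v hv => ?_⟩, Or.inr ⟨hRV, ⟨u, huV, fun hc => ?_⟩, h5⟩⟩
    · have hv' := (mem_validSet_iff hL v).1 hv
      rw [← hV, ← h3, Nat.testBit_or, Bool.or_eq_true] at hv'
      refine hv'.imp (LConn_of_testBit_closureMask hL h1 hone)
        (LConn_of_testBit_closureMask hL huV fun b => ?_)
      rw [hu, Nat.one_shiftLeft, Nat.testBit_two_pow, decide_eq_true_iff, eq_comm]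
    · have h1R : R.testBit (code 1) = true :=
        testBit_spread_of_testBit (testBit_spread_of_testBit (testBit_spread_of_testBit
          ((hone _).2 rfl)))
      have := LConn_mem_of_fixed hL h2 h1R hc
      simp [this] at hbit

/-- The array with three rows whose columns are read off a list, in reverse order. -/
def listArray {α : Type*} (u : List α) (j i : Fin 3) : Option α := u[8 - (3 * i.val + j.val)]?

theorem validSet_congr {α β : Type*} {w : Fin 3 → Fin 3 → α} {w' : Fin 3 → Fin 3 → β}
    (h : ∀ j i j' i', w j i = w j' i' ↔ w' j i = w' j' i') : validSet w = validSet w' := by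
  simp only [validSet, ColumnOK, ne_eq, h]

/-- The number of permutations of the index set that fix a row. -/
noncomputable def rowStab {α : Type*} (f : Fin 3 → α) : ℕ :=
  {p : Equiv.Perm (Fin 3) | ∀ i, f (p i) = f i}.ncard

theorem rowStab_congr {α β : Type*} {f : Fin 3 → α} {f' : Fin 3 → β}
    (h : ∀ i i', f i = f i' ↔ f' i = f' i') : rowStab f = rowStab f' := by
  simp only [rowStab, h]

noncomputable def arrayStab {α : Type*} (w : Fin 3 → Fin 3 → α) : ℕ := ∏ j, rowStab (w j)

open Classical in
/-- A function of the valid set and the row stabilizers, restricted to lists of length nine all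
of whose columns have distinct entries. -/
noncomputable def listWeight (Φ : Set PermPair → ℕ → ℚ) {α : Type*} (u : List α) : ℚ :=
  if u.length = 9 ∧ 1 ∈ validSet (listArray u) then
    Φ (validSet (listArray u)) (arrayStab (listArray u)) else 0

theorem listWeight_map (Φ : Set PermPair → ℕ → ℚ) {α β : Type*} {l : List α} {s : α → β}
    (hs : Set.InjOn s {a | a ∈ l}) : listWeight Φ (l.map s) = listWeight Φ l := by
  have h : ∀ j i j' i', listArray (l.map s) j i = listArray (l.map s) j' i' ↔
      listArray l j i = listArray l j' i' := by
    intro j i j' i'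
    simp only [listArray, List.getElem?_map]
    cases h1 : l[8 - (3 * i.val + j.val)]? <;> cases h2 : l[8 - (3 * i'.val + j'.val)]? <;> simp
    exact hs.eq_iff (List.mem_of_getElem? h1) (List.mem_of_getElem? h2)
  have h' : arrayStab (listArray (l.map s)) = arrayStab (listArray l) :=
    Finset.prod_congr rfl fun j _ => rowStab_congr fun i i' => h j i j i'
  unfold listWeight
  rw [validSet_congr h, h']
  split_ifs with h1 h2 h2
  · rfl
  · exact absurd (by rwa [List.length_map] at h1) h2
  · exact absurd (by rwa [List.length_map]) h1
  · rfl

def ColumnsNodup {α : Type*} : List α → Prop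
  | [] => True
  | a :: u => a ∉ u.take (u.length % 3) ∧ ColumnsNodup u

theorem exists_eq_of_length_eq_nine {α : Type*} {u : List α} (h : u.length = 9) :
    ∃ c2 b2 a2 c1 b1 a1 c0 b0 a0, u = [c2, b2, a2, c1, b1, a1, c0, b0, a0] := by
  match u, h with
  | [c2, b2, a2, c1, b1, a1, c0, b0, a0], _ => exact ⟨c2, b2, a2, c1, b1, a1, c0, b0, a0, rfl⟩

theorem listArray_eq {α : Type*} (c2 b2 a2 c1 b1 a1 c0 b0 a0 : α) (j i : Fin 3) :
    listArray [c2, b2, a2, c1, b1, a1, c0, b0, a0] j i =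
      some (![![a0, a1, a2], ![b0, b1, b2], ![c0, c1, c2]] j i) := by
  fin_cases j <;> fin_cases i <;> rfl

theorem validSet_listArray {α : Type*} (c2 b2 a2 c1 b1 a1 c0 b0 a0 : α) :
    validSet (listArray [c2, b2, a2, c1, b1, a1, c0, b0, a0]) =
      validSet ![![a0, a1, a2], ![b0, b1, b2], ![c0, c1, c2]] :=
  validSet_congr fun j i j' i' => by rw [listArray_eq, listArray_eq, Option.some_inj]

theorem columnsNodup_of_one_mem {α : Type*} {u : List α} (hu : u.length = 9)
    (h : 1 ∈ validSet (listArray u)) : ColumnsNodup u := by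
  obtain ⟨c2, b2, a2, c1, b1, a1, c0, b0, a0, rfl⟩ := exists_eq_of_length_eq_nine hu
  rw [validSet_listArray] at h
  have h0 := h 0
  have h1 := h 1
  have h2 := h 2
  simp [ColumnOK] at h0 h1 h2
  simp [ColumnsNodup]
  grind

/-- The sum of a function over all extensions of a list by a given number of entries. -/
def sumExt {α M : Type*} [Fintype α] [AddCommMonoid M] (G : List α → M) : ℕ → List α → M
  | 0, u => G u
  | r + 1, u => ∑ a, sumExt G r (a :: u)

theorem sumExt_eq_zero {α : Type*} [Fintype α] (Φ : Set PermPair → ℕ → ℚ) (r : ℕ) (u : List α)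
    (hu : ¬ ColumnsNodup u) : sumExt (listWeight Φ) r u = 0 := by
  induction r generalizing u with
  | zero => exact if_neg fun h => hu (columnsNodup_of_one_mem h.1 h.2)
  | succ r ih => exact Finset.sum_eq_zero fun a _ => ih _ fun h => hu h.2

theorem le_of_mem_leaves {r : ℕ} {c : List ℕ} {m : ℕ} {e : List ℕ × ℕ} (he : e ∈ leaves r c m) :
    m ≤ e.2 := by
  induction r generalizing c m with
  | zero => rw [leaves, List.mem_singleton] at he; rw [he]
  | succ r ih =>
    rw [leaves, List.mem_flatMap] at he
    obtain ⟨i, -, he⟩ := he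
    cases h : (c.take (c.length % 3)).elem i <;> simp only [h, cond_true, cond_false] at he
    · exact (le_max_left _ _).trans (ih he)
    · cases he

theorem sum_map_eq_zero {ι M : Type*} [AddCommMonoid M] {l : List ι} {f : ι → M}
    (h : ∀ x ∈ l, f x = 0) : (l.map f).sum = 0 :=
  List.sum_eq_zero fun y hy => by
    obtain ⟨x, hx, rfl⟩ := List.mem_map.1 hy
    exact h x hx

theorem sum_map_flatMap {ι κ M : Type*} [AddCommMonoid M] (l : List ι) (f : ι → List κ)
    (g : κ → M) : ((l.flatMap f).map g).sum = (l.map fun i => ((f i).map g).sum).sum := by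
  induction l with
  | nil => rfl
  | cons i l ih => simp [ih]

theorem sumExt_mul_descFactorial {n : ℕ} (Φ : Set PermPair → ℕ → ℚ) (r : ℕ) (c : List ℕ) (m : ℕ)
    (s : ℕ → Fin n) (hc : ∀ i ∈ c, i < m) (hs : Set.InjOn s (Set.Iio m)) :
    sumExt (listWeight Φ) r (c.map s) * (n.descFactorial m : ℚ) =
      ((leaves r c m).map fun e => listWeight Φ e.1 * (n.descFactorial e.2 : ℚ)).sum := by
  induction r generalizing c m s with
  | zero =>
    simp only [sumExt, leaves, List.map_cons, List.map_nil, List.sum_singleton]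
    rw [listWeight_map Φ (hs.mono fun i hi => hc i hi)]
  | succ r ih =>
    set T : ℕ → ℚ := fun i => ((bif (c.take (c.length % 3)).elem i then [] else
      leaves r (i :: c) (max m (i + 1))).map
        fun e => listWeight Φ e.1 * (n.descFactorial e.2 : ℚ)).sum with hT
    have hR : ((leaves (r + 1) c m).map fun e =>
        listWeight Φ e.1 * (n.descFactorial e.2 : ℚ)).sum = ∑ i ∈ Finset.range (m + 1), T i := by
      rw [leaves, sum_map_flatMap]
      rfl
    have hterm : ∀ i m' (s' : ℕ → Fin n), m' = max m (i + 1) → Set.InjOn s' (Set.Iio m') →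
        sumExt (listWeight Φ) r ((i :: c).map s') * (n.descFactorial m' : ℚ) = T i := by
      intro i m' s' hm hs'
      subst hm
      by_cases hi : (c.take (c.length % 3)).elem i = true
      · rw [sumExt_eq_zero, zero_mul, hT]
        · simp only [hi, cond_true, List.map_nil, List.sum_nil]
        · rintro ⟨h, -⟩
          rw [List.length_map, ← List.map_take] at h
          exact h (List.mem_map_of_mem (List.elem_iff.1 hi))
      · rw [ih (i :: c) _ s' _ hs', hT]
        · simp only [hi, cond_false]
        · intro x hx
          rcases List.mem_cons.1 hx with rfl | hx
          · exact lt_max_of_lt_right (Nat.lt_succ_self _)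
          · exact lt_max_of_lt_left (hc x hx)
    have hold : ∀ i < m, sumExt (listWeight Φ) r (s i :: c.map s) * (n.descFactorial m : ℚ) = T i :=
      fun i hi => hterm i m s (max_eq_left hi).symm hs
    have hinj : Set.InjOn s (Finset.range m : Finset ℕ) := by simpa using hs
    have hcard : ((Finset.range m).image s).card = m := by
      rw [Finset.card_image_of_injOn hinj, Finset.card_range]
    have hmn : m ≤ n := by
      simpa [hcard] using Finset.card_le_univ ((Finset.range m).image s)
    have hnew : ∀ a ∈ ((Finset.range m).image s)ᶜ,
        sumExt (listWeight Φ) r (a :: c.map s) * (n.descFactorial (m + 1) : ℚ) = T m := by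
      intro a ha
      have ha' : ∀ i < m, s i ≠ a := by simpa using ha
      have hmap : (m :: c).map (Function.update s m a) = a :: c.map s := by
        rw [List.map_cons, Function.update_self]
        congr 1
        exact List.map_congr_left fun i hi => Function.update_of_ne (hc i hi).ne _ _
      rw [← hmap]
      refine hterm m (m + 1) _ (by simp) fun i hi j hj hij => ?_
      simp only [Set.mem_Iio] at hi hj
      rcases Nat.lt_succ_iff_lt_or_eq.1 hi with hi | rfl <;>
        rcases Nat.lt_succ_iff_lt_or_eq.1 hj with hj | rfl
      · rw [Function.update_of_ne hi.ne, Function.update_of_ne hj.ne] at hij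
        exact hs hi hj hij
      · rw [Function.update_of_ne hi.ne, Function.update_self] at hij
        exact absurd hij (ha' i hi)
      · rw [Function.update_of_ne hj.ne, Function.update_self] at hij
        exact absurd hij.symm (ha' j hj)
      · rfl
    rw [hR, Finset.sum_range_succ, sumExt, Finset.sum_mul,
      ← Finset.sum_add_sum_compl ((Finset.range m).image s)]
    congr 1
    · rw [Finset.sum_image fun i hi j hj h => hinj hi hj h]
      exact Finset.sum_congr rfl fun i hi => hold i (Finset.mem_range.1 hi)
    · rcases hmn.lt_or_eq with hlt | rfl
      · have hpos : ((n - m : ℕ) : ℚ) ≠ 0 := by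
          exact_mod_cast (Nat.sub_pos_of_lt hlt).ne'
        have hcc : (((Finset.range m).image s)ᶜ).card = n - m := by
          rw [Finset.card_compl, hcard, Fintype.card_fin]
        have : ∀ a ∈ ((Finset.range m).image s)ᶜ,
            sumExt (listWeight Φ) r (a :: c.map s) * (n.descFactorial m : ℚ) =
              T m / ((n - m : ℕ) : ℚ) := by
          intro a ha
          rw [eq_div_iff hpos, ← hnew a ha, Nat.descFactorial_succ]
          push_cast
          ring
        rw [Finset.sum_congr rfl this, Finset.sum_const, hcc, nsmul_eq_mul,
          mul_div_cancel₀ _ hpos]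
      · have : ((Finset.range m).image s)ᶜ = ∅ := by
          rw [← Finset.card_eq_zero, Finset.card_compl, hcard, Fintype.card_fin, Nat.sub_self]
        rw [this, Finset.sum_empty, hT]
        refine (sum_map_eq_zero fun e he => ?_).symm
        cases h : (c.take (c.length % 3)).elem m <;> simp only [h, cond_true, cond_false] at he
        · have := le_of_mem_leaves he
          rw [Nat.descFactorial_of_lt (lt_of_lt_of_le (by simp) this), Nat.cast_zero, mul_zero]
        · cases he

theorem sumExt_nil {n : ℕ} [NeZero n] (Φ : Set PermPair → ℕ → ℚ) :
    sumExt (listWeight Φ) 9 ([] : List (Fin n)) =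
      ((leaves 9 [] 0).map fun e => listWeight Φ e.1 * (n.descFactorial e.2 : ℚ)).sum := by
  have := sumExt_mul_descFactorial Φ 9 [] 0 (fun _ => (0 : Fin n)) (by simp) (by simp [Set.InjOn])
  simpa using this

theorem univ_perm_fin_three : (Finset.univ : Finset (Equiv.Perm (Fin 3))) =
    {1, Equiv.swap 0 1, Equiv.swap 0 2, Equiv.swap 1 2, finRotate 3, (finRotate 3)⁻¹} := by
  decide

theorem rowStab_eq_rowSym (a b c : ℕ) : rowStab ![a, b, c] = rowSym a b c := by
  have key : rowStab ![a, b, c] = ∑ p : Equiv.Perm (Fin 3),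
      if ![a, b, c] (p 0) = a ∧ ![a, b, c] (p 1) = b ∧ ![a, b, c] (p 2) = c then 1 else 0 := by
    rw [rowStab, ← Finset.card_filter, ← Set.ncard_coe_finset]
    congr 1
    ext p
    simp [Fin.forall_fin_succ]
  have h1 : (finRotate 3) 0 = 1 ∧ (finRotate 3) 1 = 2 ∧ (finRotate 3) 2 = 0 := by decide
  have h2 : (finRotate 3)⁻¹ 0 = 2 ∧ (finRotate 3)⁻¹ 1 = 0 ∧ (finRotate 3)⁻¹ 2 = 1 := by decide
  have h3 : (Equiv.swap (0 : Fin 3) 1) 2 = 2 ∧ (Equiv.swap (0 : Fin 3) 2) 1 = 1 ∧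
    (Equiv.swap (1 : Fin 3) 2) 0 = 0 := by decide
  rw [key, univ_perm_fin_three, Finset.sum_insert (by decide), Finset.sum_insert (by decide),
    Finset.sum_insert (by decide), Finset.sum_insert (by decide), Finset.sum_insert (by decide),
    Finset.sum_singleton]
  simp only [h1, h2, h3, Equiv.Perm.one_apply, Equiv.swap_apply_left, Equiv.swap_apply_right,
    rowSym, Matrix.cons_val_zero, Matrix.cons_val_one, Matrix.cons_val]
  have hb : ∀ x y : ℕ, x.beq y = decide (x = y) := fun x y => by
    by_cases h : x = y
    · simp [h]
    · simp [h, nat_beq_eq_false.2 h]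
  simp only [hb]
  by_cases hab : a = b <;> by_cases hac : a = c <;> by_cases hbc : b = c <;>
    simp_all [eq_comm]

def TwoComps (V : Set PermPair) : Prop :=
  ∃ v₀ ∈ V, ∀ v ∈ V, LConn V 1 v ∨ LConn V v₀ v

open Classical in
/-- The reciprocal of the number of rearrangements, for disconnected graphs. -/
noncomputable def badWeight (V : Set PermPair) (s : ℕ) : ℚ :=
  if LBad V then (s : ℚ) / (6 * V.ncard) else 0

open Classical in
noncomputable def manyWeight (V : Set PermPair) (_ : ℕ) : ℚ := if TwoComps V then 0 else 1

theorem arrayStab_listArray (c2 b2 a2 c1 b1 a1 c0 b0 a0 : ℕ) :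
    arrayStab (listArray [c2, b2, a2, c1, b1, a1, c0, b0, a0]) =
      rowSym a0 a1 a2 * rowSym b0 b1 b2 * rowSym c0 c1 c2 := by
  have : arrayStab (listArray [c2, b2, a2, c1, b1, a1, c0, b0, a0]) =
      arrayStab ![![a0, a1, a2], ![b0, b1, b2], ![c0, c1, c2]] :=
    Finset.prod_congr rfl fun j _ => rowStab_congr fun i i' => by
      rw [listArray_eq, listArray_eq, Option.some_inj]
  rw [this, arrayStab, Fin.prod_univ_three]
  simp [rowStab_eq_rowSym]

theorem withTable_cons {β : Type} (f : List (Bool × ℕ) → ℕ → β) (d : β)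
    (c2 b2 a2 c1 b1 a1 c0 b0 a0 : ℕ) :
    withTable f d [c2, b2, a2, c1, b1, a1, c0, b0, a0] =
      f (colTable a0 a1 a2 b0 b1 b2 c0 c1 c2)
        (rowSym a0 a1 a2 * rowSym b0 b1 b2 * rowSym c0 c1 c2) := rfl

theorem listWeight_of_chk {c : List ℕ} {k : ℕ} (h : chk c k = true) :
    listWeight manyWeight c = 0 ∧ listWeight badWeight c = weight72 c / 72 ∧
      (3 ≤ k ∧ k ≤ 6 ∨ weight72 c = 0) := by
  rw [chk, Bool.and_eq_true] at h
  obtain ⟨h, hk⟩ := h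
  have hc : ∃ c2 b2 a2 c1 b1 a1 c0 b0 a0, c = [c2, b2, a2, c1, b1, a1, c0, b0, a0] := by
    unfold withTable at h
    split at h
    · exact ⟨_, _, _, _, _, _, _, _, _, rfl⟩
    · cases h
  obtain ⟨c2, b2, a2, c1, b1, a1, c0, b0, a0, rfl⟩ := hc
  have hL := isTable_colTable a0 a1 a2 b0 b1 b2 c0 c1 c2
  rw [withTable_cons] at h
  obtain ⟨h1, h2, h3⟩ := twoComp_spec hL h
  have hw : ∀ Φ, listWeight Φ [c2, b2, a2, c1, b1, a1, c0, b0, a0] =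
      Φ (validSet ![![a0, a1, a2], ![b0, b1, b2], ![c0, c1, c2]])
        (rowSym a0 a1 a2 * rowSym b0 b1 b2 * rowSym c0 c1 c2) := by
    intro Φ
    rw [listWeight, arrayStab_listArray, validSet_listArray, if_pos ⟨rfl, h1⟩]
  have hpop := popCount_validMask hL
  rw [hw, hw]
  clear hw
  have hwt : ∀ b, (closureMask (colTable a0 a1 a2 b0 b1 b2 c0 c1 c2)
      (validMask (colTable a0 a1 a2 b0 b1 b2 c0 c1 c2)) 1).beq
        (validMask (colTable a0 a1 a2 b0 b1 b2 c0 c1 c2)) = b →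
      weight72 [c2, b2, a2, c1, b1, a1, c0, b0, a0] = bif b then 0 else
        12 * (rowSym a0 a1 a2 * rowSym b0 b1 b2 * rowSym c0 c1 c2) /
          popCount 36 (validMask (colTable a0 a1 a2 b0 b1 b2 c0 c1 c2)) := by
    rintro b rfl
    rw [weight72, withTable_cons]
  rw [isConn, withTable_cons] at hk
  generalize colTable a0 a1 a2 b0 b1 b2 c0 c1 c2 = L at *
  generalize rowSym a0 a1 a2 * rowSym b0 b1 b2 * rowSym c0 c1 c2 = s at *
  refine ⟨if_pos h2, ?_, ?_⟩
  · rcases h3 with ⟨h3, h4⟩ | ⟨h3, h4, h5⟩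
    · rw [hwt true (by rw [h3, Nat.beq_eq]), badWeight, if_neg h4]
      simp
    · rw [hwt false (nat_beq_eq_false.2 h3), badWeight, if_pos h4, cond_false, ← hpop]
      have hpos : popCount 36 (validMask L) ≠ 0 := by
        rw [hpop]
        exact (Set.ncard_pos (Set.toFinite _)).2 ⟨1, h1⟩ |>.ne'
      generalize popCount 36 (validMask L) = q at *
      rw [div_eq_div_iff (mul_ne_zero (by norm_num) (Nat.cast_ne_zero.2 hpos)) (by norm_num)]
      have h5' := congrArg (Nat.cast : ℕ → ℚ) h5
      push_cast at h5' ⊢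
      linear_combination -6 * h5'
  · rw [Bool.or_eq_true, Bool.and_eq_true, Nat.ble_eq, Nat.ble_eq] at hk
    refine hk.imp id fun hk => ?_
    rw [hwt true hk, cond_true]

theorem sum_split {l : List (List ℕ × ℕ)} (hl : ∀ e ∈ l, 3 ≤ e.2 ∧ e.2 ≤ 6 ∨ weight72 e.1 = 0)
    (f : ℕ → ℚ) : (l.map fun e => (weight72 e.1 : ℚ) * f e.2).sum =
      ∑ k ∈ Finset.Icc 3 6, ((l.map fun e => bif e.2.beq k then weight72 e.1 else 0).sum : ℕ) *
        f k := by
  induction l with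
  | nil => simp
  | cons e l ih =>
    have hb : ∀ x y : ℕ, x.beq y = decide (x = y) := fun x y => by
      by_cases h : x = y
      · simp [h]
      · simp [h, nat_beq_eq_false.2 h]
    simp only [List.map_cons, List.sum_cons, ih fun e he => hl e (List.mem_cons_of_mem _ he)]
    push_cast
    simp only [add_mul, Finset.sum_add_distrib, hb]
    congr 1
    rcases hl e List.mem_cons_self with h | h
    · rw [Finset.sum_eq_single_of_mem e.2 (Finset.mem_Icc.2 h)]
      · simp
      · intro k _ hk
        simp [hk.symm]
    · simp [h]

set_option maxRecDepth 100000 in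
theorem chk_leaves : (leaves 9 [] 0).all (fun e => chk e.1 e.2) = true := by
  decide +kernel

set_option maxRecDepth 100000 in
theorem sum_leaves_three :
    ((leaves 9 [] 0).map fun e => bif e.2.beq 3 then weight72 e.1 else 0).sum = 12 := by
  decide +kernel

set_option maxRecDepth 100000 in
theorem sum_leaves_four :
    ((leaves 9 [] 0).map fun e => bif e.2.beq 4 then weight72 e.1 else 0).sum = 468 := by
  decide +kernel

set_option maxRecDepth 100000 in
theorem sum_leaves_five :
    ((leaves 9 [] 0).map fun e => bif e.2.beq 5 then weight72 e.1 else 0).sum = 126 := by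
  decide +kernel

set_option maxRecDepth 100000 in
theorem sum_leaves_six :
    ((leaves 9 [] 0).map fun e => bif e.2.beq 6 then weight72 e.1 else 0).sum = 6 := by
  decide +kernel

theorem sumExt_manyWeight {n : ℕ} [NeZero n] :
    sumExt (listWeight manyWeight) 9 ([] : List (Fin n)) = 0 := by
  rw [sumExt_nil]
  refine sum_map_eq_zero fun e he => ?_
  rw [(listWeight_of_chk (List.all_eq_true.1 chk_leaves e he)).1, zero_mul]

theorem sumExt_badWeight {n : ℕ} [NeZero n] :
    sumExt (listWeight badWeight) 9 ([] : List (Fin n)) =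
      ((n.choose 3 + 156 * n.choose 4 + 210 * n.choose 5 + 60 * n.choose 6 : ℕ) : ℚ) := by
  rw [sumExt_nil]
  have h : ∀ e ∈ leaves 9 [] 0, listWeight badWeight e.1 * (n.descFactorial e.2 : ℚ) =
      (weight72 e.1 : ℚ) * ((n.descFactorial e.2 : ℚ) / 72) := by
    intro e he
    rw [(listWeight_of_chk (List.all_eq_true.1 chk_leaves e he)).2.1]
    ring
  rw [List.map_congr_left h, sum_split
    (fun e he => (listWeight_of_chk (List.all_eq_true.1 chk_leaves e he)).2.2)
    (fun k => (n.descFactorial k : ℚ) / 72)]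
  have hI : Finset.Icc 3 6 = {3, 4, 5, 6} := by decide
  rw [hI, Finset.sum_insert (by decide), Finset.sum_insert (by decide),
    Finset.sum_insert (by decide), Finset.sum_singleton, sum_leaves_three, sum_leaves_four,
    sum_leaves_five, sum_leaves_six]
  simp only [Nat.descFactorial_eq_factorial_mul_choose, Nat.factorial]
  push_cast
  ring

/-- The vector counting how often each vote occurs in a family of votes. -/
def vec {α : Type*} [DecidableEq α] {m : ℕ} (X : Fin m → α) (σ : α) : ℕ :=
  ∑ i, if X i = σ then 1 else 0

theorem exists_perm_of_vec_eq {α : Type*} [DecidableEq α] {m : ℕ} {f g : Fin m → α}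
    (h : vec f = vec g) : ∃ p : Equiv.Perm (Fin m), ∀ i, f i = g (p i) := by
  have hc : ∀ a, Nonempty ({i // f i = a} ≃ {i // g i = a}) := fun a => by
    rw [← Fintype.card_eq, Fintype.card_subtype, Fintype.card_subtype, Finset.card_filter,
      Finset.card_filter]
    exact congrFun h a
  let e := fun a => (hc a).some
  refine ⟨(Equiv.sigmaFiberEquiv f).symm.trans ((Equiv.sigmaCongrRight e).trans
    (Equiv.sigmaFiberEquiv g)), fun i => ?_⟩
  exact (e (f i) ⟨i, rfl⟩).2.symm

theorem vec_comp_perm {α : Type*} [DecidableEq α] {m : ℕ} (f : Fin m → α)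
    (p : Equiv.Perm (Fin m)) : vec (f ∘ p) = vec f :=
  funext fun a => Equiv.sum_comp p fun i => if f i = a then 1 else 0

theorem vec_pos {α : Type*} [DecidableEq α] {m : ℕ} {f : Fin m → α} {a : α} :
    0 < vec f a ↔ ∃ i, f i = a := by
  simp [vec, Finset.Nonempty]

theorem exists_vec {α : Type*} [DecidableEq α] [Fintype α] {m : ℕ} {x : α → ℕ}
    (hx : ∑ a, x a = m) : ∃ f : Fin m → α, vec f = x := by
  induction m generalizing x with
  | zero =>
    refine ⟨Fin.elim0, funext fun a => ?_⟩
    rw [Finset.sum_eq_zero_iff] at hx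
    rw [hx a (Finset.mem_univ a)]
    rfl
  | succ m ih =>
    obtain ⟨a, -, ha⟩ := Finset.exists_ne_zero_of_sum_ne_zero (hx.trans_ne m.succ_ne_zero)
    obtain ⟨f, hf⟩ := ih (x := Function.update x a (x a - 1)) (by
      rw [Finset.sum_update_of_mem (Finset.mem_univ a)]
      rw [Finset.sum_eq_add_sum_sdiff_singleton_of_mem (Finset.mem_univ a)] at hx
      omega)
    refine ⟨Fin.cons a f, funext fun b => ?_⟩
    have h : vec (Fin.cons a f : Fin (m + 1) → α) b = (if a = b then 1 else 0) + vec f b := by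
      simp only [vec, Fin.sum_univ_succ, Fin.cons_zero, Fin.cons_succ]
    rw [h, hf]
    by_cases hb : a = b
    · subst hb
      rw [if_pos rfl, Function.update_self]
      omega
    · rw [if_neg hb, Function.update_of_ne (Ne.symm hb), zero_add]

abbrev Vote (n : ℕ) := Fin 3 ↪ Fin n

theorem suffN_vec {n : ℕ} (X : Fin 3 → Vote n) (j : Fin 3) (k : Fin n) :
    suffN n 3 (vec X) (j, k) = vec (fun i => X i j) k := by
  have h : ∀ σ : Vote n, (if σ j = k then vec X σ else 0) =
      ∑ i, if X i = σ then (if σ j = k then 1 else 0) else 0 := fun σ => by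
    split_ifs <;> simp [vec]
  simp only [suffN, h]
  rw [Finset.sum_comm]
  exact Finset.sum_congr rfl fun i _ => by simp

theorem sum_suffN {n : ℕ} (x : Vote n → ℕ) (j : Fin 3) :
    ∑ k, suffN n 3 x (j, k) = ∑ σ, x σ := by
  simp only [suffN]
  rw [Finset.sum_comm]
  simp

theorem sum_eq_of_suffN_eq {n : ℕ} {x y : Vote n → ℕ} (h : suffN n 3 x = suffN n 3 y) :
    ∑ σ, x σ = ∑ σ, y σ := by
  rw [← sum_suffN x 0, ← sum_suffN y 0, h]

theorem sum_vec {α : Type*} [DecidableEq α] [Fintype α] {m : ℕ} (f : Fin m → α) :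
    ∑ a, vec f a = m := by
  simp only [vec]
  rw [Finset.sum_comm]
  simp

theorem suffN_vec_eq_iff {n : ℕ} {X Y : Fin 3 → Vote n} :
    suffN n 3 (vec Y) = suffN n 3 (vec X) ↔
      ∀ j, ∃ p : Equiv.Perm (Fin 3), ∀ i, Y i j = X (p i) j := by
  constructor
  · intro h j
    have hj : vec (fun i => Y i j) = vec (fun i => X i j) := funext fun k => by
      rw [← suffN_vec, ← suffN_vec, h]
    exact exists_perm_of_vec_eq hj
  · intro h
    ext ⟨j, k⟩
    obtain ⟨p, hp⟩ := h j
    rw [suffN_vec, suffN_vec, ← vec_comp_perm (fun i => X i j) p]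
    exact congrFun (congrArg vec (funext hp)) k

/-- The array whose columns are the given votes. -/
def array {n : ℕ} (X : Fin 3 → Vote n) (j i : Fin 3) : Fin n := X i j

/-- `Y` arises from `X` by permuting the entries of rows `1` and `2` of its array. -/
def Tw {n : ℕ} (X : Fin 3 → Vote n) (u : PermPair) (Y : Fin 3 → Vote n) : Prop :=
  ∀ i, Y i 0 = X i 0 ∧ Y i 1 = X (u.1 i) 1 ∧ Y i 2 = X (u.2 i) 2

theorem Tw.one {n : ℕ} (X : Fin 3 → Vote n) : Tw X 1 X := fun _ => ⟨rfl, rfl, rfl⟩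

theorem Tw.mem {n : ℕ} {X Y : Fin 3 → Vote n} {u : PermPair} (h : Tw X u Y) :
    u ∈ validSet (array X) := by
  intro i
  obtain ⟨h0, h1, h2⟩ := h i
  refine ⟨?_, ?_, ?_⟩
  · simp only [array, ← h0, ← h1]
    exact (Y i).injective.ne (by decide)
  · simp only [array, ← h0, ← h2]
    exact (Y i).injective.ne (by decide)
  · simp only [array, ← h1, ← h2]
    exact (Y i).injective.ne (by decide)

theorem exists_vote {n : ℕ} {a b c : Fin n} (h : a ≠ b ∧ a ≠ c ∧ b ≠ c) :
    ∃ σ : Vote n, σ 0 = a ∧ σ 1 = b ∧ σ 2 = c := by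
  refine ⟨⟨![a, b, c], fun i j hij => ?_⟩, rfl, rfl, rfl⟩
  fin_cases i <;> fin_cases j <;> simp_all [eq_comm]

theorem exists_Tw {n : ℕ} {X : Fin 3 → Vote n} {u : PermPair} (h : u ∈ validSet (array X)) :
    ∃ Y, Tw X u Y := by
  choose Y hY using fun i => exists_vote (h i)
  exact ⟨Y, hY⟩

theorem Tw.suffN_eq {n : ℕ} {X Y : Fin 3 → Vote n} {u : PermPair} (h : Tw X u Y) :
    suffN n 3 (vec Y) = suffN n 3 (vec X) := by
  rw [suffN_vec_eq_iff, Fin.forall_fin_succ, Fin.forall_fin_two]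
  exact ⟨⟨1, fun i => (h i).1⟩, ⟨u.1, fun i => (h i).2.1⟩, ⟨u.2, fun i => (h i).2.2⟩⟩

theorem exists_Tw_of_suffN_eq {n : ℕ} {X : Fin 3 → Vote n} {y : Vote n → ℕ}
    (h : suffN n 3 y = suffN n 3 (vec X)) : ∃ u Y, Tw X u Y ∧ vec Y = y := by
  obtain ⟨Z, rfl⟩ := exists_vec ((sum_eq_of_suffN_eq h).trans (sum_vec X))
  choose p hp using suffN_vec_eq_iff.1 h
  refine ⟨(p 1 * (p 0)⁻¹, p 2 * (p 0)⁻¹), Z ∘ ⇑(p 0)⁻¹, fun i => ?_, vec_comp_perm _ _⟩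
  simp [hp]

/-- Two vectors of a common fiber with a vote in common. -/
def Share {n : ℕ} (x y : Vote n → ℕ) : Prop :=
  suffN n 3 x = suffN n 3 y ∧ ∃ σ, 0 < x σ ∧ 0 < y σ

theorem share_of_LAdj {n : ℕ} {X Y Z : Fin 3 → Vote n} {u v : PermPair} (hY : Tw X u Y)
    (hZ : Tw X v Z) (h : LAdj (validSet (array X)) u v) : Share (vec Y) (vec Z) := by
  obtain ⟨-, -, i, h1, h2⟩ := h
  refine ⟨hY.suffN_eq.trans hZ.suffN_eq.symm, Y i, vec_pos.2 ⟨i, rfl⟩, vec_pos.2 ⟨i, ?_⟩⟩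
  ext j
  obtain ⟨hy0, hy1, hy2⟩ := hY i
  obtain ⟨hz0, hz1, hz2⟩ := hZ i
  fin_cases j
  · exact congrArg _ (hz0.trans hy0.symm)
  · exact congrArg _ (hz1.trans (h1 ▸ hy1.symm))
  · exact congrArg _ (hz2.trans (h2 ▸ hy2.symm))

abbrev Conn {n : ℕ} : (Vote n → ℕ) → (Vote n → ℕ) → Prop := Relation.ReflTransGen Share

theorem conn_of_LConn {n : ℕ} {X Y Z : Fin 3 → Vote n} {u v : PermPair} (hY : Tw X u Y)
    (hZ : Tw X v Z) (h : LConn (validSet (array X)) u v) : Conn (vec Y) (vec Z) := by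
  induction h generalizing Z with
  | refl =>
    have : Y = Z := funext fun i => by
      obtain ⟨hy0, hy1, hy2⟩ := hY i
      obtain ⟨hz0, hz1, hz2⟩ := hZ i
      ext j
      fin_cases j <;> simp_all
    rw [this]
  | tail _ h ih =>
    obtain ⟨W, hW⟩ := exists_Tw h.1
    exact (ih hW).tail (share_of_LAdj hW hZ h)

theorem apply_swap_of_eq {ι α : Type*} [DecidableEq ι] {f : ι → α} {a b : ι} (h : f a = f b)
    (k : ι) : f (Equiv.swap a b k) = f k := by
  rw [Equiv.swap_apply_def]
  split_ifs with h1 h2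
  · rw [h1, h]
  · rw [h2, h]
  · rfl

theorem exists_swap_fixed : ∀ (p : Equiv.Perm (Fin 3)) (a b : Fin 3),
    ∃ i, p i = Equiv.swap a b (p i) := by decide

theorem LConn_of_common {n : ℕ} {X Y Z : Fin 3 → Vote n} {u v : PermPair} (hY : Tw X u Y)
    (hZ : Tw X v Z) {i i' : Fin 3} (h : Y i = Z i') : LConn (validSet (array X)) u v := by
  obtain ⟨p, q⟩ := u
  obtain ⟨p', q'⟩ := v
  have h0 : X i 0 = X i' 0 := by rw [← (hY i).1, ← (hZ i').1, h]
  have h1 : X (p i) 1 = X (p' i') 1 := by rw [← (hY i).2.1, ← (hZ i').2.1, h]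
  have h2 : X (q i) 2 = X (q' i') 2 := by rw [← (hY i).2.2, ← (hZ i').2.2, h]
  set s := Equiv.swap i i' with hs
  have t0 : Tw X (p * s, q * s) (Y ∘ s) := fun k => by
    refine ⟨?_, (hY (s k)).2.1, (hY (s k)).2.2⟩
    rw [Function.comp_apply, (hY (s k)).1, apply_swap_of_eq (f := fun k => X k 0) h0]
  have t1 : Tw X (Equiv.swap (p i) (p' i') * (p * s), q * s) (Y ∘ s) := fun k => by
    refine ⟨(t0 k).1, ?_, (t0 k).2.2⟩
    rw [(t0 k).2.1]
    exact (apply_swap_of_eq (f := fun k => X k 1) h1 _).symm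
  have t2 : Tw X (Equiv.swap (p i) (p' i') * (p * s), Equiv.swap (q i) (q' i') * (q * s))
      (Y ∘ s) := fun k => by
    refine ⟨(t0 k).1, (t1 k).2.1, ?_⟩
    rw [(t1 k).2.2]
    exact (apply_swap_of_eq (f := fun k => X k 2) h2 _).symm
  have e0 : LAdj (validSet (array X)) (p, q) (p * s, q * s) := by
    obtain ⟨k, hk⟩ := exists_swap_fixed 1 i i'
    refine ⟨hY.mem, t0.mem, k, ?_, ?_⟩
    · exact congrArg p hk
    · exact congrArg q hk
  have e1 := exists_swap_fixed (p * s) (p i) (p' i')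
  have e2 := exists_swap_fixed (q * s) (q i) (q' i')
  obtain ⟨k1, e1⟩ := e1
  obtain ⟨k2, e2⟩ := e2
  refine (((Relation.ReflTransGen.single e0).tail ⟨t0.mem, t1.mem, k1, e1, rfl⟩).tail
    ⟨t1.mem, t2.mem, k2, rfl, e2⟩).tail ⟨t2.mem, hZ.mem, i', ?_, ?_⟩
  · simp [hs]
  · simp [hs]

theorem Conn.suffN_eq {n : ℕ} {x y : Vote n → ℕ} (h : Conn x y) : suffN n 3 x = suffN n 3 y := by
  induction h with
  | refl => rfl
  | tail _ h ih => exact ih.trans h.1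

theorem LConn_of_conn {n : ℕ} {X Y : Fin 3 → Vote n} {u : PermPair} (hY : Tw X u Y)
    {z : Vote n → ℕ} (h : Conn (vec Y) z) {v : PermPair} {Z : Fin 3 → Vote n} (hZ : Tw X v Z)
    (hz : vec Z = z) : LConn (validSet (array X)) u v := by
  induction h generalizing v Z with
  | refl =>
    obtain ⟨i, hi⟩ := vec_pos.1 (hz ▸ vec_pos.2 ⟨0, rfl⟩ : 0 < vec Y (Z 0))
    exact LConn_of_common hY hZ hi
  | tail hx h ih =>
    obtain ⟨v', Z', hZ', rfl⟩ := exists_Tw_of_suffN_eq ((Conn.suffN_eq hx).symm.trans hY.suffN_eq)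
    obtain ⟨-, σ, hσ, hσ'⟩ := h
    subst hz
    obtain ⟨i, rfl⟩ := vec_pos.1 hσ
    obtain ⟨i', hi'⟩ := vec_pos.1 hσ'
    exact (ih hZ' rfl).trans (LConn_of_common hZ' hZ hi'.symm)

/-- The fiber of `x` is not connected by steps between vectors with a vote in common. -/
def Bad {n : ℕ} (x : Vote n → ℕ) : Prop := ∃ y, suffN n 3 y = suffN n 3 x ∧ ¬ Conn x y

theorem bad_vec_iff {n : ℕ} (X : Fin 3 → Vote n) : Bad (vec X) ↔ LBad (validSet (array X)) := by
  constructor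
  · rintro ⟨y, hy, hn⟩
    obtain ⟨v, Z, hZ, rfl⟩ := exists_Tw_of_suffN_eq hy
    exact ⟨v, hZ.mem, fun h => hn (conn_of_LConn (Tw.one X) hZ h)⟩
  · rintro ⟨v, hv, hn⟩
    obtain ⟨Z, hZ⟩ := exists_Tw hv
    exact ⟨vec Z, hZ.suffN_eq, fun h => hn (LConn_of_conn (Tw.one X) h hZ rfl)⟩

theorem conn_of_twoComps {n : ℕ} {X : Fin 3 → Vote n} (h : TwoComps (validSet (array X))) :
    ∃ y₀, suffN n 3 y₀ = suffN n 3 (vec X) ∧ ∀ y, suffN n 3 y = suffN n 3 (vec X) →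
      Conn (vec X) y ∨ Conn y₀ y := by
  obtain ⟨v, hv, h⟩ := h
  obtain ⟨Z, hZ⟩ := exists_Tw hv
  refine ⟨vec Z, hZ.suffN_eq, fun y hy => ?_⟩
  obtain ⟨u, Y, hY, rfl⟩ := exists_Tw_of_suffN_eq hy
  exact (h u hY.mem).imp (conn_of_LConn (Tw.one X) hY) (conn_of_LConn hZ hY)

/-- The entries of a matrix, in reverse order. -/
def listOf {α : Type*} (w : Fin 3 → Fin 3 → α) : List α :=
  [w 2 2, w 2 1, w 2 0, w 1 2, w 1 1, w 1 0, w 0 2, w 0 1, w 0 0]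

theorem sum_fin_three_arrow {α M : Type*} [Fintype α] [AddCommMonoid M] (g : (Fin 3 → α) → M) :
    ∑ f, g f = ∑ a, ∑ b, ∑ c, g ![a, b, c] := by
  let e : (Fin 3 → α) ≃ α × α × α :=
    { toFun := fun f => (f 0, f 1, f 2)
      invFun := fun t => ![t.1, t.2.1, t.2.2]
      left_inv := fun f => by ext i; fin_cases i <;> rfl
      right_inv := fun t => rfl }
  rw [← Equiv.sum_comp e.symm g, Fintype.sum_prod_type]
  exact Finset.sum_congr rfl fun a _ => Fintype.sum_prod_type _

theorem sumExt_nine {α M : Type*} [Fintype α] [AddCommMonoid M] (G : List α → M) :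
    sumExt G 9 [] = ∑ w : Fin 3 → Fin 3 → α, G (listOf w) := by
  simp only [sum_fin_three_arrow]
  rfl

theorem listArray_listOf {α : Type*} (w : Fin 3 → Fin 3 → α) (j i : Fin 3) :
    listArray (listOf w) j i = some (w i j) := by
  fin_cases j <;> fin_cases i <;> rfl

theorem listWeight_listOf {n : ℕ} (Φ : Set PermPair → ℕ → ℚ) (X : Fin 3 → Vote n) :
    listWeight Φ (listOf fun i => ⇑(X i)) = Φ (validSet (array X)) (arrayStab (array X)) := by
  have h : ∀ j i j' i', listArray (listOf fun i => ⇑(X i)) j i =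
      listArray (listOf fun i => ⇑(X i)) j' i' ↔ array X j i = array X j' i' := by
    intro j i j' i'
    rw [listArray_listOf, listArray_listOf, Option.some_inj]
    rfl
  have hs : arrayStab (listArray (listOf fun i => ⇑(X i))) = arrayStab (array X) :=
    Finset.prod_congr rfl fun j _ => rowStab_congr fun i i' => h j i j i'
  rw [listWeight, validSet_congr h, hs, if_pos ⟨rfl, (Tw.one X).mem⟩]

theorem sum_votes {n : ℕ} (Φ : Set PermPair → ℕ → ℚ) :
    ∑ X : Fin 3 → Vote n, Φ (validSet (array X)) (arrayStab (array X)) =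
      sumExt (listWeight Φ) 9 ([] : List (Fin n)) := by
  rw [sumExt_nine]
  refine Fintype.sum_of_injective (fun (X : Fin 3 → Vote n) i => ⇑(X i)) (fun X Y h => ?_) _ _ (fun w hw => ?_)
    fun X => (listWeight_listOf Φ X).symm
  · exact funext fun i => DFunLike.coe_injective (congrFun h i)
  · refine if_neg fun h => hw ?_
    have hv : ∀ i, ∃ σ : Vote n, σ 0 = w i 0 ∧ σ 1 = w i 1 ∧ σ 2 = w i 2 := fun i => by
      refine exists_vote ?_
      have := h.2 i
      simpa only [ColumnOK, listArray_listOf, ne_eq, Option.some_inj, Prod.fst_one, Prod.snd_one,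
        Equiv.Perm.one_apply] using this
    choose X hX using hv
    refine ⟨X, funext fun i => funext fun j => ?_⟩
    obtain ⟨h0, h1, h2⟩ := hX i
    fin_cases j
    · exact h0
    · exact h1
    · exact h2

theorem twoComps_validSet {n : ℕ} (X : Fin 3 → Vote n) : TwoComps (validSet (array X)) := by
  classical
  have : NeZero n := ⟨by
    rintro rfl
    exact (X 0 0).elim0⟩
  have h := (sum_votes manyWeight).trans (sumExt_manyWeight (n := n))
  rw [Finset.sum_eq_zero_iff_of_nonneg fun X _ => by unfold manyWeight; split_ifs <;> simp] at h
  have := h X (Finset.mem_univ X)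
  by_contra hn
  simp [manyWeight, hn] at this

theorem card_coset_eq_rowStab {α : Type*} [DecidableEq α] {f g : Fin 3 → α}
    {q : Equiv.Perm (Fin 3)} (hq : ∀ i, f i = g (q i)) :
    (Finset.univ.filter fun p : Equiv.Perm (Fin 3) => ∀ i, f i = g (p i)).card = rowStab g := by
  rw [rowStab, ← Set.ncard_image_of_injective _ (mul_left_injective q), ← Set.ncard_coe_finset]
  congr 1
  ext p
  simp only [Finset.coe_filter, Finset.mem_univ, true_and, Set.mem_ofPred_eq, Set.mem_image]
  constructor
  · refine fun hp => ⟨p * q⁻¹, fun i => ?_, by simp⟩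
    have h : f (q⁻¹ i) = g i := by simpa using hq (q⁻¹ i)
    rw [Equiv.Perm.mul_apply, ← hp, h]
  · rintro ⟨p, hp, rfl⟩ i
    rw [Equiv.Perm.mul_apply, hp, hq]

theorem Tw.unique {n : ℕ} {X Y Z : Fin 3 → Vote n} {u : PermPair} (hY : Tw X u Y)
    (hZ : Tw X u Z) : Y = Z := funext fun i => by
  obtain ⟨hy0, hy1, hy2⟩ := hY i
  obtain ⟨hz0, hz1, hz2⟩ := hZ i
  ext j
  fin_cases j <;> simp_all

/-- A permutation of each of three rows, described by the permutation of the first row and its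
relative position to the others. -/
def rowPerms : Equiv.Perm (Fin 3) × PermPair ≃ (Fin 3 → Equiv.Perm (Fin 3)) where
  toFun q := ![q.1, q.2.1 * q.1, q.2.2 * q.1]
  invFun d := (d 0, d 1 * (d 0)⁻¹, d 2 * (d 0)⁻¹)
  left_inv q := by simp
  right_inv d := by
    ext1 j
    fin_cases j <;> simp

open Classical in
/-- The number of families of votes in the fiber of a given one. -/
noncomputable def fiberSize {n : ℕ} (X : Fin 3 → Vote n) : ℕ :=
  (Finset.univ.filter fun Y : Fin 3 → Vote n => suffN n 3 (vec Y) = suffN n 3 (vec X)).card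

theorem fiberSize_mul_arrayStab {n : ℕ} (X : Fin 3 → Vote n) :
    fiberSize X * arrayStab (array X) = 6 * (validSet (array X)).ncard := by
  classical
  let R : (Fin 3 → Equiv.Perm (Fin 3)) → (Fin 3 → Vote n) → Prop :=
    fun d Y => ∀ j i, Y i j = X (d j i) j
  have h1 : ∀ Y, (Finset.univ.filter fun d => R d Y).card =
      if suffN n 3 (vec Y) = suffN n 3 (vec X) then arrayStab (array X) else 0 := by
    intro Y
    have : (Finset.univ.filter fun d => R d Y) = Fintype.piFinset fun j =>
        Finset.univ.filter fun p : Equiv.Perm (Fin 3) => ∀ i, Y i j = X (p i) j := by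
      ext d
      simp [R, Fintype.mem_piFinset]
    rw [this, Fintype.card_piFinset]
    split_ifs with h
    · refine Finset.prod_congr rfl fun j _ => ?_
      obtain ⟨q, hq⟩ := suffN_vec_eq_iff.1 h j
      exact card_coset_eq_rowStab (f := fun i => Y i j) (g := fun i => X i j) hq
    · rw [suffN_vec_eq_iff, not_forall] at h
      obtain ⟨j, hj⟩ := h
      refine Finset.prod_eq_zero (Finset.mem_univ j) ?_
      rw [Finset.card_eq_zero, Finset.filter_eq_empty_iff]
      exact fun p _ hp => hj ⟨p, hp⟩
  have h2 : ∀ p u, (Finset.univ.filter fun Y => R (rowPerms (p, u)) Y).card =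
      if u ∈ validSet (array X) then 1 else 0 := by
    intro p u
    have hR : ∀ Y, R (rowPerms (p, u)) Y ↔ Tw X u (Y ∘ ⇑p⁻¹) := by
      intro Y
      constructor
      · refine fun h i => ⟨?_, ?_, ?_⟩
        · simpa [rowPerms] using h 0 (p⁻¹ i)
        · simpa [rowPerms] using h 1 (p⁻¹ i)
        · simpa [rowPerms] using h 2 (p⁻¹ i)
      · intro h j i
        fin_cases j
        · simpa [rowPerms] using (h (p i)).1
        · simpa [rowPerms] using (h (p i)).2.1
        · simpa [rowPerms] using (h (p i)).2.2
    split_ifs with h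
    · obtain ⟨Z, hZ⟩ := exists_Tw h
      rw [Finset.card_eq_one]
      refine ⟨Z ∘ p, Finset.eq_singleton_iff_unique_mem.2 ⟨?_, fun Y hY => ?_⟩⟩
      · rw [Finset.mem_filter_univ, hR]
        convert hZ
        ext1 i
        simp
      · rw [Finset.mem_filter_univ, hR] at hY
        rw [hZ.unique hY]
        ext1 i
        simp
    · rw [Finset.card_eq_zero, Finset.filter_eq_empty_iff]
      exact fun Y _ hY => h ((hR Y).1 hY).mem
  have h3 := Finset.sum_card_bipartiteAbove_eq_sum_card_bipartiteBelow (s := Finset.univ)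
    (t := Finset.univ) R
  simp only [Finset.bipartiteAbove, Finset.bipartiteBelow, h1] at h3
  rw [← Equiv.sum_comp rowPerms, Fintype.sum_prod_type] at h3
  simp only [h2] at h3
  simp only [← Finset.sum_filter, Finset.sum_const, smul_eq_mul, mul_one, Finset.card_univ,
    Fintype.card_perm, Fintype.card_fin] at h3
  have h4 : (Finset.univ.filter fun u => u ∈ validSet (array X)).card =
      (validSet (array X)).ncard := by
    rw [← Set.ncard_coe_finset, Finset.coe_filter_univ]
    rfl
  rw [fiberSize, ← h3, h4]
  rfl

theorem Share.symm {n : ℕ} {x y : Vote n → ℕ} (h : Share x y) : Share y x :=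
  ⟨h.1.symm, h.2.imp fun _ h => h.symm⟩

theorem Conn.symm {n : ℕ} {x y : Vote n → ℕ} (h : Conn x y) : Conn y x :=
  have : Std.Symm (Share (n := n)) := ⟨fun _ _ => Share.symm⟩
  symm_of _ h

theorem Bad.of_suffN_eq {n : ℕ} {x y : Vote n → ℕ} (h : Bad x)
    (hxy : suffN n 3 x = suffN n 3 y) : Bad y := by
  by_contra hn
  have hy : ∀ z, suffN n 3 z = suffN n 3 y → Conn y z := by
    simpa [Bad] using hn
  obtain ⟨z, hz, hc⟩ := h
  exact hc ((hy x hxy).symm.trans (hy z (hz.trans hxy)))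

open Classical in
/-- The statistics of the disconnected fibers of degree three. -/
noncomputable def badStats (n : ℕ) : Finset (Fin 3 × Fin n → ℕ) :=
  (Finset.univ.filter fun X : Fin 3 → Vote n => Bad (vec X)).image fun X => suffN n 3 (vec X)

theorem card_badStats {n : ℕ} [NeZero n] : (badStats n).card =
    n.choose 3 + 156 * n.choose 4 + 210 * n.choose 5 + 60 * n.choose 6 := by
  classical
  have hX : ∀ X : Fin 3 → Vote n, badWeight (validSet (array X)) (arrayStab (array X)) =
      if Bad (vec X) then 1 / (fiberSize X : ℚ) else 0 := by
    intro X
    have h : (fiberSize X : ℚ) * arrayStab (array X) = 6 * (validSet (array X)).ncard := by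
      exact_mod_cast fiberSize_mul_arrayStab X
    have hs : (fiberSize X : ℚ) ≠ 0 := by
      rw [Nat.cast_ne_zero, fiberSize, Finset.card_ne_zero]
      exact ⟨X, by simp⟩
    have hv : ((validSet (array X)).ncard : ℚ) ≠ 0 := by
      rw [Nat.cast_ne_zero]
      exact Set.ncard_ne_zero_of_mem (Tw.one X).mem (Set.toFinite _)
    rw [badWeight, bad_vec_iff]
    split_ifs
    · rw [div_eq_div_iff (by simpa using hv) hs, one_mul, ← h, mul_comm]
    · rfl
  have hsum : ∑ X ∈ Finset.univ.filter (fun X : Fin 3 → Vote n => Bad (vec X)),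
      1 / (fiberSize X : ℚ) = (badStats n).card := by
    rw [← Finset.sum_fiberwise_of_maps_to (t := badStats n)
      (fun X hX => Finset.mem_image_of_mem (fun X => suffN n 3 (vec X)) hX),
      Finset.card_eq_sum_ones, Nat.cast_sum]
    refine Finset.sum_congr rfl fun t ht => ?_
    obtain ⟨X, hX, rfl⟩ := Finset.mem_image.1 ht
    rw [Finset.mem_filter_univ] at hX
    have hset : (Finset.univ.filter fun Y : Fin 3 → Vote n => Bad (vec Y)).filter
        (fun Y => suffN n 3 (vec Y) = suffN n 3 (vec X)) =
        Finset.univ.filter fun Y : Fin 3 → Vote n => suffN n 3 (vec Y) = suffN n 3 (vec X) := by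
      rw [Finset.filter_filter]
      exact Finset.filter_congr fun Y _ => ⟨And.right, fun h => ⟨hX.of_suffN_eq h.symm, h⟩⟩
    have hsz : ∀ Y : Fin 3 → Vote n, suffN n 3 (vec Y) = suffN n 3 (vec X) →
        fiberSize Y = fiberSize X := fun Y hY => by rw [fiberSize, fiberSize, hY]
    rw [hset, Finset.sum_congr rfl fun Y hY => by rw [hsz Y (Finset.mem_filter.1 hY).2],
      Finset.sum_const, nsmul_eq_mul]
    change (fiberSize X : ℚ) * _ = _
    have hs : (fiberSize X : ℚ) ≠ 0 := by
      rw [Nat.cast_ne_zero, fiberSize, Finset.card_ne_zero]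
      exact ⟨X, by simp⟩
    rw [mul_one_div_cancel hs, Nat.cast_one]
  have := (sum_votes badWeight).trans (sumExt_badWeight (n := n))
  rw [Finset.sum_congr rfl fun X _ => hX X, ← Finset.sum_filter, hsum] at this
  exact_mod_cast this

/-- The integer vector leading from `x` to `y`. -/
def diff {α : Type*} (x y : α → ℕ) (σ : α) : ℤ := (y σ : ℤ) - x σ

/-- Two vectors that differ by an element of `B` or its negative. -/
def Step {α : Type*} (B : Finset (α → ℤ)) (x y : α → ℕ) : Prop := diff x y ∈ B ∨ diff y x ∈ B

theorem Step.symm {α : Type*} {B : Finset (α → ℤ)} {x y : α → ℕ} (h : Step B x y) : Step B y x :=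
  Or.symm h

abbrev Path {α : Type*} (B : Finset (α → ℤ)) : (α → ℕ) → (α → ℕ) → Prop :=
  Relation.ReflTransGen (Step B)

theorem Path.symm {α : Type*} {B : Finset (α → ℤ)} {x y : α → ℕ} (h : Path B x y) : Path B y x :=
  have : Std.Symm (Step B) := ⟨fun _ _ => Step.symm⟩
  symm_of _ h

theorem Path.mono {α : Type*} {B B' : Finset (α → ℤ)} (hB : B ⊆ B') {x y : α → ℕ}
    (h : Path B x y) : Path B' x y :=
  Relation.ReflTransGen.mono (fun _ _ => Or.imp (@hB _) (@hB _)) _ _ h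

theorem Path.add {α : Type*} {B : Finset (α → ℤ)} {x y : α → ℕ} (h : Path B x y) (c : α → ℕ) :
    Path B (x + c) (y + c) := by
  have hd : ∀ x y : α → ℕ, diff (x + c) (y + c) = diff x y := fun x y => by
    ext σ
    simp [diff]
  refine Relation.ReflTransGen.lift (· + c) (fun x y h => ?_) _ _ h
  change diff (x + c) (y + c) ∈ B ∨ diff (y + c) (x + c) ∈ B
  rwa [hd, hd]

/-- The positive and (for `-z`) the negative part of an integer vector. -/
def posVec {α : Type*} (z : α → ℤ) (σ : α) : ℕ := (z σ).toNat

theorem diff_posPart {α : Type*} (z : α → ℤ) : diff (posVec (-z)) (posVec z) = z := by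
  ext σ
  simp only [diff, posVec, Pi.neg_apply]
  omega

theorem exists_add_of_diff_eq {α : Type*} {x y : α → ℕ} {z : α → ℤ} (h : diff x y = z) :
    ∃ c, x = posVec (-z) + c ∧ y = posVec z + c := by
  subst h
  refine ⟨fun σ => min (x σ) (y σ), funext fun σ => ?_, funext fun σ => ?_⟩ <;>
    simp only [diff, posVec, Pi.neg_apply, Pi.add_apply] <;> omega

theorem suffZ_diff {n : ℕ} (x y : Vote n → ℕ) (p : Fin 3 × Fin n) :
    suffZ n 3 (diff x y) p = (suffN n 3 y p : ℤ) - suffN n 3 x p := by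
  simp only [suffZ, suffN, diff]
  push_cast
  rw [← Finset.sum_sub_distrib]
  refine Finset.sum_congr rfl fun σ _ => ?_
  split_ifs <;> simp

theorem suffZ_diff_eq_zero_iff {n : ℕ} {x y : Vote n → ℕ} :
    suffZ n 3 (diff x y) = 0 ↔ suffN n 3 x = suffN n 3 y := by
  simp only [funext_iff, suffZ_diff, Pi.zero_apply, sub_eq_zero, Nat.cast_inj]
  exact forall_congr' fun _ => eq_comm

theorem Step.suffN_eq {n : ℕ} {B : Finset (Vote n → ℤ)} (hB : ∀ z ∈ B, suffZ n 3 z = 0)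
    {x y : Vote n → ℕ} (h : Step B x y) : suffN n 3 x = suffN n 3 y :=
  h.elim (fun h => suffZ_diff_eq_zero_iff.1 (hB _ h))
    fun h => (suffZ_diff_eq_zero_iff.1 (hB _ h)).symm

theorem isMarkovBasis_iff {n : ℕ} {B : Finset (Vote n → ℤ)} : IsMarkovBasis n 3 B ↔
    (∀ z ∈ B, suffZ n 3 z = 0) ∧ ∀ x y, suffN n 3 x = suffN n 3 y → Path B x y := by
  refine and_congr_right fun hB => forall₂_congr fun x y => imp_congr_right fun hxy => ?_
  constructor
  · rintro ⟨m, w, rfl, rfl, -, hw⟩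
    have : ∀ i ≤ m, Path B (w 0) (w i) := by
      intro i hi
      induction i with
      | zero => exact Relation.ReflTransGen.refl
      | succ i ih => exact (ih (Nat.le_of_succ_le hi)).tail (hw i hi)
    exact this m le_rfl
  · clear hxy
    intro h
    induction h with
    | refl => exact ⟨0, fun _ => x, rfl, rfl, fun _ _ => rfl, fun i hi => absurd hi i.not_lt_zero⟩
    | @tail y y' _ hs ih =>
      obtain ⟨m, w, h0, hm, hf, hw⟩ := ih
      have hu : ∀ i ≤ m, Function.update w (m + 1) y' i = w i := fun i hi =>
        Function.update_of_ne (by omega) _ _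
      refine ⟨m + 1, Function.update w (m + 1) y', ?_, Function.update_self _ _ _,
        fun i hi => ?_, fun i hi => ?_⟩
      · rw [hu 0 (Nat.zero_le _), h0]
      · rcases Nat.le_succ_iff.1 hi with hi | rfl
        · rw [hu i hi, hf i hi]
        · rw [Function.update_self, ← hf m le_rfl, hm, hs.suffN_eq hB]
      · rcases Nat.lt_succ_iff_lt_or_eq.1 hi with hi | rfl
        · rw [hu i hi.le, hu (i + 1) hi]
          exact hw i hi
        · rw [hu i le_rfl, Function.update_self, hm]
          exact hs

theorem moveDeg_diff_le {n : ℕ} (x y : Vote n → ℕ) : moveDeg n 3 (diff x y) ≤ ∑ σ, y σ :=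
  Finset.sum_le_sum fun σ _ => by
    simp only [diff]
    omega

theorem path_filter {n : ℕ} {B : Finset (Vote n → ℤ)} (hB : ∀ z ∈ B, suffZ n 3 z = 0) {m : ℕ}
    {x y : Vote n → ℕ} (h : Path B x y) (hx : ∑ σ, x σ ≤ m) :
    Path (B.filter fun z => moveDeg n 3 z ≤ m) x y ∧ ∑ σ, y σ ≤ m := by
  induction h with
  | refl => exact ⟨Relation.ReflTransGen.refl, hx⟩
  | tail _ h ih =>
    obtain ⟨ih, hm⟩ := ih
    have hm' := (sum_eq_of_suffN_eq (h.suffN_eq hB)).symm.trans_le hm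
    refine ⟨ih.tail (h.imp (fun h => ?_) fun h => ?_), hm'⟩
    · exact Finset.mem_filter.2 ⟨h, (moveDeg_diff_le _ _).trans hm'⟩
    · exact Finset.mem_filter.2 ⟨h, (moveDeg_diff_le _ _).trans hm⟩

theorem suffN_add {n : ℕ} (x c : Vote n → ℕ) : suffN n 3 (x + c) = suffN n 3 x + suffN n 3 c := by
  ext p
  simp only [suffN, Pi.add_apply, ← Finset.sum_add_distrib]
  exact Finset.sum_congr rfl fun σ _ => by split_ifs <;> rfl

theorem exists_add_single {n : ℕ} {x : Vote n → ℕ} {σ : Vote n} (h : 0 < x σ) :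
    ∃ x' : Vote n → ℕ, x = x' + Pi.single σ 1 := by
  refine ⟨Function.update x σ (x σ - 1), funext fun τ => ?_⟩
  rw [Pi.add_apply]
  by_cases hτ : τ = σ
  · subst hτ
    rw [Function.update_self, Pi.single_eq_same]
    omega
  · rw [Function.update_of_ne hτ, Pi.single_eq_of_ne hτ, add_zero]

theorem path_of_share {n m : ℕ} {B : Finset (Vote n → ℤ)} (hB : IsMarkovBasis n 3 B)
    {x y : Vote n → ℕ} (hx : ∑ σ, x σ = m + 1) (h : Share x y) :
    Path (B.filter fun z => moveDeg n 3 z ≤ m) x y := by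
  rw [isMarkovBasis_iff] at hB
  obtain ⟨hs, σ, hσ, hσ'⟩ := h
  obtain ⟨x, rfl⟩ := exists_add_single hσ
  obtain ⟨y, rfl⟩ := exists_add_single hσ'
  rw [suffN_add, suffN_add, add_left_inj] at hs
  refine (path_filter hB.1 (hB.2 x y hs) ?_).1.add _
  have : ∑ τ, (Pi.single σ 1 : Vote n → ℕ) τ = 1 := by
    rw [Finset.sum_pi_single']
    simp
  simp only [Pi.add_apply, Finset.sum_add_distrib, this] at hx
  omega

theorem path_of_conn {n m : ℕ} {B : Finset (Vote n → ℤ)} (hB : IsMarkovBasis n 3 B)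
    {x y : Vote n → ℕ} (hx : ∑ σ, x σ = m + 1) (h : Conn x y) :
    Path (B.filter fun z => moveDeg n 3 z ≤ m) x y := by
  induction h with
  | refl => exact Relation.ReflTransGen.refl
  | tail hc h ih =>
    exact ih.trans (path_of_share hB ((sum_eq_of_suffN_eq (Conn.suffN_eq hc)).symm.trans hx) h)

theorem isMarkovBasis_erase {n : ℕ} {B : Finset (Vote n → ℤ)} [DecidableEq (Vote n → ℤ)]
    (hB : IsMarkovBasis n 3 B) {z : Vote n → ℤ}
    (h : Path (B.erase z) (posVec (-z)) (posVec z)) : IsMarkovBasis n 3 (B.erase z) := by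
  rw [isMarkovBasis_iff] at hB ⊢
  have key : ∀ x y, diff x y ∈ B → Path (B.erase z) x y := by
    intro x y hxy
    by_cases hz : diff x y = z
    · obtain ⟨c, rfl, rfl⟩ := exists_add_of_diff_eq hz
      exact h.add c
    · exact Relation.ReflTransGen.single (Or.inl (Finset.mem_erase.2 ⟨hz, hxy⟩))
  refine ⟨fun z' hz' => hB.1 z' (Finset.mem_of_mem_erase hz'), fun x y hxy => ?_⟩
  have := hB.2 x y hxy
  clear hxy
  induction this with
  | refl => exact Relation.ReflTransGen.refl
  | tail _ h ih => exact ih.trans (h.elim (key _ _) fun h => (key _ _ h).symm)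

theorem exists_step_not_share {n : ℕ} {B : Finset (Vote n → ℤ)} {x y : Vote n → ℕ}
    (h : Path B x y) (hn : ¬ Conn x y) : ∃ x' y', Conn x x' ∧ Step B x' y' ∧ ¬ Share x' y' := by
  induction h with
  | refl => exact absurd Relation.ReflTransGen.refl hn
  | @tail y y' _ h ih =>
    by_cases hc : Conn x y
    · exact ⟨y, y', hc, h, fun hs => hn (hc.tail hs)⟩
    · exact ih hc

theorem posPart_diff_of_not_share {n : ℕ} {x y : Vote n → ℕ} (hs : suffN n 3 x = suffN n 3 y)
    (h : ¬ Share x y) : posVec (diff x y) = y := by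
  funext σ
  have : ¬ (0 < x σ ∧ 0 < y σ) := fun h' => h ⟨hs, σ, h'⟩
  simp only [posVec, diff]
  omega

section Minimal

variable {n : ℕ} {B : Finset (Vote n → ℤ)}

theorem suffN_posPart_neg {z : Vote n → ℤ} (hz : suffZ n 3 z = 0) :
    suffN n 3 (posVec (-z)) = suffN n 3 (posVec z) := by
  rwa [← suffZ_diff_eq_zero_iff, diff_posPart]

theorem not_path_erase [DecidableEq (Vote n → ℤ)] (hB : IsMarkovBasis n 3 B)
    (hmin : ∀ B' ⊂ B, ¬ IsMarkovBasis n 3 B') {z : Vote n → ℤ} (hz : z ∈ B) :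
    ¬ Path (B.erase z) (posVec (-z)) (posVec z) :=
  fun h => hmin _ (Finset.erase_ssubset hz) (isMarkovBasis_erase hB h)

theorem path_erase_of_conn [DecidableEq (Vote n → ℤ)] (hB : IsMarkovBasis n 3 B)
    {z : Vote n → ℤ} (hz : moveDeg n 3 z = 3) {x y : Vote n → ℕ} (hx : ∑ σ, x σ = 3)
    (h : Conn x y) : Path (B.erase z) x y :=
  (path_of_conn (m := 2) hB hx h).mono fun z' hz' => by
    obtain ⟨h1, h2⟩ := Finset.mem_filter.1 hz'
    refine Finset.mem_erase.2 ⟨?_, h1⟩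
    rintro rfl
    omega

theorem not_conn_posPart (hB : IsMarkovBasis n 3 B) (hmin : ∀ B' ⊂ B, ¬ IsMarkovBasis n 3 B')
    {z : Vote n → ℤ} (hz : z ∈ B) (hdeg : moveDeg n 3 z = 3) :
    ¬ Conn (posVec (-z)) (posVec z) := by
  classical
  have hs := sum_eq_of_suffN_eq (suffN_posPart_neg (hB.1 z hz))
  exact fun h => not_path_erase hB hmin hz (path_erase_of_conn hB hdeg (hs.trans hdeg) h)

theorem conn_or_conn {x y y' : Vote n → ℕ} (hx : ∑ σ, x σ = 3)
    (hy : suffN n 3 y = suffN n 3 x) (hy' : suffN n 3 y' = suffN n 3 x) (h : ¬ Conn x y)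
    (h' : ¬ Conn x y') : Conn y y' := by
  obtain ⟨X, rfl⟩ := exists_vec hx
  obtain ⟨y₀, -, h₀⟩ := conn_of_twoComps (twoComps_validSet X)
  exact ((h₀ y hy).resolve_left h).symm.trans ((h₀ y' hy').resolve_left h')

theorem suffN_posPart_injOn (hB : IsMarkovBasis n 3 B)
    (hmin : ∀ B' ⊂ B, ¬ IsMarkovBasis n 3 B') {z z' : Vote n → ℤ} (hz : z ∈ B)
    (hdeg : moveDeg n 3 z = 3) (hz' : z' ∈ B) (hdeg' : moveDeg n 3 z' = 3)
    (h : suffN n 3 (posVec z) = suffN n 3 (posVec z')) : z = z' := by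
  classical
  by_contra hne
  have hs := suffN_posPart_neg (hB.1 z hz)
  have hs' := suffN_posPart_neg (hB.1 z' hz')
  have hx : ∑ σ, posVec (-z) σ = 3 := (sum_eq_of_suffN_eq hs).trans hdeg
  have hx' : ∑ σ, posVec (-z') σ = 3 := (sum_eq_of_suffN_eq hs').trans hdeg'
  have hn := not_conn_posPart hB hmin hz hdeg
  have hn' := not_conn_posPart hB hmin hz' hdeg'
  have hstep : Path (B.erase z) (posVec (-z')) (posVec z') :=
    Relation.ReflTransGen.single (Or.inl (by
      rw [diff_posPart]
      exact Finset.mem_erase.2 ⟨Ne.symm hne, hz'⟩))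
  refine not_path_erase hB hmin hz ?_
  by_cases hc : Conn (posVec (-z)) (posVec (-z'))
  · have hc' : Conn (posVec z') (posVec z) :=
      conn_or_conn hx (h.symm.trans hs.symm) hs.symm (fun h => hn' (hc.symm.trans h)) hn
    exact ((path_erase_of_conn hB hdeg hx hc).trans hstep).trans
      (path_erase_of_conn hB hdeg hdeg' hc')
  · have h1 : Conn (posVec (-z')) (posVec z) :=
      conn_or_conn hx (hs'.trans (h.symm.trans hs.symm)) hs.symm hc hn
    have h2 : Conn (posVec (-z)) (posVec z') := by
      by_contra h2
      exact hn' (conn_or_conn hx (hs'.trans (h.symm.trans hs.symm)) (h.symm.trans hs.symm) hc h2)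
    exact ((path_erase_of_conn hB hdeg hx h2).trans hstep.symm).trans
      (path_erase_of_conn hB hdeg hx' h1)

theorem card_filter_moveDeg_eq (hB : IsMarkovBasis n 3 B)
    (hmin : ∀ B' ⊂ B, ¬ IsMarkovBasis n 3 B') :
    (B.filter fun z => moveDeg n 3 z = 3).card = (badStats n).card := by
  classical
  refine Finset.card_bij (fun z _ => suffN n 3 (posVec z)) (fun z hz => ?_)
    (fun z hz z' hz' h => ?_) fun t ht => ?_
  · obtain ⟨hz, hdeg⟩ := Finset.mem_filter.1 hz
    have hs := suffN_posPart_neg (hB.1 z hz)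
    obtain ⟨X, hX⟩ := exists_vec ((sum_eq_of_suffN_eq hs).trans hdeg)
    refine Finset.mem_image.2 ⟨X, (Finset.mem_filter_univ _).2 ⟨posVec z, ?_, ?_⟩, ?_⟩
    · rw [hX, hs]
    · rw [hX]
      exact not_conn_posPart hB hmin hz hdeg
    · rw [hX, hs]
  · obtain ⟨hz, hdeg⟩ := Finset.mem_filter.1 hz
    obtain ⟨hz', hdeg'⟩ := Finset.mem_filter.1 hz'
    exact suffN_posPart_injOn hB hmin hz hdeg hz' hdeg' h
  · obtain ⟨X, hX, rfl⟩ := Finset.mem_image.1 ht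
    rw [Finset.mem_filter_univ] at hX
    obtain ⟨y, hy, hn⟩ := hX
    obtain ⟨x', y', hx', hst, hsh⟩ :=
      exists_step_not_share ((isMarkovBasis_iff.1 hB).2 _ _ hy.symm) hn
    have hs := hst.suffN_eq hB.1
    have hxs : suffN n 3 x' = suffN n 3 (vec X) := (Conn.suffN_eq hx').symm
    have key : ∀ x y, suffN n 3 x = suffN n 3 y → suffN n 3 y = suffN n 3 (vec X) →
        ¬ Share x y → diff x y ∈ B →
        ∃ z, ∃ _ : z ∈ B.filter fun z => moveDeg n 3 z = 3, suffN n 3 (posVec z) =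
          suffN n 3 (vec X) := by
      intro x y hxy hy hsh hd
      have hp := posPart_diff_of_not_share hxy hsh
      refine ⟨diff x y, Finset.mem_filter.2 ⟨hd, ?_⟩, by rw [hp, hy]⟩
      change ∑ σ, posVec (diff x y) σ = 3
      rw [hp, sum_eq_of_suffN_eq hy, sum_vec]
    rcases hst with hst | hst
    · exact key x' y' hs (hs.symm.trans hxs) hsh hst
    · exact key y' x' hs.symm hxs (fun h => hsh h.symm) hst

end Minimal

end BirkhoffThree

/-- **Every minimal Markov basis for A_{n,3} contains exactly C(n,3) + 156·C(n,4) + 210·C(n,5) + 60·C(n,6) moves of degree three.** -/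
theorem count_deg_three_moves_r3
    (n : ℕ) (hn : 3 ≤ n)
    (B : Finset ((Fin 3 ↪ Fin n) → ℤ))
    (hB : IsMarkovBasis n 3 B)
    (hmin : ∀ B' ⊂ B, ¬ IsMarkovBasis n 3 B') :
    (B.filter fun z => moveDeg n 3 z = 3).card = n.choose 3 + 156 * n.choose 4 + 210 * n.choose 5 + 60 * n.choose 6 := by
  have : NeZero n := ⟨by omega⟩
  rw [BirkhoffThree.card_filter_moveDeg_eq hB hmin, BirkhoffThree.card_badStats]
end

section
/- For every integer n ≥ 4, every minimal Markov basis for A_{n,4} contains exactly 160·C(n,4) + 28040·C(n,5) + 86660·C(n,6) + 102480·C(n,7) + 57120·C(n,8) + 10080·C(n,9) moves of degree three, where C(n,k) denotes the binomial coefficient n choose k. -/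
section TreeCount

/-- A connected multigraph on a nonempty vertex set in which no edge is redundant has one edge
less than it has vertices. -/
lemma card_add_one_of_connected_of_irredundant {V ι : Type*} [Finite V] [Nonempty V] [DecidableEq ι]
    (I : Finset ι) (p q : ι → V)
    (hconn : (SimpleGraph.fromEdgeSet ((fun i => s(p i, q i)) '' (I : Set ι))).Preconnected)
    (hirr : ∀ i ∈ I, ¬ (SimpleGraph.fromEdgeSet
      ((fun i => s(p i, q i)) '' (I.erase i : Set ι))).Reachable (p i) (q i)) :
    I.card + 1 = Nat.card V := by
  classical
  have := Fintype.ofFinite V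
  set G := SimpleGraph.fromEdgeSet ((fun i => s(p i, q i)) '' (I : Set ι)) with hG
  have hne : ∀ i ∈ I, p i ≠ q i := fun i hi h => hirr i hi (h ▸ SimpleGraph.Reachable.refl _)
  have hinj : ∀ i ∈ I, ∀ j ∈ I, s(p i, q i) = s(p j, q j) → i = j := by
    intro i hi j hj h
    by_contra hij
    refine hirr i hi (SimpleGraph.Adj.reachable ?_)
    rw [SimpleGraph.fromEdgeSet_adj]
    exact ⟨⟨j, Finset.mem_coe.2 (Finset.mem_erase.2 ⟨Ne.symm hij, hj⟩), h.symm⟩, hne i hi⟩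
  have hedge : G.edgeSet = (fun i => s(p i, q i)) '' (I : Set ι) := by
    rw [hG, SimpleGraph.edgeSet_fromEdgeSet, sdiff_eq_left]
    rw [Set.disjoint_left]
    rintro _ ⟨i, hi, rfl⟩ h
    exact hne i hi (by simpa using h)
  have hacyc : G.IsAcyclic := by
    rw [SimpleGraph.isAcyclic_iff_forall_isBridge]
    intro e he
    rw [hedge] at he
    obtain ⟨i, hi, rfl⟩ := he
    rw [SimpleGraph.isBridge_iff]
    intro h
    refine hirr i hi (h.mono ?_)
    intro a b hab
    rw [SimpleGraph.deleteEdges_adj, hG, SimpleGraph.fromEdgeSet_adj] at hab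
    obtain ⟨⟨⟨j, hj, hjab⟩, hne'⟩, hnot⟩ := hab
    rw [SimpleGraph.fromEdgeSet_adj]
    refine ⟨⟨j, Finset.mem_coe.2 (Finset.mem_erase.2 ⟨?_, hj⟩), hjab⟩, hne'⟩
    rintro rfl
    exact hnot hjab.symm
  have htree : G.IsTree := ⟨⟨hconn⟩, hacyc⟩
  have hc := htree.card_edgeFinset
  rw [Nat.card_eq_fintype_card, ← hc]
  congr 1
  have : G.edgeFinset = I.image fun i => s(p i, q i) := by
    ext e
    rw [SimpleGraph.mem_edgeFinset, hedge]
    simp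
  rw [this, Finset.card_image_of_injOn fun i hi j hj h => hinj i hi j hj h]

end TreeCount

section Fibers

variable {n r : ℕ}

/-- The points of the fiber of `t`. -/
abbrev Fiber (t : Fin r × Fin n → ℕ) : Type :=
  {x : (Fin r ↪ Fin n) → ℕ // suffN n r x = t}

/-- Two points of a fiber have a common element in their supports. -/
def Shares {t : Fin r × Fin n → ℕ} (x y : Fiber t) : Prop :=
  ∃ σ, x.1 σ ≠ 0 ∧ y.1 σ ≠ 0

/-- The number of classes of the equivalence relation generated by `Shares`. -/
noncomputable def numClasses (t : Fin r × Fin n → ℕ) : ℕ :=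
  Nat.card (Quot (Shares (t := t)))

/-- One can pass from `x` to `y` by adding an element of `B` or its negative. -/
def Step (B : Finset ((Fin r ↪ Fin n) → ℤ)) (x y : (Fin r ↪ Fin n) → ℕ) : Prop :=
  (fun σ => (y σ : ℤ) - (x σ : ℤ)) ∈ B ∨ (fun σ => (x σ : ℤ) - (y σ : ℤ)) ∈ B

lemma Step.symm {B : Finset ((Fin r ↪ Fin n) → ℤ)} {x y : (Fin r ↪ Fin n) → ℕ}
    (h : Step B x y) : Step B y x := Or.symm h

lemma Step.add_right {B : Finset ((Fin r ↪ Fin n) → ℤ)} {x y : (Fin r ↪ Fin n) → ℕ}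
    (h : Step B x y) (s : (Fin r ↪ Fin n) → ℕ) : Step B (x + s) (y + s) := by
  simpa [Step] using h

open Relation

lemma reflTransGen_step_symm {B : Finset ((Fin r ↪ Fin n) → ℤ)} {x y : (Fin r ↪ Fin n) → ℕ}
    (h : ReflTransGen (Step B) x y) : ReflTransGen (Step B) y x :=
  have : Std.Symm (Step B) := ⟨fun _ _ => Step.symm⟩
  ReflTransGen.stdSymm.symm _ _ h

lemma reflTransGen_step_add_right {B : Finset ((Fin r ↪ Fin n) → ℤ)}
    {x y : (Fin r ↪ Fin n) → ℕ} (h : ReflTransGen (Step B) x y) (s : (Fin r ↪ Fin n) → ℕ) :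
    ReflTransGen (Step B) (x + s) (y + s) :=
  h.lift (· + s) fun _ _ h => h.add_right s

lemma suffN_add (x y : (Fin r ↪ Fin n) → ℕ) :
    suffN n r (x + y) = suffN n r x + suffN n r y := by
  funext p
  simp only [suffN, Pi.add_apply, ← Finset.sum_add_distrib]
  refine Finset.sum_congr rfl fun σ _ => ?_
  split_ifs <;> rfl

lemma suffZ_sub (x y : (Fin r ↪ Fin n) → ℕ) (p : Fin r × Fin n) :
    suffZ n r (fun σ => (y σ : ℤ) - (x σ : ℤ)) p = suffN n r y p - suffN n r x p := by
  simp only [suffN, suffZ, Nat.cast_sum, ← Finset.sum_sub_distrib]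
  refine Finset.sum_congr rfl fun σ _ => ?_
  split_ifs <;> simp

lemma suffN_eq_of_suffZ_eq_zero {x y : (Fin r ↪ Fin n) → ℕ}
    (h : suffZ n r (fun σ => (y σ : ℤ) - (x σ : ℤ)) = 0) : suffN n r x = suffN n r y := by
  funext p
  have := congrFun h p
  rw [suffZ_sub] at this
  simp only [Pi.zero_apply] at this
  omega

lemma Step.suffN_eq {B : Finset ((Fin r ↪ Fin n) → ℤ)} (hB : ∀ z ∈ B, suffZ n r z = 0)
    {x y : (Fin r ↪ Fin n) → ℕ} (h : Step B x y) : suffN n r x = suffN n r y := by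
  rcases h with h | h
  · exact suffN_eq_of_suffZ_eq_zero (hB _ h)
  · exact (suffN_eq_of_suffZ_eq_zero (hB _ h)).symm

lemma isMarkovBasis_iff {B : Finset ((Fin r ↪ Fin n) → ℤ)} :
    IsMarkovBasis n r B ↔ (∀ z ∈ B, suffZ n r z = 0) ∧
      ∀ x y, suffN n r x = suffN n r y → ReflTransGen (Step B) x y := by
  refine and_congr_right fun hB => forall₃_congr fun x y hxy => ⟨?_, fun h => ?_⟩
  · rintro ⟨m, w, rfl, rfl, -, hw⟩
    have : ∀ i ≤ m, ReflTransGen (Step B) (w 0) (w i) := by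
      intro i
      induction i with
      | zero => exact fun _ => .refl
      | succ i ih => exact fun hi => (ih (by omega)).tail (hw i (by omega))
    exact this m le_rfl
  · clear hxy
    induction h with
    | refl => exact ⟨0, fun _ => x, rfl, rfl, by simp, by simp⟩
    | @tail y z hxy hyz ih =>
      obtain ⟨m, w, h0, hm, hw, hs⟩ := ih
      refine ⟨m + 1, fun i => if i ≤ m then w i else z, by simpa using h0, by simp, ?_, ?_⟩
      · intro i hi
        by_cases him : i ≤ m
        · simpa [him] using hw i him
        · simp only [him, if_false]
          rw [← Step.suffN_eq hB hyz, ← hm, hw m le_rfl]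
      · intro i hi
        rcases Nat.lt_succ_iff_lt_or_eq.1 hi with h | rfl
        · simpa [h.le, Nat.succ_le_iff.2 h] using hs i h
        · simpa [hm, Step] using hyz

/-- The positive part of a move. -/
def movePos (z : (Fin r ↪ Fin n) → ℤ) : (Fin r ↪ Fin n) → ℕ := fun σ => (z σ).toNat

/-- The negative part of a move. -/
def moveNeg (z : (Fin r ↪ Fin n) → ℤ) : (Fin r ↪ Fin n) → ℕ := fun σ => (-z σ).toNat

lemma movePos_sub_moveNeg (z : (Fin r ↪ Fin n) → ℤ) :
    (fun σ => (movePos z σ : ℤ) - (moveNeg z σ : ℤ)) = z := by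
  funext σ
  simp only [movePos, moveNeg]
  omega

lemma suffN_moveNeg {z : (Fin r ↪ Fin n) → ℤ} (hz : suffZ n r z = 0) :
    suffN n r (moveNeg z) = suffN n r (movePos z) :=
  suffN_eq_of_suffZ_eq_zero (by rwa [movePos_sub_moveNeg])

lemma exists_eq_add_of_sub_eq {x y : (Fin r ↪ Fin n) → ℕ} {z : (Fin r ↪ Fin n) → ℤ}
    (h : (fun σ => (y σ : ℤ) - (x σ : ℤ)) = z) :
    ∃ s, y = movePos z + s ∧ x = moveNeg z + s := by
  subst h
  refine ⟨fun σ => min (x σ) (y σ), ?_, ?_⟩ <;> funext σ <;>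
    simp only [movePos, moveNeg, Pi.add_apply] <;> omega

lemma sum_suffN (x : (Fin r ↪ Fin n) → ℕ) (j : Fin r) :
    ∑ k, suffN n r x (j, k) = ∑ σ, x σ := by
  simp only [suffN]
  rw [Finset.sum_comm]
  simp

lemma sum_eq_of_suffN_eq [NeZero r] {x y : (Fin r ↪ Fin n) → ℕ}
    (h : suffN n r x = suffN n r y) : ∑ σ, x σ = ∑ σ, y σ := by
  rw [← sum_suffN x 0, ← sum_suffN y 0, h]

/-- Steps leading through points of total `d` use moves of degree at most `d`. -/
lemma Step.filter_le {B : Finset ((Fin r ↪ Fin n) → ℤ)} {x y : (Fin r ↪ Fin n) → ℕ}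
    (h : Step B x y) {d : ℕ} (hx : ∑ σ, x σ = d) (hy : ∑ σ, y σ = d) :
    Step (B.filter fun z => moveDeg n r z ≤ d) x y := by
  have key : ∀ {x y : (Fin r ↪ Fin n) → ℕ}, ∑ σ, y σ = d →
      moveDeg n r (fun σ => (y σ : ℤ) - (x σ : ℤ)) ≤ d := by
    intro x y hy
    rw [← hy]
    exact Finset.sum_le_sum fun σ _ => by simp only; omega
  rcases h with h | h
  · exact Or.inl (Finset.mem_filter.2 ⟨h, key hy⟩)
  · exact Or.inr (Finset.mem_filter.2 ⟨h, key hx⟩)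

lemma reflTransGen_step_filter_le [NeZero r] {B : Finset ((Fin r ↪ Fin n) → ℤ)}
    (hB : ∀ z ∈ B, suffZ n r z = 0) {x y : (Fin r ↪ Fin n) → ℕ}
    (h : ReflTransGen (Step B) x y) {d : ℕ} (hx : ∑ σ, x σ = d) :
    ∑ σ, y σ = d ∧ ReflTransGen (Step (B.filter fun z => moveDeg n r z ≤ d)) x y := by
  induction h with
  | refl => exact ⟨hx, .refl⟩
  | tail _ hyz ih =>
    have hz := (sum_eq_of_suffN_eq (hyz.suffN_eq hB)).symm.trans ih.1
    exact ⟨hz, ih.2.tail (hyz.filter_le ih.1 hz)⟩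

lemma Step.mono {B B' : Finset ((Fin r ↪ Fin n) → ℤ)} (h : B ⊆ B')
    {x y : (Fin r ↪ Fin n) → ℕ} : Step B x y → Step B' x y :=
  Or.imp (fun h' => h h') fun h' => h h'

lemma reflTransGen_step_mono {B B' : Finset ((Fin r ↪ Fin n) → ℤ)} (h : B ⊆ B')
    {x y : (Fin r ↪ Fin n) → ℕ} (hxy : ReflTransGen (Step B) x y) :
    ReflTransGen (Step B') x y :=
  hxy.lift id fun _ _ => Step.mono h

/-- Points with intersecting supports are connected by moves of smaller degree. -/
lemma reflTransGen_step_filter_lt [NeZero r] {B : Finset ((Fin r ↪ Fin n) → ℤ)}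
    (hB : IsMarkovBasis n r B) {t : Fin r × Fin n → ℕ} {x y : Fiber t} (h : Shares x y)
    {d : ℕ} (hx : ∑ σ, x.1 σ = d) :
    ReflTransGen (Step (B.filter fun z => moveDeg n r z < d)) x.1 y.1 := by
  classical
  obtain ⟨σ, hxσ, hyσ⟩ := h
  have key : ∀ x : (Fin r ↪ Fin n) → ℕ, x σ ≠ 0 →
      ∃ x' : (Fin r ↪ Fin n) → ℕ, x = x' + Pi.single σ 1 := by
    intro x hx
    refine ⟨fun τ => x τ - (Pi.single σ 1 : (Fin r ↪ Fin n) → ℕ) τ, ?_⟩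
    funext τ
    by_cases h : τ = σ
    · subst h
      simp only [Pi.add_apply, Pi.single_eq_same]
      omega
    · simp [h]
  obtain ⟨x', hx'⟩ := key x.1 hxσ
  obtain ⟨y', hy'⟩ := key y.1 hyσ
  rw [isMarkovBasis_iff] at hB
  have hxy : suffN n r x' = suffN n r y' := by
    have := x.2.trans y.2.symm
    rw [hx', hy', suffN_add, suffN_add] at this
    exact add_right_cancel this
  have hd : ∑ σ, x' σ + 1 = d := by
    rw [← hx, hx']
    simp [Finset.sum_add_distrib]
  have := (reflTransGen_step_filter_le hB.1 (hB.2 x' y' hxy) rfl).2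
  rw [hx', hy']
  refine reflTransGen_step_add_right (reflTransGen_step_mono ?_ this) _
  exact Finset.monotone_filter_right _ fun z _ hz => by omega

lemma le_of_suffN [NeZero r] (x : (Fin r ↪ Fin n) → ℕ) (σ : Fin r ↪ Fin n) :
    x σ ≤ suffN n r x (0, σ 0) := by
  have := Finset.single_le_sum (f := fun τ : Fin r ↪ Fin n => if τ 0 = σ 0 then x τ else 0)
    (fun _ _ => Nat.zero_le _) (Finset.mem_univ σ)
  simpa [suffN] using this

instance [NeZero r] (t : Fin r × Fin n → ℕ) : Finite (Fiber t) := by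
  have : Set.Finite {x : (Fin r ↪ Fin n) → ℕ | suffN n r x = t} := by
    refine (Set.finite_Iic fun σ => t (0, σ 0)).subset fun x hx σ => ?_
    rw [← show suffN n r x = t from hx]
    exact le_of_suffN x σ
  exact this

/-- In a minimal Markov basis, the moves of degree `d` in a fiber of total `d` form a spanning
tree of the classes of the fiber. -/
theorem card_moves_fiber [NeZero r] {B : Finset ((Fin r ↪ Fin n) → ℤ)}
    (hB : IsMarkovBasis n r B) (hmin : ∀ B' ⊂ B, ¬ IsMarkovBasis n r B')
    (t : Fin r × Fin n → ℕ) (d : ℕ) (hd : ∀ x : Fiber t, ∑ σ, x.1 σ = d) :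
    (B.filter fun z => moveDeg n r z = d ∧ suffN n r (movePos z) = t).card =
      numClasses t - 1 := by
  classical
  set I := B.filter fun z => moveDeg n r z = d ∧ suffN n r (movePos z) = t with hI
  have hI' : ∀ {z}, z ∈ I ↔ z ∈ B ∧ moveDeg n r z = d ∧ suffN n r (movePos z) = t := by simp [hI]
  rcases isEmpty_or_nonempty (Fiber t) with hE | ⟨⟨x₀⟩⟩
  · have h1 : numClasses t = 0 := by
      have : IsEmpty (Quot (Shares (t := t))) := ⟨fun q => hE.elim q.exists_rep.choose⟩
      exact Nat.card_of_isEmpty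
    have h2 : I = ∅ := Finset.eq_empty_of_forall_notMem fun z hz =>
      hE.elim ⟨movePos z, (hI'.1 hz).2.2⟩
    simp [h1, h2]
  have hmk := (isMarkovBasis_iff.1 hB)
  let V := Quot (Shares (t := t))
  have : Nonempty V := ⟨Quot.mk _ x₀⟩
  let cls : ((Fin r ↪ Fin n) → ℕ) → V := fun x =>
    if h : suffN n r x = t then Quot.mk _ ⟨x, h⟩ else Quot.mk _ x₀
  have hcls : ∀ x : Fiber t, cls x.1 = Quot.mk _ x := fun x => by simp [cls, x.2]
  have hpos : ∀ z ∈ I, suffN n r (movePos z) = t := fun z hz => (hI'.1 hz).2.2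
  have hneg : ∀ z ∈ I, suffN n r (moveNeg z) = t := fun z hz =>
    (suffN_moveNeg (hmk.1 z (hI'.1 hz).1)).trans (hpos z hz)
  have hstep : ∀ (J : Finset ((Fin r ↪ Fin n) → ℤ)) (x y : Fiber t),
      (fun σ => (y.1 σ : ℤ) - (x.1 σ : ℤ)) ∈ J → J = B →
      (SimpleGraph.fromEdgeSet ((fun z => s(cls (movePos z), cls (moveNeg z))) ''
        (I : Set ((Fin r ↪ Fin n) → ℤ)))).Reachable (Quot.mk _ x) (Quot.mk _ y) := by
    rintro _ x y hz rfl
    obtain ⟨s, hy, hx⟩ := exists_eq_add_of_sub_eq (x := x.1) (y := y.1) rfl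
    by_cases hs : s = 0
    · subst hs
      rw [add_zero] at hy hx
      set z := (fun σ => (y.1 σ : ℤ) - (x.1 σ : ℤ)) with hzdef
      have hzI : z ∈ I := by
        refine hI'.2 ⟨hz, ?_, hy ▸ y.2⟩
        rw [← hd y, hy]
        rfl
      by_cases hxy : (Quot.mk _ x : V) = Quot.mk _ y
      · rw [hxy]
      · refine (SimpleGraph.Adj.reachable ?_)
        rw [SimpleGraph.fromEdgeSet_adj]
        refine ⟨⟨z, hzI, ?_⟩, hxy⟩
        simp only
        rw [← hy, ← hx, hcls, hcls]
        exact Sym2.eq_swap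
    · obtain ⟨σ, hσ⟩ : ∃ σ, s σ ≠ 0 := by
        by_contra! h
        exact hs (funext h)
      have : Shares x y := ⟨σ, by rw [hx]; simp [hσ], by rw [hy]; simp [hσ]⟩
      rw [Quot.sound this]
  have hconn : (SimpleGraph.fromEdgeSet ((fun z => s(cls (movePos z), cls (moveNeg z))) ''
        (I : Set ((Fin r ↪ Fin n) → ℤ)))).Preconnected := by
    intro a b
    induction a using Quot.ind with | _ x => ?_
    induction b using Quot.ind with | _ y => ?_
    have key : ∀ w, ReflTransGen (Step B) x.1 w → ∃ h : suffN n r w = t,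
        (SimpleGraph.fromEdgeSet ((fun z => s(cls (movePos z), cls (moveNeg z))) ''
        (I : Set ((Fin r ↪ Fin n) → ℤ)))).Reachable (Quot.mk _ x) (Quot.mk _ ⟨w, h⟩) := by
      intro w hw
      induction hw with
      | refl => exact ⟨x.2, .refl _⟩
      | tail _ hvw ih =>
        obtain ⟨hv, hr⟩ := ih
        have hw := (hvw.suffN_eq hmk.1).symm.trans hv
        refine ⟨hw, hr.trans ?_⟩
        rcases hvw with h | h
        · exact hstep B ⟨_, hv⟩ ⟨_, hw⟩ h rfl
        · exact (hstep B ⟨_, hw⟩ ⟨_, hv⟩ h rfl).symm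
    exact (key y.1 (hmk.2 _ _ (x.2.trans y.2.symm))).2
  have hirr : ∀ z ∈ I, ¬ (SimpleGraph.fromEdgeSet
      ((fun z => s(cls (movePos z), cls (moveNeg z))) ''
        (I.erase z : Set ((Fin r ↪ Fin n) → ℤ)))).Reachable
        (cls (movePos z)) (cls (moveNeg z)) := by
    intro z hz hreach
    have hsame : ∀ x y : Fiber t, (Quot.mk _ x : V) = Quot.mk _ y →
        ReflTransGen (Step (B.erase z)) x.1 y.1 := by
      intro x y hxy
      have := Quot.eqvGen_exact hxy
      induction this with
      | rel x y h =>
        refine reflTransGen_step_mono ?_ (reflTransGen_step_filter_lt hB h (hd x))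
        intro w hw
        rw [Finset.mem_filter] at hw
        refine Finset.mem_erase.2 ⟨?_, hw.1⟩
        rintro rfl
        exact hw.2.ne (hI'.1 hz).2.1
      | refl => exact .refl
      | symm x y _ ih => exact reflTransGen_step_symm (ih (Quot.eqvGen_sound (by assumption)))
      | trans x y w _ _ ih1 ih2 =>
        exact (ih1 (Quot.eqvGen_sound (by assumption))).trans
          (ih2 (Quot.eqvGen_sound (by assumption)))
    have hedge : ∀ w ∈ I.erase z, ReflTransGen (Step (B.erase z)) (movePos w) (moveNeg w) := by
      intro w hw
      rw [Finset.mem_erase] at hw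
      refine .single (Or.inr ?_)
      rw [movePos_sub_moveNeg]
      exact Finset.mem_erase.2 ⟨hw.1, (hI'.1 hw.2).1⟩
    have hreach' : ∀ a b : V, (SimpleGraph.fromEdgeSet
        ((fun z => s(cls (movePos z), cls (moveNeg z))) ''
        (I.erase z : Set ((Fin r ↪ Fin n) → ℤ)))).Reachable a b →
        ∀ x y : Fiber t, Quot.mk _ x = a → Quot.mk _ y = b →
        ReflTransGen (Step (B.erase z)) x.1 y.1 := by
      intro a b hab
      rw [SimpleGraph.reachable_iff_reflTransGen] at hab
      induction hab with
      | refl => exact fun x y hx hy => hsame x y (hx.trans hy.symm)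
      | @tail b c _ hbc ih =>
        intro x y hx hy
        rw [SimpleGraph.fromEdgeSet_adj] at hbc
        obtain ⟨⟨w, hw, hwbc⟩, -⟩ := hbc
        have hwI := Finset.mem_of_mem_erase (Finset.mem_coe.1 hw)
        have h1 := hcls ⟨_, hpos w hwI⟩
        have h2 := hcls ⟨_, hneg w hwI⟩
        simp only at hwbc h1 h2
        rw [h1, h2, Sym2.eq_iff] at hwbc
        rcases hwbc with ⟨rfl, rfl⟩ | ⟨rfl, rfl⟩
        · exact ((ih x _ hx rfl).trans (hedge w hw)).trans (hsame ⟨_, hneg w hwI⟩ y hy.symm)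
        · exact ((ih x _ hx rfl).trans (reflTransGen_step_symm (hedge w hw))).trans
            (hsame ⟨_, hpos w hwI⟩ y hy.symm)
    have hz' : ReflTransGen (Step (B.erase z)) (movePos z) (moveNeg z) :=
      hreach' _ _ hreach ⟨_, hpos z hz⟩ ⟨_, hneg z hz⟩ (hcls ⟨_, hpos z hz⟩).symm
        (hcls ⟨_, hneg z hz⟩).symm
    refine hmin _ (Finset.erase_ssubset (hI'.1 hz).1) (isMarkovBasis_iff.2
      ⟨fun w hw => hmk.1 w (Finset.mem_of_mem_erase hw), fun x y hxy => ?_⟩)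
    have hone : ∀ x y : (Fin r ↪ Fin n) → ℕ, (fun σ => (y σ : ℤ) - (x σ : ℤ)) ∈ B →
        ReflTransGen (Step (B.erase z)) x y := by
      intro x y hxy
      by_cases h : (fun σ => (y σ : ℤ) - (x σ : ℤ)) = z
      · obtain ⟨s, rfl, rfl⟩ := exists_eq_add_of_sub_eq h
        exact reflTransGen_step_add_right (reflTransGen_step_symm hz') s
      · exact .single (Or.inl (Finset.mem_erase.2 ⟨h, hxy⟩))
    have := hmk.2 x y hxy
    induction this with
    | refl => exact .refl
    | tail _ hvw ih =>
      refine (ih ?_).trans ?_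
      · exact hxy.trans (hvw.suffN_eq hmk.1).symm
      · rcases hvw with h | h
        · exact hone _ _ h
        · exact reflTransGen_step_symm (hone _ _ h)
  have := card_add_one_of_connected_of_irredundant I (fun z => cls (movePos z))
    (fun z => cls (moveNeg z)) hconn hirr
  rw [numClasses]
  exact Nat.eq_sub_of_add_eq this

end Fibers
/-- Evaluation of a function at a numeral; in the kernel the argument is reduced first. -/
def force {α : Type} (a : ℕ) (f : ℕ → α) : α :=
  match Nat.add a 1 with
  | 0 => f 0
  | b + 1 => f b

/-- Concatenate the values of a function at the distinct rearrangements of a triple whose equal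
entries are adjacent. -/
def overArrangements (x y z : ℕ) (f : ℕ → ℕ → ℕ → List ℕ) : List ℕ :=
  bif Nat.beq x y then
    bif Nat.beq y z then f x y z else f x y z ++ (f x z y ++ f z x y)
  else bif Nat.beq y z then f x y z ++ (f y x z ++ f y z x)
  else f x y z ++ (f x z y ++ (f y x z ++ (f y z x ++ (f z x y ++ f z y x))))

/-- The triples differ in every coordinate. -/
def apart (x y z x' y' z' : ℕ) : Bool :=
  bif Nat.beq x x' then false else bif Nat.beq y y' then false else !Nat.beq z z'

/-- The position of `a` in a list of length three starting with `x` and `y`. -/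
def slot (x y a : ℕ) : ℕ :=
  bif Nat.beq a x then 0 else bif Nat.beq a y then 1 else 2

/-- Call a function with the entries of a list of length three. -/
def withEntries (c : List ℕ) (f : ℕ → ℕ → ℕ → List ℕ) : List ℕ :=
  match c with
  | [x, y, z] => force x fun x => force y fun y => force z fun z => f x y z
  | _ => []

/-- The arrays with the given columns and with distinct entries in each row, up to the order
of the rows; an array is recorded as the bit mask of the codes of its rows. -/
def arrayMasks (c₀ c₁ c₂ c₃ : List ℕ) : List ℕ :=
  withEntries c₀ fun x₀ y₀ z₀ => withEntries c₁ fun a₁ b₁ c₁ =>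
  withEntries c₂ fun a₂ b₂ c₂ => withEntries c₃ fun a₃ b₃ c₃ =>
    overArrangements a₁ b₁ c₁ fun x₁ y₁ z₁ =>
    bif apart x₀ y₀ z₀ x₁ y₁ z₁ then
      overArrangements a₂ b₂ c₂ fun x₂ y₂ z₂ =>
      bif apart x₀ y₀ z₀ x₂ y₂ z₂ && apart x₁ y₁ z₁ x₂ y₂ z₂ then
        overArrangements a₃ b₃ c₃ fun x₃ y₃ z₃ =>
        bif apart x₀ y₀ z₀ x₃ y₃ z₃ && (apart x₁ y₁ z₁ x₃ y₃ z₃ && apart x₂ y₂ z₂ x₃ y₃ z₃) then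
          let code := fun a b c d => Nat.add (slot x₀ y₀ a) (Nat.mul 3
            (Nat.add (slot a₁ b₁ b) (Nat.mul 3
              (Nat.add (slot a₂ b₂ c) (Nat.mul 3 (slot a₃ b₃ d))))))
          [Nat.lor (Nat.pow 2 (code x₀ x₁ x₂ x₃))
              (Nat.lor (Nat.pow 2 (code y₀ y₁ y₂ y₃))
                (Nat.pow 2 (code z₀ z₁ z₂ z₃)))]
          else []
      else []
    else []

/-- Add the bit mask `m` to a list of disjoint bit masks, merging those it meets. -/
def absorb : ℕ → List ℕ → List ℕ
  | m, [] => [m]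
  | m, c :: cs => bif Nat.beq (Nat.land m c) 0 then c :: absorb m cs else
      force (Nat.lor m c) fun d => absorb d cs

/-- The unions of the connected components of a list of bit masks. -/
def components : List ℕ → List ℕ
  | [] => []
  | m :: ms => force m fun m => absorb m (components ms)

/-- The number of components, minus one, of the arrays with the given columns. -/
def excess (c₀ c₁ c₂ c₃ : List ℕ) : ℕ :=
  (components (arrayMasks c₀ c₁ c₂ c₃)).length - 1

/-- The name, in the columns, of the `k`-th label if its profile is `p`: labels occurring in
column `j` only are all named `j`. -/
def labelName : ℕ × ℕ × ℕ × ℕ → ℕ → ℕ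
  | (a, b, c, d), k =>
    bif Nat.beq (Nat.add b (Nat.add c d)) 0 then 0
    else bif Nat.beq (Nat.add a (Nat.add c d)) 0 then 1
    else bif Nat.beq (Nat.add a (Nat.add b d)) 0 then 2
    else bif Nat.beq (Nat.add a (Nat.add b c)) 0 then 3
    else Nat.add k 4

/-- Put `a` copies of `x` in front of a list. -/
def prepend : ℕ → ℕ → List ℕ → List ℕ
  | 0, _, l => l
  | a + 1, x, l => x :: prepend a x l

/-- The profile fits in the columns without making one longer than three. -/
def fits (p : ℕ × ℕ × ℕ × ℕ) (c₀ c₁ c₂ c₃ : List ℕ) : Bool :=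
  Nat.ble (Nat.add p.1 c₀.length) 3 && (Nat.ble (Nat.add p.2.1 c₁.length) 3 &&
    (Nat.ble (Nat.add p.2.2.1 c₂.length) 3 && Nat.ble (Nat.add p.2.2.2 c₃.length) 3))

/-- Coefficientwise addition. -/
def addCoeffs : List ℕ → List ℕ → List ℕ
  | [], y => y
  | a :: x, [] => a :: x
  | a :: x, b :: y => Nat.add a b :: addCoeffs x y

/-- The coefficient list of `w` times the `k`-th basis element. -/
def monomialCoeffs (k m : ℕ) : ℕ → List ℕ
  | 0 => []
  | w + 1 => List.replicate k 0 ++ [m * (w + 1)]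

/-- Fill up column `j` to length three with the label name `j`. -/
def fillColumn (j : ℕ) (c : List ℕ) : List ℕ :=
  prepend (Nat.sub 3 c.length) j c

/-- Coefficients, in the basis of the binomial coefficients `n.choose k`, of the weighted number
of ways to add to the given columns labels with profiles from the list. -/
def countCoeffs (F : List ℕ → List ℕ → List ℕ → List ℕ → ℕ → ℕ → List ℕ) :
    List (ℕ × ℕ × ℕ × ℕ) → (c₀ c₁ c₂ c₃ : List ℕ) → (k m : ℕ) → List ℕ
  | [], c₀, c₁, c₂, c₃, k, m => F c₀ c₁ c₂ c₃ k m
  | p :: ps, c₀, c₁, c₂, c₃, k, m =>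
    addCoeffs (countCoeffs F ps c₀ c₁ c₂ c₃ k m) <|
    bif fits p c₀ c₁ c₂ c₃ then
      let l₁ := labelName p k
      let d₀ := prepend p.1 l₁ c₀
      let d₁ := prepend p.2.1 l₁ c₁
      let d₂ := prepend p.2.2.1 l₁ c₂
      let d₃ := prepend p.2.2.2 l₁ c₃
      addCoeffs (countCoeffs F ps d₀ d₁ d₂ d₃ (Nat.add k 1) (m * Nat.choose (Nat.add k 1) 1)) <|
      bif fits p d₀ d₁ d₂ d₃ then
        let l₂ := labelName p (Nat.add k 1)
        let e₀ := prepend p.1 l₂ d₀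
        let e₁ := prepend p.2.1 l₂ d₁
        let e₂ := prepend p.2.2.1 l₂ d₂
        let e₃ := prepend p.2.2.2 l₂ d₃
        addCoeffs (countCoeffs F ps e₀ e₁ e₂ e₃ (Nat.add k 2) (m * Nat.choose (Nat.add k 2) 2)) <|
        bif fits p e₀ e₁ e₂ e₃ then
          let l₃ := labelName p (Nat.add k 2)
          countCoeffs F ps (prepend p.1 l₃ e₀) (prepend p.2.1 l₃ e₁) (prepend p.2.2.1 l₃ e₂)
            (prepend p.2.2.2 l₃ e₃) (Nat.add k 3) (m * Nat.choose (Nat.add k 3) 3)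
        else []
      else []
    else []

/-- All columns have length three. -/
def full (c₀ c₁ c₂ c₃ : List ℕ) : Bool :=
  Nat.beq c₀.length 3 && (Nat.beq c₁.length 3 && (Nat.beq c₂.length 3 && Nat.beq c₃.length 3))

/-- The profiles of total between one and three supported on one column. -/
def privateProfiles : List (ℕ × ℕ × ℕ × ℕ) :=
  [(3, 0, 0, 0), (2, 0, 0, 0), (1, 0, 0, 0), (0, 3, 0, 0), (0, 2, 0, 0), (0, 1, 0, 0),
    (0, 0, 3, 0), (0, 0, 2, 0), (0, 0, 1, 0), (0, 0, 0, 3), (0, 0, 0, 2), (0, 0, 0, 1)]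

/-- The profiles of total at most three supported on more than one column. -/
def sharedProfiles : List (ℕ × ℕ × ℕ × ℕ) :=
  [(2, 1, 0, 0), (2, 0, 1, 0), (2, 0, 0, 1), (1, 2, 0, 0), (1, 1, 1, 0), (1, 1, 0, 1),
    (1, 1, 0, 0), (1, 0, 2, 0), (1, 0, 1, 1), (1, 0, 1, 0), (1, 0, 0, 2), (1, 0, 0, 1),
    (0, 2, 1, 0), (0, 2, 0, 1), (0, 1, 2, 0), (0, 1, 1, 1), (0, 1, 1, 0), (0, 1, 0, 2),
    (0, 1, 0, 1), (0, 0, 2, 1), (0, 0, 1, 2), (0, 0, 1, 1)]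

/-- The contribution of full columns with `w` excess components. -/
def fullCoeffs (w : ℕ) (c₀ c₁ c₂ c₃ : List ℕ) (k m : ℕ) : List ℕ :=
  bif full c₀ c₁ c₂ c₃ then monomialCoeffs k m w else []

/-- The contribution of columns that are to be completed with labels occurring in one column
only; the number of components does not depend on the way of completion. -/
def completionCoeffs (c₀ c₁ c₂ c₃ : List ℕ) (k m : ℕ) : List ℕ :=
  match excess (fillColumn 0 c₀) (fillColumn 1 c₁) (fillColumn 2 c₂) (fillColumn 3 c₃) with
  | 0 => []
  | w + 1 => countCoeffs (fullCoeffs (w + 1)) privateProfiles c₀ c₁ c₂ c₃ k m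

@[simp] lemma force_eq {α : Type} (a : ℕ) (f : ℕ → α) : force a f = f a := rfl

section Components

lemma and_eq_zero_iff {a b : ℕ} : a &&& b = 0 ↔ ∀ i, a.testBit i → ¬ b.testBit i := by
  constructor
  · intro h i ha hb
    have := Nat.testBit_and a b i
    rw [h, ha, hb] at this
    simp at this
  · intro h
    refine Nat.eq_of_testBit_eq fun i => ?_
    have := h i
    rw [Nat.testBit_and]
    cases ha : a.testBit i <;> simp_all

lemma exists_testBit {a : ℕ} (h : a ≠ 0) : ∃ i, a.testBit i := by
  by_contra! h'
  exact h (Nat.eq_of_testBit_eq fun i => by simpa using h' i)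

lemma absorb_cons (m c : ℕ) (cs : List ℕ) :
    absorb m (c :: cs) = if m &&& c = 0 then c :: absorb m cs else absorb (m ||| c) cs := by
  change (bif Nat.beq (m &&& c) 0 then c :: absorb m cs else absorb (m ||| c) cs) = _
  by_cases h : m &&& c = 0
  · simp [h]
  · have : Nat.beq (m &&& c) 0 = false := by
      rw [Bool.eq_false_iff]
      exact fun h' => h (Nat.eq_of_beq_eq_true h')
    simp [h, this]

/-- Every mask is contained in one of the masks after merging. -/
lemma exists_mem_absorb (m : ℕ) (cs : List ℕ) {c : ℕ} (hc : c ∈ m :: cs) :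
    ∃ d ∈ absorb m cs, ∀ i, c.testBit i → d.testBit i := by
  induction cs generalizing m c with
  | nil => exact ⟨c, hc, fun _ => id⟩
  | cons e cs ih =>
    rw [absorb_cons]
    split_ifs with h
    · rcases List.mem_cons.1 hc with rfl | hc
      · obtain ⟨d, hd, h'⟩ := ih c (c := c) (by simp)
        exact ⟨d, List.mem_cons_of_mem _ hd, h'⟩
      · rcases List.mem_cons.1 hc with rfl | hc
        · exact ⟨c, by simp, fun _ => id⟩
        · obtain ⟨d, hd, h'⟩ := ih m (c := c) (by simp [hc])
          exact ⟨d, List.mem_cons_of_mem _ hd, h'⟩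
    · rcases List.mem_cons.1 hc with rfl | hc
      · obtain ⟨d, hd, h'⟩ := ih (c ||| e) (c := c ||| e) (by simp)
        exact ⟨d, hd, fun i hi => h' i (by simp [Nat.testBit_or, hi])⟩
      · rcases List.mem_cons.1 hc with rfl | hc
        · obtain ⟨d, hd, h'⟩ := ih (m ||| c) (c := m ||| c) (by simp)
          exact ⟨d, hd, fun i hi => h' i (by simp [Nat.testBit_or, hi])⟩
        · exact ih (m ||| e) (by simp [hc])

lemma exists_of_mem_absorb (m : ℕ) (cs : List ℕ) {d i : ℕ} (hd : d ∈ absorb m cs)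
    (hi : d.testBit i) : ∃ c ∈ m :: cs, c.testBit i := by
  induction cs generalizing m with
  | nil => exact ⟨d, hd, hi⟩
  | cons e cs ih =>
    rw [absorb_cons] at hd
    split_ifs at hd with h
    · rcases List.mem_cons.1 hd with rfl | hd
      · exact ⟨d, by simp, hi⟩
      · obtain ⟨c, hc, h'⟩ := ih m hd
        refine ⟨c, ?_, h'⟩
        rcases List.mem_cons.1 hc with rfl | hc <;> simp [*]
    · obtain ⟨c, hc, h'⟩ := ih _ hd
      rcases List.mem_cons.1 hc with rfl | hc
      · rw [Nat.testBit_or, Bool.or_eq_true] at h'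
        rcases h' with h' | h'
        · exact ⟨m, by simp, h'⟩
        · exact ⟨e, by simp, h'⟩
      · exact ⟨c, by simp [hc], h'⟩

lemma absorb_pairwise (m : ℕ) {cs : List ℕ} (h : cs.Pairwise fun c d => c &&& d = 0) :
    (absorb m cs).Pairwise fun c d => c &&& d = 0 := by
  induction cs generalizing m with
  | nil => exact List.pairwise_singleton _ _
  | cons e cs ih =>
    rw [List.pairwise_cons] at h
    rw [absorb_cons]
    split_ifs with hm
    · refine List.pairwise_cons.2 ⟨fun d hd => and_eq_zero_iff.2 fun i he hdi => ?_, ih m h.2⟩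
      obtain ⟨c, hc, hci⟩ := exists_of_mem_absorb m cs hd hdi
      rcases List.mem_cons.1 hc with rfl | hc
      · exact and_eq_zero_iff.1 hm i hci he
      · exact and_eq_zero_iff.1 (h.1 c hc) i he hci
    · exact ih _ h.2

lemma absorb_related {R : ℕ → ℕ → Prop} (htrans : ∀ a b c, R a b → R b c → R a c) (m : ℕ)
    (cs : List ℕ)
    (h : ∀ c ∈ m :: cs, c ≠ 0 ∧ ∀ i j, c.testBit i → c.testBit j → R i j) :
    ∀ c ∈ absorb m cs, c ≠ 0 ∧ ∀ i j, c.testBit i → c.testBit j → R i j := by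
  induction cs generalizing m with
  | nil => exact h
  | cons e cs ih =>
    rw [absorb_cons]
    split_ifs with hm
    · intro c hc
      rcases List.mem_cons.1 hc with rfl | hc
      · exact h c (by simp)
      · refine ih m (fun c hc => h c ?_) c hc
        rcases List.mem_cons.1 hc with rfl | hc <;> simp [*]
    · refine ih _ fun c hc => ?_
      rcases List.mem_cons.1 hc with rfl | hc
      · obtain ⟨k, hk⟩ := exists_testBit hm
        rw [Nat.testBit_and, Bool.and_eq_true] at hk
        have h1 := (h m (by simp)).2
        have h2 := (h e (by simp)).2
        refine ⟨fun h0 => ?_, fun i j hi hj => ?_⟩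
        · have := congrArg (fun a => a.testBit k) h0
          simp [Nat.testBit_or, hk.1] at this
        · simp only [Nat.testBit_or, Bool.or_eq_true] at hi hj
          refine htrans i k j ?_ ?_
          · exact hi.elim (fun hi => h1 _ _ hi hk.1) fun hi => h2 _ _ hi hk.2
          · exact hj.elim (fun hj => h1 _ _ hk.1 hj) fun hj => h2 _ _ hk.2 hj
      · exact h c (by simp [hc])

lemma exists_mem_components (xs : List ℕ) {x : ℕ} (hx : x ∈ xs) :
    ∃ d ∈ components xs, ∀ i, x.testBit i → d.testBit i := by
  induction xs with
  | nil => simp at hx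
  | cons y xs ih =>
    rcases List.mem_cons.1 hx with rfl | hx
    · exact exists_mem_absorb _ _ (by simp)
    · obtain ⟨c, hc, h⟩ := ih hx
      obtain ⟨d, hd, h'⟩ := exists_mem_absorb y (components xs) (List.mem_cons_of_mem _ hc)
      exact ⟨d, hd, fun i hi => h' i (h i hi)⟩

lemma components_pairwise (xs : List ℕ) :
    (components xs).Pairwise fun c d => c &&& d = 0 := by
  induction xs with
  | nil => exact List.Pairwise.nil
  | cons y xs ih => exact absorb_pairwise y ih

lemma components_related {R : ℕ → ℕ → Prop} (htrans : ∀ a b c, R a b → R b c → R a c)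
    (xs : List ℕ) (h : ∀ x ∈ xs, x ≠ 0 ∧ ∀ i j, x.testBit i → x.testBit j → R i j) :
    ∀ c ∈ components xs, c ≠ 0 ∧ ∀ i j, c.testBit i → c.testBit j → R i j := by
  induction xs with
  | nil => simp [components]
  | cons y xs ih =>
    refine absorb_related htrans y (components xs) fun c hc => ?_
    rcases List.mem_cons.1 hc with rfl | hc
    · exact h c (by simp)
    · exact ih (fun x hx => h x (by simp [hx])) c hc

/-- The classes of the equivalence relation generated by having a common bit. -/
theorem card_quot_meets (xs : List ℕ) (h0 : ∀ x ∈ xs, x ≠ 0) :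
    Nat.card (Quot fun a b : {x // x ∈ xs} => a.1 &&& b.1 ≠ 0) = (components xs).length := by
  classical
  set M := fun a b : {x // x ∈ xs} => a.1 &&& b.1 ≠ 0 with hM
  have meet : ∀ {a b : {x // x ∈ xs}} {i : ℕ}, a.1.testBit i → b.1.testBit i →
      Quot.mk M a = Quot.mk M b := fun ha hb =>
    Quot.sound fun h => and_eq_zero_iff.1 h _ ha hb
  have hrel := components_related (R := fun i j => ∃ x y : {x // x ∈ xs}, x.1.testBit i ∧
      y.1.testBit j ∧ Quot.mk M x = Quot.mk M y)
    (by
      rintro a b c ⟨x, y, hx, hy, hxy⟩ ⟨x', y', hx', hy', hxy'⟩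
      exact ⟨x, y', hx, hy', hxy.trans ((meet hy hx').trans hxy')⟩) xs
    (fun x hx => ⟨h0 x hx, fun i j hi hj => ⟨⟨x, hx⟩, ⟨x, hx⟩, hi, hj, rfl⟩⟩)
  have hdisj : ∀ c ∈ components xs, ∀ d ∈ components xs, ∀ i, c.testBit i → d.testBit i →
      c = d := by
    intro c hc d hd i hci hdi
    by_contra hne
    refine and_eq_zero_iff.1 ?_ i hci hdi
    have : Std.Symm fun c d : ℕ => c &&& d = 0 := ⟨fun a b h => by rwa [Nat.land_comm] at h⟩
    exact (components_pairwise xs).forall hc hd hne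
  have hnodup : (components xs).Nodup := by
    refine List.Pairwise.imp_of_mem ?_ (components_pairwise xs)
    rintro a b ha - hab rfl
    exact (hrel a ha).1 (by simpa using hab)
  choose f hf hsub using fun x : {x // x ∈ xs} => exists_mem_components xs x.2
  let g : Quot M → {c // c ∈ components xs} := Quot.lift (fun x => ⟨f x, hf x⟩) (by
    intro a b hab
    obtain ⟨i, hi⟩ := exists_testBit hab
    rw [Nat.testBit_and, Bool.and_eq_true] at hi
    exact Subtype.ext (hdisj _ (hf a) _ (hf b) i (hsub a i hi.1) (hsub b i hi.2)))
  have hg : Function.Bijective g := by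
    constructor
    · intro a b
      induction a using Quot.ind with | _ a => ?_
      induction b using Quot.ind with | _ b => ?_
      intro hab
      have hab' : f a = f b := congrArg Subtype.val hab
      obtain ⟨i, hi⟩ := exists_testBit (h0 a.1 a.2)
      obtain ⟨j, hj⟩ := exists_testBit (h0 b.1 b.2)
      obtain ⟨x, y, hx, hy, hxy⟩ :=
        (hrel (f a) (hf a)).2 i j (hsub a i hi) (hab' ▸ hsub b j hj)
      exact (meet hi hx).trans (hxy.trans (meet hy hj))
    · rintro ⟨c, hc⟩
      obtain ⟨i, hi⟩ := exists_testBit (hrel c hc).1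
      obtain ⟨x, -, hx, -, -⟩ := (hrel c hc).2 i i hi hi
      exact ⟨Quot.mk _ x, Subtype.ext (hdisj _ (hf x) _ hc i (hsub x i hx) hi)⟩
  rw [Nat.card_eq_of_bijective g hg, ← List.toFinset_card_of_nodup hnodup, ← Fintype.card_coe,
    ← Nat.card_eq_fintype_card]
  exact Nat.card_congr (Equiv.subtypeEquivRight fun _ => List.mem_toFinset.symm)

end Components

section Arrays

variable {n r : ℕ}

lemma suffN_count (X : Multiset (Fin r ↪ Fin n)) (j : Fin r) (k : Fin n) :
    suffN n r (fun σ => X.count σ) (j, k) = (X.map fun σ => σ j).count k := by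
  simp only [suffN]
  induction X using Multiset.induction with
  | empty => simp
  | cons σ X ih =>
    rw [Multiset.map_cons, Multiset.count_cons, ← ih]
    have : ∀ τ : Fin r ↪ Fin n, (if τ j = k then Multiset.count τ (σ ::ₘ X) else 0) =
        (if τ j = k then X.count τ else 0) + if τ = σ then (if k = σ j then 1 else 0) else 0 := by
      intro τ
      rw [Multiset.count_cons]
      by_cases h : τ = σ
      · subst h
        by_cases h' : τ j = k <;> simp [h', eq_comm (a := k)]
      · simp [h]
    rw [Finset.sum_congr rfl fun τ _ => this τ, Finset.sum_add_distrib]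
    simp

/-- The multiset of entries of column `j`. -/
def column (t : Fin r × Fin n → ℕ) (j : Fin r) : Multiset (Fin n) :=
  ∑ k, Multiset.replicate (t (j, k)) k

lemma count_column (t : Fin r × Fin n → ℕ) (j : Fin r) (k : Fin n) :
    (column t j).count k = t (j, k) := by
  simp [column, Multiset.count_sum', Multiset.count_replicate]

lemma mem_column {t : Fin r × Fin n → ℕ} {j : Fin r} {k : Fin n} :
    k ∈ column t j ↔ t (j, k) ≠ 0 := by
  rw [← count_column t, Multiset.count_ne_zero]

lemma suffN_count_eq_iff {t : Fin r × Fin n → ℕ} {X : Multiset (Fin r ↪ Fin n)} :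
    suffN n r (fun σ => X.count σ) = t ↔ ∀ j, (X.map fun σ => σ j) = column t j := by
  simp only [funext_iff, Prod.forall, suffN_count, Multiset.ext, count_column]

lemma exists_eq_count (x : (Fin r ↪ Fin n) → ℕ) :
    ∃ X : Multiset (Fin r ↪ Fin n), x = fun σ => X.count σ := by
  refine ⟨∑ σ, Multiset.replicate (x σ) σ, ?_⟩
  funext τ
  simp [Multiset.count_sum', Multiset.count_replicate]

/-- A rearrangement of the images can be lifted. -/
lemma exists_list_map_eq {α : Type*} (g : α → ℕ) (l : List ℕ) (M : Multiset α)
    (h : (l : Multiset ℕ) = M.map g) : ∃ l' : List α, (l' : Multiset α) = M ∧ l'.map g = l := by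
  induction l generalizing M with
  | nil =>
    refine ⟨[], ?_, rfl⟩
    simpa [eq_comm] using h
  | cons a l ih =>
    obtain ⟨u, hu, rfl⟩ := Multiset.mem_map.1 (h ▸ (by simp : a ∈ ((a :: l : List ℕ) : Multiset ℕ)))
    obtain ⟨M', rfl⟩ := Multiset.exists_cons_of_mem hu
    rw [Multiset.map_cons, ← Multiset.cons_coe, Multiset.cons_inj_right] at h
    obtain ⟨l', hl', h'⟩ := ih M' h
    exact ⟨u :: l', by rw [← Multiset.cons_coe, hl'], by simp [h']⟩

/-- The point of a fiber given by a multiset of rows. -/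
def fiberMk {t : Fin r × Fin n → ℕ} (X : Multiset (Fin r ↪ Fin n))
    (h : ∀ j, (X.map fun σ => σ j) = column t j) : Fiber t :=
  ⟨fun σ => X.count σ, suffN_count_eq_iff.2 h⟩

lemma shares_fiberMk {t : Fin r × Fin n → ℕ} {X Y : Multiset (Fin r ↪ Fin n)}
    {hX : ∀ j, (X.map fun σ => σ j) = column t j} {hY : ∀ j, (Y.map fun σ => σ j) = column t j} :
    Shares (fiberMk X hX) (fiberMk Y hY) ↔ ∃ σ ∈ X, σ ∈ Y := by
  simp only [Shares, fiberMk, Multiset.count_ne_zero]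

lemma exists_eq_fiberMk {t : Fin r × Fin n → ℕ} (x : Fiber t) :
    ∃ X h, x = fiberMk X h := by
  obtain ⟨x, hx⟩ := x
  obtain ⟨X, rfl⟩ := exists_eq_count x
  exact ⟨X, suffN_count_eq_iff.1 hx, rfl⟩

lemma ne_zero_of_mem {t : Fin r × Fin n → ℕ} {X : Multiset (Fin r ↪ Fin n)}
    (hX : ∀ j, (X.map fun σ => σ j) = column t j) {σ : Fin r ↪ Fin n} (hσ : σ ∈ X) (j : Fin r) :
    t (j, σ j) ≠ 0 := by
  rw [← mem_column, ← hX]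
  exact Multiset.mem_map_of_mem _ hσ

/-- Replace one value of an embedding by a value it does not take. -/
lemma exists_update (τ : Fin r ↪ Fin n) (c : Fin r) (u : Fin n) (h : ∀ i ≠ c, τ i ≠ u) :
    ∃ τ' : Fin r ↪ Fin n, τ' c = u ∧ ∀ i ≠ c, τ' i = τ i := by
  refine ⟨⟨Function.update τ c u, ?_⟩, Function.update_self c u τ,
    fun i hi => Function.update_of_ne hi u τ⟩
  intro a b hab
  by_cases ha : a = c <;> by_cases hb : b = c
  · rw [ha, hb]
  · subst ha
    simp only [Function.update_self, Function.update_of_ne hb] at hab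
    exact absurd hab.symm (h b hb)
  · subst hb
    simp only [Function.update_self, Function.update_of_ne ha] at hab
    exact absurd hab (h a ha)
  · simpa [ha, hb] using hab

/-- An entry occurring only in column `c` can be exchanged with another one without leaving the
class. -/
lemma exists_exchange {t : Fin r × Fin n → ℕ} {Y : Multiset (Fin r ↪ Fin n)}
    (hY : ∀ j, (Y.map fun σ => σ j) = column t j) (hcard : 3 ≤ Y.card) {τ : Fin r ↪ Fin n}
    (hτ : τ ∈ Y) {c : Fin r} {u : Fin n} (hu : t (c, u) ≠ 0) (hu' : ∀ i ≠ c, t (i, u) = 0)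
    (hτ' : ∀ i ≠ c, t (i, τ c) = 0) :
    ∃ Y' hY', Quot.mk Shares (fiberMk (t := t) Y' hY') = Quot.mk Shares (fiberMk Y hY) ∧
      ∃ τ' ∈ Y', τ' c = u ∧ ∀ i ≠ c, τ' i = τ i := by
  by_cases hne : τ c = u
  · exact ⟨Y, hY, rfl, τ, hτ, hne, fun _ _ => rfl⟩
  obtain ⟨ρ, hρ, hρu⟩ : ∃ ρ ∈ Y, ρ c = u := by
    rw [← mem_column, ← hY, Multiset.mem_map] at hu
    exact hu
  have hρτ : ρ ≠ τ := by
    rintro rfl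
    exact hne hρu
  obtain ⟨Y₁, rfl⟩ := Multiset.exists_cons_of_mem hτ
  obtain ⟨Y₂, rfl⟩ := Multiset.exists_cons_of_mem ((Multiset.mem_cons.1 hρ).resolve_left hρτ)
  obtain ⟨π, hπ⟩ : ∃ π, π ∈ Y₂ := by
    apply Multiset.exists_mem_of_ne_zero
    rintro rfl
    simp at hcard
  obtain ⟨τ', hτ'c, hτ'i⟩ := exists_update τ c u fun i hi h =>
    ne_zero_of_mem hY hτ i (h ▸ hu' i hi)
  obtain ⟨ρ', hρ'c, hρ'i⟩ := exists_update ρ c (τ c) fun i hi h =>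
    ne_zero_of_mem hY hρ i (h ▸ hτ' i hi)
  have hY' : ∀ j, ((τ' ::ₘ ρ' ::ₘ Y₂).map fun σ => σ j) = column t j := by
    intro j
    rw [← hY]
    simp only [Multiset.map_cons]
    by_cases hj : j = c
    · subst hj
      rw [hτ'c, hρ'c, hρu, Multiset.cons_swap]
    · rw [hτ'i j hj, hρ'i j hj]
  refine ⟨_, hY', Quot.sound (shares_fiberMk.2 ⟨π, ?_, ?_⟩), τ', ?_, hτ'c, hτ'i⟩ <;> simp [hπ]

/-- Labels that occur in the table and have the same name occur in one column only. -/
def GoodNames (t : Fin r × Fin n → ℕ) (g : Fin n → ℕ) : Prop :=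
  ∀ u v, u ≠ v → (∃ j, t (j, u) ≠ 0) → (∃ j, t (j, v) ≠ 0) → g u = g v →
    ∃ c, ∀ i ≠ c, t (i, u) = 0 ∧ t (i, v) = 0

/-- Points containing rows with the same names are in the same class. -/
lemma mk_eq_of_names_eq {t : Fin r × Fin n → ℕ} {g : Fin n → ℕ} (hg : GoodNames t g)
    {X Y : Multiset (Fin r ↪ Fin n)} (hX : ∀ j, (X.map fun σ => σ j) = column t j)
    (hY : ∀ j, (Y.map fun σ => σ j) = column t j) (hcard : ∀ j, 3 ≤ (column t j).card)
    {σ τ : Fin r ↪ Fin n} (hσ : σ ∈ X) (hτ : τ ∈ Y) (h : ∀ j, g (σ j) = g (τ j)) :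
    Quot.mk Shares (fiberMk X hX) = Quot.mk Shares (fiberMk Y hY) := by
  have key : ∀ J : Finset (Fin r), ∃ Y' hY',
      Quot.mk Shares (fiberMk (t := t) Y' hY') = Quot.mk Shares (fiberMk Y hY) ∧
      ∃ τ' ∈ Y', ∀ j, τ' j = if j ∈ J then σ j else τ j := by
    intro J
    induction J using Finset.induction_on with
    | empty => exact ⟨Y, hY, rfl, τ, hτ, by simp⟩
    | insert c J hc ih =>
      obtain ⟨Y', hY', hmk, τ', hτ', hτ'j⟩ := ih
      have hc' : τ' c = τ c := by simp [hτ'j, hc]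
      by_cases hne : σ c = τ c
      · refine ⟨Y', hY', hmk, τ', hτ', fun j => ?_⟩
        by_cases hj : j = c
        · simp [hj, hc', hne]
        · simp [hτ'j, hj]
      obtain ⟨c', hcc⟩ := hg _ _ hne ⟨c, ne_zero_of_mem hX hσ c⟩ ⟨c, ne_zero_of_mem hY hτ c⟩ (h c)
      obtain rfl : c = c' := by
        by_contra h'
        exact ne_zero_of_mem hX hσ c (hcc c h').1
      obtain ⟨Y'', hY'', hmk', τ'', hτ'', h1, h2⟩ := exists_exchange hY'
        (by rw [← Multiset.card_map (fun σ : Fin r ↪ Fin n => σ c), hY']; exact hcard c) hτ'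
        (ne_zero_of_mem hX hσ c) (fun i hi => (hcc i hi).1) (fun i hi => by
          rw [hc']
          exact (hcc i hi).2)
      refine ⟨Y'', hY'', hmk'.trans hmk, τ'', hτ'', fun j => ?_⟩
      by_cases hj : j = c
      · simp [hj, h1]
      · simp [h2 j hj, hτ'j, hj]
  obtain ⟨Y', hY', hmk, τ', hτ', hτ'j⟩ := key Finset.univ
  obtain rfl : τ' = σ := by
    ext j
    simp [hτ'j]
  exact (Quot.sound (shares_fiberMk.2 ⟨τ', hσ, hτ'⟩)).trans hmk

lemma names_injective {t : Fin r × Fin n → ℕ} {g : Fin n → ℕ} (hg : GoodNames t g)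
    {X : Multiset (Fin r ↪ Fin n)} (hX : ∀ j, (X.map fun σ => σ j) = column t j)
    {σ : Fin r ↪ Fin n} (hσ : σ ∈ X) : Function.Injective fun j => g (σ j) := by
  intro i j hij
  by_contra hne
  have hi := ne_zero_of_mem hX hσ i
  have hj := ne_zero_of_mem hX hσ j
  obtain ⟨c, hc⟩ := hg _ _ (fun h => hne (σ.injective h)) ⟨i, hi⟩ ⟨j, hj⟩ hij
  have h1 : i = c := by
    by_contra h
    exact hi (hc i h).1
  have h2 : j = c := by
    by_contra h
    exact hj (hc j h).2
  exact hne (h1.trans h2.symm)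

lemma card_quot_eq {α β : Type*} {R : α → α → Prop} {S : β → β → Prop} (f : α → β)
    (hf : Function.Surjective f) (hS : ∀ b, S b b) (h1 : ∀ a a', R a a' → S (f a) (f a'))
    (h2 : ∀ a a', S (f a) (f a') → Quot.mk R a = Quot.mk R a') :
    Nat.card (Quot R) = Nat.card (Quot S) := by
  refine Nat.card_eq_of_bijective (Quot.map f h1) ⟨?_, ?_⟩
  · intro a b
    induction a using Quot.ind with | _ a => ?_
    induction b using Quot.ind with | _ b => ?_
    intro hab
    have key : ∀ b b', Relation.EqvGen S b b' → ∀ a a', f a = b → f a' = b' →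
        Quot.mk R a = Quot.mk R a' := by
      intro b b' h
      induction h with
      | rel b b' h =>
        rintro a a' rfl rfl
        exact h2 a a' h
      | refl b =>
        rintro a a' rfl h
        exact h2 a a' (h ▸ hS _)
      | symm b b' _ ih => exact fun a a' ha ha' => (ih a' a ha' ha).symm
      | trans b c d _ _ ih1 ih2 =>
        intro a a' ha ha'
        obtain ⟨e, he⟩ := hf c
        exact (ih1 a e ha he).trans (ih2 e a' he ha')
    exact key _ _ (Quot.eqvGen_exact hab) a b rfl rfl
  · intro b
    induction b using Quot.ind with | _ b => ?_
    obtain ⟨a, rfl⟩ := hf b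
    exact ⟨Quot.mk _ a, rfl⟩

end Arrays

section Masks

lemma perm_triple_iff {a b c x y z : ℕ} : [a, b, c].Perm [x, y, z] ↔
    (a = x ∧ b = y ∧ c = z) ∨ (a = x ∧ b = z ∧ c = y) ∨ (a = y ∧ b = x ∧ c = z) ∨
    (a = y ∧ b = z ∧ c = x) ∨ (a = z ∧ b = x ∧ c = y) ∨ (a = z ∧ b = y ∧ c = x) := by
  rw [← List.mem_permutations']
  simp only [List.permutations', List.flatMap_cons, List.flatMap_nil, List.permutations'Aux,
    List.map_cons, List.map_nil, List.append_nil, List.mem_append, List.mem_cons,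
    List.not_mem_nil, List.cons.injEq, and_true, or_false]
  grind

lemma natBeq_eq (a b : ℕ) : Nat.beq a b = decide (a = b) := by
  by_cases h : a = b
  · simp [h]
  · rw [decide_eq_false h, Bool.eq_false_iff]
    exact fun h' => h (Nat.eq_of_beq_eq_true h')

lemma mem_overArrangements {x y z m : ℕ} {f : ℕ → ℕ → ℕ → List ℕ} :
    m ∈ overArrangements x y z f ↔ ∃ a b c, [a, b, c].Perm [x, y, z] ∧ m ∈ f a b c := by
  have : (∃ a b c, [a, b, c].Perm [x, y, z] ∧ m ∈ f a b c) ↔ m ∈ f x y z ∨ m ∈ f x z y ∨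
      m ∈ f y x z ∨ m ∈ f y z x ∨ m ∈ f z x y ∨ m ∈ f z y x := by
    simp only [perm_triple_iff]
    constructor
    · rintro ⟨a, b, c, h, hm⟩
      rcases h with ⟨rfl, rfl, rfl⟩ | ⟨rfl, rfl, rfl⟩ | ⟨rfl, rfl, rfl⟩ | ⟨rfl, rfl, rfl⟩ |
        ⟨rfl, rfl, rfl⟩ | ⟨rfl, rfl, rfl⟩ <;> simp [hm]
    · rintro (h | h | h | h | h | h) <;> exact ⟨_, _, _, by simp, h⟩
  rw [this, overArrangements]
  by_cases hxy : x = y <;> by_cases hyz : y = z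
  · subst hxy hyz
    simp
  · subst hxy
    simp [natBeq_eq, hyz]
    tauto
  · subst hyz
    simp [natBeq_eq, hxy]
    tauto
  · simp [natBeq_eq, hxy, hyz]

lemma apart_eq_true {x y z x' y' z' : ℕ} :
    apart x y z x' y' z' = true ↔ x ≠ x' ∧ y ≠ y' ∧ z ≠ z' := by
  by_cases hx : x = x' <;> by_cases hy : y = y' <;> by_cases hz : z = z' <;>
    simp [natBeq_eq, apart, hx, hy, hz]

/-- The code of a row. -/
def rowCode (C : Fin 4 → Fin 3 → ℕ) (a : Fin 4 → ℕ) : ℕ :=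
  slot (C 0 0) (C 0 1) (a 0) + 3 * (slot (C 1 0) (C 1 1) (a 1) +
    3 * (slot (C 2 0) (C 2 1) (a 2) + 3 * slot (C 3 0) (C 3 1) (a 3)))

lemma slot_eq (x y a : ℕ) : slot x y a = if a = x then 0 else if a = y then 1 else 2 := by
  by_cases hx : a = x <;> by_cases hy : a = y <;> simp [natBeq_eq, slot, hx, hy]

lemma slot_lt (x y a : ℕ) : slot x y a < 3 := by
  rw [slot_eq]
  split_ifs <;> omega

lemma slot_injOn {c : Fin 3 → ℕ} {i j : Fin 3}
    (h : slot (c 0) (c 1) (c i) = slot (c 0) (c 1) (c j)) :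
    c i = c j := by
  rw [slot_eq, slot_eq] at h
  fin_cases i <;> fin_cases j <;> simp at h ⊢ <;> grind

lemma rowCode_inj {C : Fin 4 → Fin 3 → ℕ} {a b : Fin 4 → ℕ} (ha : ∀ j, ∃ i, a j = C j i)
    (hb : ∀ j, ∃ i, b j = C j i) (h : rowCode C a = rowCode C b) : a = b := by
  choose p hp using ha
  choose q hq using hb
  have hs : ∀ j, slot (C j 0) (C j 1) (a j) = slot (C j 0) (C j 1) (b j) := by
    have h0 := fun j => slot_lt (C j 0) (C j 1) (a j)
    have h1 := fun j => slot_lt (C j 0) (C j 1) (b j)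
    simp only [rowCode] at h
    have a0 := h0 0
    have a1 := h0 1
    have a2 := h0 2
    have a3 := h0 3
    have b0 := h1 0
    have b1 := h1 1
    have b2 := h1 2
    have b3 := h1 3
    intro j
    fin_cases j <;> simp only [Fin.zero_eta, Fin.mk_one, Fin.reduceFinMk] <;> omega
  funext j
  rw [hp, hq]
  refine slot_injOn ?_
  rw [← hp, ← hq]
  exact hs j

lemma mem_cond_nil {b : Bool} {m : ℕ} {l : List ℕ} :
    m ∈ (bif b then l else []) ↔ b = true ∧ m ∈ l := by
  cases b <;> simp

lemma injective_four {a : Fin 4 → ℕ} (h01 : a 0 ≠ a 1) (h02 : a 0 ≠ a 2) (h03 : a 0 ≠ a 3)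
    (h12 : a 1 ≠ a 2) (h13 : a 1 ≠ a 3) (h23 : a 2 ≠ a 3) : Function.Injective a := by
  intro i j
  fin_cases i <;> fin_cases j <;> simp_all [Ne.symm]

/-- The columns of a triple of rows are rearrangements of the given columns. -/
def Fills (C : Fin 4 → Fin 3 → ℕ) (a b c : Fin 4 → ℕ) : Prop :=
  ∀ j, [a j, b j, c j].Perm [C j 0, C j 1, C j 2]

/-- The members of `arrayMasks`. -/
lemma mem_arrayMasks {C : Fin 4 → Fin 3 → ℕ} {m : ℕ} :
    m ∈ arrayMasks (List.ofFn (C 0)) (List.ofFn (C 1)) (List.ofFn (C 2)) (List.ofFn (C 3)) ↔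
      ∃ a b c : Fin 4 → ℕ, (a 0 = C 0 0 ∧ b 0 = C 0 1 ∧ c 0 = C 0 2) ∧ Fills C a b c ∧
        (Function.Injective a ∧ Function.Injective b ∧ Function.Injective c) ∧
        m = 2 ^ rowCode C a ||| (2 ^ rowCode C b ||| 2 ^ rowCode C c) := by
  simp only [List.ofFn_succ, List.ofFn_zero, arrayMasks, withEntries, force_eq,
    mem_overArrangements, mem_cond_nil, Bool.and_eq_true, apart_eq_true, List.mem_singleton]
  constructor
  · rintro ⟨x₁, y₁, z₁, h₁, ⟨hx₁, hy₁, hz₁⟩, x₂, y₂, z₂, h₂, ⟨⟨hx₂, hy₂, hz₂⟩, hx₂', hy₂', hz₂'⟩,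
      x₃, y₃, z₃, h₃, ⟨⟨hx₃, hy₃, hz₃⟩, ⟨hx₃', hy₃', hz₃'⟩, hx₃'', hy₃'', hz₃''⟩, hm⟩
    refine ⟨![C 0 0, x₁, x₂, x₃], ![C 0 1, y₁, y₂, y₃], ![C 0 2, z₁, z₂, z₃], ⟨rfl, rfl, rfl⟩,
      ?_, ⟨injective_four ?_ ?_ ?_ ?_ ?_ ?_, injective_four ?_ ?_ ?_ ?_ ?_ ?_,
      injective_four ?_ ?_ ?_ ?_ ?_ ?_⟩, hm⟩
    · intro j
      fin_cases j
      exacts [List.Perm.refl _, h₁, h₂, h₃]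
    all_goals assumption
  · rintro ⟨a, b, c, ⟨ha, hb, hc⟩, h, ⟨hia, hib, hic⟩, rfl⟩
    have key₀ : ∀ j ≠ 0, C 0 0 ≠ a j ∧ C 0 1 ≠ b j ∧ C 0 2 ≠ c j := fun j hj =>
      ⟨ha ▸ hia.ne hj.symm, hb ▸ hib.ne hj.symm, hc ▸ hic.ne hj.symm⟩
    have key : ∀ i j, i ≠ j → a i ≠ a j ∧ b i ≠ b j ∧ c i ≠ c j := fun i j h =>
      ⟨hia.ne h, hib.ne h, hic.ne h⟩
    refine ⟨a 1, b 1, c 1, h 1, ?_, a 2, b 2, c 2, h 2, ?_, a 3, b 3, c 3, h 3, ?_, ?_⟩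
    · exact key₀ 1 (by decide)
    · exact ⟨key₀ 2 (by decide), key 1 2 (by decide)⟩
    · exact ⟨key₀ 3 (by decide), key 1 3 (by decide), key 2 3 (by decide)⟩
    · simp only [rowCode, ha, hb, hc]
      rfl

end Masks

section Classes

variable {n : ℕ}

lemma testBit_masks (a b c i : ℕ) :
    (2 ^ a ||| (2 ^ b ||| 2 ^ c)).testBit i = true ↔ a = i ∨ b = i ∨ c = i := by
  simp [Nat.testBit_or, Nat.testBit_two_pow]

/-- The number of classes of a fiber is computed by `components`. -/
theorem numClasses_eq_length_components {t : Fin 4 × Fin n → ℕ} {g : Fin n → ℕ}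
    (hg : GoodNames t g) (C : Fin 4 → Fin 3 → ℕ)
    (hC : ∀ j, ((List.ofFn (C j) : List ℕ) : Multiset ℕ) = (column t j).map g) :
    numClasses t = (components (arrayMasks (List.ofFn (C 0)) (List.ofFn (C 1))
      (List.ofFn (C 2)) (List.ofFn (C 3)))).length := by
  set xs := arrayMasks (List.ofFn (C 0)) (List.ofFn (C 1)) (List.ofFn (C 2)) (List.ofFn (C 3))
    with hxs
  have hcard : ∀ j, (column t j).card = 3 := fun j => by
    rw [← Multiset.card_map g, ← hC]
    simp
  have hentry : ∀ {X : Multiset (Fin 4 ↪ Fin n)},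
      (∀ j, (X.map fun σ => σ j) = column t j) → ∀ σ ∈ X, ∀ j, ∃ i, g (σ j) = C j i := by
    intro X hX σ hσ j
    have : g (σ j) ∈ (column t j).map g :=
      Multiset.mem_map_of_mem g (mem_column.2 (ne_zero_of_mem hX hσ j))
    rw [← hC, Multiset.mem_coe, List.mem_ofFn] at this
    obtain ⟨i, hi⟩ := this
    exact ⟨i, hi.symm⟩
  let code : (Fin 4 ↪ Fin n) → ℕ := fun σ => rowCode C fun j => g (σ j)
  let Rel : Fiber t → ℕ → Prop := fun x m =>
    ∀ i, m.testBit i = true ↔ ∃ σ, x.1 σ ≠ 0 ∧ code σ = i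
  have hRel : ∀ (σ τ ρ : Fin 4 ↪ Fin n)
      (h : ∀ j, ((([σ, τ, ρ] : List (Fin 4 ↪ Fin n)) : Multiset (Fin 4 ↪ Fin n)).map
        fun σ => σ j) = column t j),
      Rel (fiberMk _ h) (2 ^ code σ ||| (2 ^ code τ ||| 2 ^ code ρ)) := by
    intro σ τ ρ h i
    rw [testBit_masks]
    simp only [fiberMk, Multiset.count_ne_zero]
    simp
  have hA : ∀ x : Fiber t, ∃ m ∈ xs, Rel x m := by
    intro x
    obtain ⟨X, hX, rfl⟩ := exists_eq_fiberMk x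
    obtain ⟨L, rfl, hL⟩ := exists_list_map_eq (fun σ : Fin 4 ↪ Fin n => g (σ 0))
      (List.ofFn (C 0)) X (by rw [hC, ← hX, Multiset.map_map]; rfl)
    have hlen := congrArg List.length hL
    rw [List.length_map, List.length_ofFn, List.length_eq_three] at hlen
    obtain ⟨σ, τ, ρ, rfl⟩ := hlen
    refine ⟨_, ?_, hRel σ τ ρ hX⟩
    rw [hxs, mem_arrayMasks]
    refine ⟨fun j => g (σ j), fun j => g (τ j), fun j => g (ρ j), ?_, ?_,
      ⟨names_injective hg hX (by simp), names_injective hg hX (by simp),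
        names_injective hg hX (by simp)⟩, rfl⟩
    · simpa using hL
    · intro j
      have := hC j
      rw [← hX] at this
      have h' : ([g (σ j), g (τ j), g (ρ j)] : Multiset ℕ) = ([C j 0, C j 1, C j 2] : List ℕ) := by
        simpa [List.ofFn_succ] using this.symm
      exact Multiset.coe_eq_coe.1 h'
  have hB : ∀ m ∈ xs, ∃ x, Rel x m := by
    intro m hm
    rw [hxs, mem_arrayMasks] at hm
    obtain ⟨a, b, c, -, hfill, ⟨ha, hb, hc⟩, rfl⟩ := hm
    have hlift : ∀ j, ∃ u v w, ([u, v, w] : List (Fin n)) = column t j ∧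
        g u = a j ∧ g v = b j ∧ g w = c j := by
      intro j
      obtain ⟨L, hL, hL'⟩ := exists_list_map_eq g [a j, b j, c j] (column t j) (by
        rw [← hC]
        refine (Multiset.coe_eq_coe.2 (hfill j)).trans ?_
        simp [List.ofFn_succ])
      have hlen := congrArg List.length hL'
      rw [List.length_map, List.length_cons, List.length_cons, List.length_singleton,
        List.length_eq_three] at hlen
      obtain ⟨u, v, w, rfl⟩ := hlen
      exact ⟨u, v, w, hL, by simpa using hL'⟩
    choose u v w huvw hu hv hw using hlift
    let σ : Fin 4 ↪ Fin n := ⟨u, fun i j h => ha (by rw [← hu, ← hu, h])⟩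
    let τ : Fin 4 ↪ Fin n := ⟨v, fun i j h => hb (by rw [← hv, ← hv, h])⟩
    let ρ : Fin 4 ↪ Fin n := ⟨w, fun i j h => hc (by rw [← hw, ← hw, h])⟩
    have h : ∀ j, ((([σ, τ, ρ] : List (Fin 4 ↪ Fin n)) : Multiset (Fin 4 ↪ Fin n)).map
        fun σ => σ j) = column t j := fun j => by
      rw [← huvw]
      rfl
    have hσ : a = fun j => g (σ j) := funext fun j => (hu j).symm
    have hτ : b = fun j => g (τ j) := funext fun j => (hv j).symm
    have hρ : c = fun j => g (ρ j) := funext fun j => (hw j).symm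
    exact ⟨_, by rw [hσ, hτ, hρ]; exact hRel σ τ ρ h⟩
  choose f hf hfRel using hA
  have hbits : ∀ x y : Fiber t, f x &&& f y ≠ 0 ↔
      ∃ σ τ, x.1 σ ≠ 0 ∧ y.1 τ ≠ 0 ∧ code σ = code τ := by
    intro x y
    rw [Ne, and_eq_zero_iff]
    push Not
    simp only [hfRel x _, hfRel y _]
    constructor
    · rintro ⟨i, ⟨σ, hσ, rfl⟩, τ, hτ, h⟩
      exact ⟨σ, τ, hσ, hτ, h.symm⟩
    · rintro ⟨σ, τ, hσ, hτ, h⟩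
      exact ⟨_, ⟨σ, hσ, rfl⟩, τ, hτ, h.symm⟩
  have h0 : ∀ m ∈ xs, m ≠ 0 := by
    rintro m hm rfl
    rw [hxs, mem_arrayMasks] at hm
    obtain ⟨a, b, c, -, -, -, h⟩ := hm
    have := (testBit_masks (rowCode C a) (rowCode C b) (rowCode C c) (rowCode C a)).2 (Or.inl rfl)
    rw [← h] at this
    simp at this
  rw [← card_quot_meets xs h0, numClasses]
  refine card_quot_eq (fun x => (⟨f x, hf x⟩ : {m // m ∈ xs})) ?_ ?_ ?_ ?_
  · rintro ⟨m, hm⟩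
    obtain ⟨x, hx⟩ := hB m hm
    refine ⟨x, Subtype.ext (Nat.eq_of_testBit_eq fun i => ?_)⟩
    rw [Bool.eq_iff_iff, hfRel, hx]
  · intro m
    simpa using h0 m.1 m.2
  · rintro x y ⟨σ, hx, hy⟩
    exact (hbits x y).2 ⟨σ, σ, hx, hy, rfl⟩
  · intro x y h
    obtain ⟨σ, τ, hσ, hτ, hστ⟩ := (hbits x y).1 h
    obtain ⟨X, hX, rfl⟩ := exists_eq_fiberMk x
    obtain ⟨Y, hY, rfl⟩ := exists_eq_fiberMk y
    rw [fiberMk, Multiset.count_ne_zero] at hσ hτ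
    have := rowCode_inj (hentry hX σ hσ) (hentry hY τ hτ) hστ
    exact mk_eq_of_names_eq hg hX hY (fun j => (hcard j).ge) hσ hτ (congrFun this)

end Classes

section Growth

/-- The `j`-th entry of a profile. -/
def coord (p : ℕ × ℕ × ℕ × ℕ) : Fin 4 → ℕ := ![p.1, p.2.1, p.2.2.1, p.2.2.2]

/-- Add a label named `l` with profile `p` to the columns. -/
def push (p : ℕ × ℕ × ℕ × ℕ) (l : ℕ) (c : Fin 4 → List ℕ) : Fin 4 → List ℕ :=
  fun j => prepend (coord p j) l (c j)

/-- Add `j` labels with profile `p` to columns with `k` labels. -/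
def grow (p : ℕ × ℕ × ℕ × ℕ) (k : ℕ) : ℕ → (Fin 4 → List ℕ) → Fin 4 → List ℕ
  | 0, c => c
  | j + 1, c => push p (labelName p (k + j)) (grow p k j c)

/-- The weighted number of ways to add up to three labels of each profile in a list to columns
with `k` labels, if `N` further labels are available. -/
def countWays (f : (Fin 4 → List ℕ) → ℕ → ℕ → ℕ) :
    List (ℕ × ℕ × ℕ × ℕ) → (Fin 4 → List ℕ) → ℕ → ℕ → ℕ
  | [], c, k, N => f c k N
  | p :: ps, c, k, N =>
    ∑ j ∈ Finset.range 4, N.choose j * countWays f ps (grow p k j c) (k + j) (N - j)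

lemma countWays_append (f : (Fin 4 → List ℕ) → ℕ → ℕ → ℕ) (ps qs : List (ℕ × ℕ × ℕ × ℕ)) :
    countWays f (ps ++ qs) = countWays (countWays f qs) ps := by
  induction ps with
  | nil => rfl
  | cons p ps ih =>
    funext c k N
    simp only [List.cons_append, countWays, ih]

lemma length_prepend (a x : ℕ) (l : List ℕ) : (prepend a x l).length = a + l.length := by
  induction a with
  | zero => simp [prepend]
  | succ a ih =>
    simp only [prepend, List.length_cons, ih]
    omega

lemma prepend_prepend (a b x : ℕ) (l : List ℕ) :
    prepend a x (prepend b x l) = prepend (a + b) x l := by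
  induction a with
  | zero => simp [prepend]
  | succ a ih => simp [Nat.succ_add, prepend, ih]

lemma length_push (p : ℕ × ℕ × ℕ × ℕ) (l : ℕ) (c : Fin 4 → List ℕ) (j : Fin 4) :
    (push p l c j).length = coord p j + (c j).length := length_prepend _ _ _

lemma length_grow (p : ℕ × ℕ × ℕ × ℕ) (k i : ℕ) (c : Fin 4 → List ℕ) (j : Fin 4) :
    (grow p k i c j).length = i * coord p j + (c j).length := by
  induction i with
  | zero => simp [grow]
  | succ i ih =>
    rw [grow, length_push, ih]
    ring

/-- Columns longer than three do not contribute. -/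
def VanishesOnLong (f : (Fin 4 → List ℕ) → ℕ → ℕ → ℕ) : Prop :=
  ∀ c, (∃ j, 3 < (c j).length) → ∀ k N, f c k N = 0

lemma VanishesOnLong.countWays {f : (Fin 4 → List ℕ) → ℕ → ℕ → ℕ} (hf : VanishesOnLong f)
    (ps : List (ℕ × ℕ × ℕ × ℕ)) : VanishesOnLong (countWays f ps) := by
  induction ps with
  | nil => exact hf
  | cons p ps ih =>
    rintro c ⟨j, hj⟩ k N
    refine Finset.sum_eq_zero fun i _ => ?_
    rw [ih _ ⟨j, hj.trans_le (by rw [length_grow]; omega)⟩, mul_zero]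

lemma countWays_zero (ps : List (ℕ × ℕ × ℕ × ℕ)) (c : Fin 4 → List ℕ) (k N : ℕ) :
    countWays (fun _ _ _ => 0) ps c k N = 0 := by
  induction ps generalizing c k N with
  | nil => rfl
  | cons p ps ih => simp [countWays, ih]

/-- The value of a coefficient list starting with the coefficient of `n.choose i`. -/
def evalCoeffs (n : ℕ) : ℕ → List ℕ → ℕ
  | _, [] => 0
  | i, a :: x => n.choose i * a + evalCoeffs n (i + 1) x

lemma evalCoeffs_addCoeffs (n i : ℕ) (x y : List ℕ) :
    evalCoeffs n i (addCoeffs x y) = evalCoeffs n i x + evalCoeffs n i y := by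
  induction x generalizing i y with
  | nil => simp [addCoeffs, evalCoeffs]
  | cons a x ih =>
    cases y with
    | nil => simp [addCoeffs, evalCoeffs]
    | cons b y =>
      simp only [addCoeffs, evalCoeffs, ih, Nat.add_eq]
      ring

lemma evalCoeffs_replicate_append (n i k : ℕ) (x : List ℕ) :
    evalCoeffs n i (List.replicate k 0 ++ x) = evalCoeffs n (i + k) x := by
  induction k generalizing i with
  | zero => simp
  | succ k ih =>
    rw [List.replicate_succ, List.cons_append, evalCoeffs, ih]
    simp [Nat.add_right_comm, Nat.add_assoc]

lemma evalCoeffs_monomialCoeffs (n k m w : ℕ) :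
    evalCoeffs n 0 (monomialCoeffs k m w) = n.choose k * m * w := by
  cases w with
  | zero => simp [monomialCoeffs, evalCoeffs]
  | succ w => simp [monomialCoeffs, evalCoeffs_replicate_append, evalCoeffs, mul_assoc]

lemma choose_mul_choose_sub (n k j : ℕ) :
    n.choose k * (n - k).choose j = n.choose (k + j) * (k + j).choose j := by
  by_cases h : k + j ≤ n
  · have := Nat.choose_mul (n := n) (k := k + j) (s := k) (Nat.le_add_right k j)
    rw [Nat.add_sub_cancel_left, Nat.choose_symm_add] at this
    exact this.symm
  · rw [Nat.choose_eq_zero_of_lt (n := n) (k := k + j) (by omega), zero_mul]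
    by_cases hk : k ≤ n
    · rw [Nat.choose_eq_zero_of_lt (n := n - k) (by omega), mul_zero]
    · rw [Nat.choose_eq_zero_of_lt (by omega), zero_mul]

lemma fits_eq_true {p : ℕ × ℕ × ℕ × ℕ} {c : Fin 4 → List ℕ} :
    fits p (c 0) (c 1) (c 2) (c 3) = true ↔ ∀ j, coord p j + (c j).length ≤ 3 := by
  simp [fits, Fin.forall_fin_succ, coord]

/-- The relation between `countCoeffs` and `countWays`. -/
theorem evalCoeffs_countCoeffs {n : ℕ}
    {F : List ℕ → List ℕ → List ℕ → List ℕ → ℕ → ℕ → List ℕ}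
    {f : (Fin 4 → List ℕ) → ℕ → ℕ → ℕ} (hf : VanishesOnLong f)
    (hF : ∀ (c : Fin 4 → List ℕ) (k m : ℕ), evalCoeffs n 0 (F (c 0) (c 1) (c 2) (c 3) k m) =
      n.choose k * m * f c k (n - k))
    (ps : List (ℕ × ℕ × ℕ × ℕ)) (c : Fin 4 → List ℕ) (k m : ℕ) :
    evalCoeffs n 0 (countCoeffs F ps (c 0) (c 1) (c 2) (c 3) k m) =
      n.choose k * m * countWays f ps c k (n - k) := by
  induction ps generalizing c k m with
  | nil => exact hF c k m
  | cons p ps ih =>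
    have hterm : ∀ j, n.choose (k + j) * (m * (k + j).choose j) *
        countWays f ps (grow p k j c) (k + j) (n - (k + j)) =
        n.choose k * m * ((n - k).choose j *
          countWays f ps (grow p k j c) (k + j) (n - k - j)) := by
      intro j
      rw [Nat.sub_sub, mul_left_comm, ← choose_mul_choose_sub n k j]
      ring
    have hzero : ∀ j, (∃ i < j, fits p (grow p k i c 0) (grow p k i c 1) (grow p k i c 2)
        (grow p k i c 3) = false) → ∀ l N, countWays f ps (grow p k j c) l N = 0 := by
      rintro j ⟨i, hij, hi⟩ l N
      refine hf.countWays ps _ ?_ l N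
      by_contra! h
      rw [Bool.eq_false_iff, Ne, fits_eq_true] at hi
      refine hi fun a => le_trans ?_ (h a)
      rw [length_grow, length_grow]
      have := Nat.mul_le_mul_right (coord p a) (Nat.succ_le_of_lt hij)
      rw [Nat.succ_mul] at this
      omega
    rw [countWays, Finset.mul_sum]
    simp only [Finset.sum_range_succ, Finset.sum_range_zero, zero_add, ← hterm]
    rw [countCoeffs, evalCoeffs_addCoeffs, ih]
    have h0 : n.choose k * m * countWays f ps c k (n - k) = n.choose (k + 0) *
        (m * (k + 0).choose 0) * countWays f ps (grow p k 0 c) (k + 0) (n - (k + 0)) := by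
      simp [grow]
    have h1 := ih (grow p k 1 c) (k + 1) (m * (k + 1).choose 1)
    have h2 := ih (grow p k 2 c) (k + 2) (m * (k + 2).choose 2)
    have h3 := ih (grow p k 3 c) (k + 3) (m * (k + 3).choose 3)
    rw [h0, add_assoc, add_assoc]
    refine congrArg _ ?_
    cases b1 : fits p (c 0) (c 1) (c 2) (c 3) with
    | false =>
      rw [hzero 1 ⟨0, by omega, b1⟩, hzero 2 ⟨0, by omega, b1⟩, hzero 3 ⟨0, by omega, b1⟩]
      simp [evalCoeffs]
    | true =>
      rw [cond_true, evalCoeffs_addCoeffs]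
      refine congrArg₂ _ h1 ?_
      cases b2 : fits p (grow p k 1 c 0) (grow p k 1 c 1) (grow p k 1 c 2) (grow p k 1 c 3) with
      | false =>
        rw [hzero 2 ⟨1, by omega, b2⟩, hzero 3 ⟨1, by omega, b2⟩]
        refine (congrArg _ ((congrArg (fun b => cond b _ _) b2).trans (cond_false _ _))).trans ?_
        simp [evalCoeffs]
      | true =>
        refine (congrArg _ ((congrArg (fun b => cond b _ _) b2).trans (cond_true _ _))).trans ?_
        rw [evalCoeffs_addCoeffs]
        refine congrArg₂ _ h2 ?_
        cases b3 : fits p (grow p k 2 c 0) (grow p k 2 c 1) (grow p k 2 c 2)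
            (grow p k 2 c 3) with
        | false =>
          rw [hzero 3 ⟨2, by omega, b3⟩]
          refine (congrArg _ ((congrArg (fun b => cond b _ _) b3).trans (cond_false _ _))).trans ?_
          simp [evalCoeffs]
        | true =>
          refine (congrArg _ ((congrArg (fun b => cond b _ _) b3).trans (cond_true _ _))).trans ?_
          exact h3

end Growth

section Completion

/-- The number of components, minus one, of the arrays with the given columns, if these have
length three. -/
def leafWeight (c : Fin 4 → List ℕ) (_k _N : ℕ) : ℕ :=
  if ∀ j, (c j).length = 3 then excess (c 0) (c 1) (c 2) (c 3) else 0

lemma vanishesOnLong_ite (h : (Fin 4 → List ℕ) → ℕ) :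
    VanishesOnLong fun c _ _ => if ∀ j, (c j).length = 3 then h c else 0 := by
  rintro c ⟨j, hj⟩ k N
  exact if_neg fun h => hj.ne' (h j)

lemma full_eq_true {c : Fin 4 → List ℕ} :
    full (c 0) (c 1) (c 2) (c 3) = true ↔ ∀ j, (c j).length = 3 := by
  simp [full, Fin.forall_fin_succ]

/-- A weight that does not change when labels are added may be evaluated at the start. -/
lemma countWays_ite_eq {h : (Fin 4 → List ℕ) → ℕ} {ps : List (ℕ × ℕ × ℕ × ℕ)}
    (hps : ∀ p ∈ ps, ∀ k c, (∀ j, (push p (labelName p k) c j).length ≤ 3) →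
      h (push p (labelName p k) c) = h c) (c : Fin 4 → List ℕ) (k N : ℕ) :
    countWays (fun c _ _ => if ∀ j, (c j).length = 3 then h c else 0) ps c k N =
      countWays (fun d _ _ => if ∀ j, (d j).length = 3 then h c else 0) ps c k N := by
  induction ps generalizing c k N with
  | nil => rfl
  | cons p ps ih =>
    refine Finset.sum_congr rfl fun i hmem => congrArg _ ?_
    by_cases hi : ∃ j, 3 < (grow p k i c j).length
    · rw [(vanishesOnLong_ite h).countWays ps _ hi,
        (vanishesOnLong_ite fun _ => h c).countWays ps _ hi]
    · push Not at hi
      rw [ih fun q hq => hps q (List.mem_cons_of_mem p hq)]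
      suffices h (grow p k i c) = h c by rw [this]
      clear ih hmem
      induction i with
      | zero => rfl
      | succ i ih =>
        refine (hps p List.mem_cons_self _ _ hi).trans (ih fun j => le_trans ?_ (hi j))
        rw [length_grow, length_grow, Nat.succ_mul]
        omega

lemma labelName_privateProfiles (k : ℕ) : ∀ p ∈ privateProfiles, ∀ j : Fin 4,
    coord p j = 0 ∨ labelName p k = j := by
  simp [privateProfiles, Fin.forall_fin_succ, coord, labelName, Nat.beq]

lemma fillColumn_prepend {a j : ℕ} {c : List ℕ} (h : (prepend a j c).length ≤ 3) :
    fillColumn j (prepend a j c) = fillColumn j c := by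
  rw [length_prepend] at h
  simp only [fillColumn, prepend_prepend, length_prepend, Nat.sub_eq]
  congr 1
  omega

lemma fillColumn_push {p : ℕ × ℕ × ℕ × ℕ} (hp : p ∈ privateProfiles) {k : ℕ}
    {c : Fin 4 → List ℕ} {j : Fin 4} (h : (push p (labelName p k) c j).length ≤ 3) :
    fillColumn j (push p (labelName p k) c j) = fillColumn j (c j) := by
  obtain h0 | hl := labelName_privateProfiles k p hp j
  · rw [push, h0, prepend]
  · rw [push, hl] at h ⊢
    exact fillColumn_prepend h

lemma evalCoeffs_completionCoeffs (n : ℕ) (c : Fin 4 → List ℕ) (k m : ℕ) :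
    evalCoeffs n 0 (completionCoeffs (c 0) (c 1) (c 2) (c 3) k m) =
      n.choose k * m * countWays leafWeight privateProfiles c k (n - k) := by
  let h : (Fin 4 → List ℕ) → ℕ := fun c =>
    excess (fillColumn 0 (c 0)) (fillColumn 1 (c 1)) (fillColumn 2 (c 2)) (fillColumn 3 (c 3))
  have hleaf : leafWeight = fun c _ _ => if ∀ j, (c j).length = 3 then h c else 0 := by
    funext c k N
    rw [leafWeight]
    split_ifs with hc
    · simp [h, fillColumn, hc, prepend]
    · rfl
  have hps : ∀ p ∈ privateProfiles, ∀ k c, (∀ j, (push p (labelName p k) c j).length ≤ 3) →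
      h (push p (labelName p k) c) = h c := by
    intro p hp k c hc
    have key : ∀ j : Fin 4, fillColumn j (push p (labelName p k) c j) = fillColumn j (c j) :=
      fun j => fillColumn_push hp (hc j)
    change excess (fillColumn (0 : Fin 4) _) (fillColumn (1 : Fin 4) _) (fillColumn (2 : Fin 4) _)
      (fillColumn (3 : Fin 4) _) = _
    rw [key, key, key, key]
    rfl
  rw [hleaf, countWays_ite_eq hps]
  change evalCoeffs n 0 (match h c with
    | 0 => []
    | w + 1 => countCoeffs (fullCoeffs (w + 1)) privateProfiles (c 0) (c 1) (c 2) (c 3) k m) = _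
  cases h c with
  | zero => simp [evalCoeffs, countWays_zero]
  | succ w =>
    refine evalCoeffs_countCoeffs (vanishesOnLong_ite fun _ => w + 1) (fun c k m => ?_) _ c k m
    rw [fullCoeffs]
    split_ifs with hc
    · rw [full_eq_true.2 hc, cond_true, evalCoeffs_monomialCoeffs]
    · rw [Bool.eq_false_iff.2 (mt full_eq_true.1 hc)]
      simp [evalCoeffs]

end Completion

section Tables

variable {n : ℕ}

/-- The table whose columns are the given profiles. -/
def tab (s : Fin n → ℕ × ℕ × ℕ × ℕ) : Fin 4 × Fin n → ℕ :=
  fun q => coord (s q.2) q.1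

/-- The number of classes, minus one, of the fiber of a table with row sums three. -/
noncomputable def tabWeight (s : Fin n → ℕ × ℕ × ℕ × ℕ) : ℕ :=
  if ∀ j, ∑ k, tab s (j, k) = 3 then numClasses (tab s) - 1 else 0

lemma coord_zero (j : Fin 4) : coord 0 j = 0 := by
  fin_cases j <;> rfl

lemma coord_injective : Function.Injective coord := by
  rintro ⟨a, b, c, d⟩ ⟨a', b', c', d'⟩ h
  have h0 := congrFun h 0
  have h1 := congrFun h 1
  have h2 := congrFun h 2
  have h3 := congrFun h 3
  simp only [coord, Matrix.cons_val] at h0 h1 h2 h3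
  rw [h0, h1, h2, h3]

lemma card_column (t : Fin 4 × Fin n → ℕ) (j : Fin 4) :
    (column t j).card = ∑ k, t (j, k) := by
  simp [column]

lemma coe_prepend (a x : ℕ) (l : List ℕ) :
    (prepend a x l : Multiset ℕ) = Multiset.replicate a x + l := by
  induction a with
  | zero => simp [prepend]
  | succ a ih =>
    rw [prepend, ← Multiset.cons_coe, ih, Multiset.replicate_succ, Multiset.cons_add]

lemma column_update {s : Fin n → ℕ × ℕ × ℕ × ℕ} {v : Fin n} (hv : s v = 0)
    (p : ℕ × ℕ × ℕ × ℕ) (j : Fin 4) :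
    column (tab (Function.update s v p)) j =
      Multiset.replicate (coord p j) v + column (tab s) j := by
  ext u
  rw [Multiset.count_add, count_column, count_column, Multiset.count_replicate]
  obtain rfl | hu := eq_or_ne v u
  · simp [tab, hv, coord_zero]
  · simp [tab, hu, hu.symm]

lemma labelName_eq (p : ℕ × ℕ × ℕ × ℕ) (k : ℕ) :
    (∃ j : Fin 4, (∀ i ≠ j, coord p i = 0) ∧ labelName p k = j) ∨ labelName p k = k + 4 := by
  obtain ⟨a, b, c, d⟩ := p
  simp only [labelName, Nat.add_eq, natBeq_eq, Bool.cond_decide]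
  split_ifs with h0 h1 h2 h3
  · refine Or.inl ⟨0, ?_, rfl⟩
    simp [Fin.forall_fin_succ, coord]
    omega
  · refine Or.inl ⟨1, ?_, rfl⟩
    simp [Fin.forall_fin_succ, coord]
    omega
  · refine Or.inl ⟨2, ?_, rfl⟩
    simp [Fin.forall_fin_succ, coord]
    omega
  · refine Or.inl ⟨3, ?_, rfl⟩
    simp [Fin.forall_fin_succ, coord]
    omega
  · exact Or.inr rfl

/-- The columns list the names of the labels in `S` according to their profiles. -/
structure Built (S : Finset (Fin n)) (s : Fin n → ℕ × ℕ × ℕ × ℕ) (c : Fin 4 → List ℕ) :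
    Prop where
  eq_zero : ∀ v ∉ S, s v = 0
  exists_names : ∃ g : Fin n → ℕ, (∀ j, (c j : Multiset ℕ) = (column (tab s) j).map g) ∧
    (∀ u ∈ S, (∃ j : Fin 4, (∀ i ≠ j, coord (s u) i = 0) ∧ g u = j) ∨
      (4 ≤ g u ∧ g u < S.card + 4)) ∧
    ∀ u ∈ S, ∀ v ∈ S, u ≠ v → g u = g v → g u < 4

lemma Built.tabWeight_eq {S : Finset (Fin n)} {s : Fin n → ℕ × ℕ × ℕ × ℕ} {c : Fin 4 → List ℕ}
    (h : Built S s c) (k N : ℕ) : tabWeight s = leafWeight c k N := by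
  obtain ⟨g, hc, hg, hinj⟩ := h.exists_names
  have hlen : ∀ j, ∑ k, tab s (j, k) = (c j).length := fun j => by
    rw [← card_column, ← Multiset.card_map g, ← hc, Multiset.coe_card]
  simp only [tabWeight, leafWeight, hlen]
  split_ifs with h3
  swap
  · rfl
  have hC : ∀ j, ∃ C : Fin 3 → ℕ, List.ofFn C = c j := fun j => by
    obtain ⟨x, y, z, hj⟩ := List.length_eq_three.1 (h3 j)
    exact ⟨![x, y, z], by simp [hj]⟩
  choose C hC using hC
  have hmem : ∀ u, (∃ j, tab s (j, u) ≠ 0) → u ∈ S := by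
    rintro u ⟨j, hj⟩
    by_contra hu
    exact hj (by rw [tab, h.eq_zero u hu, coord_zero])
  have hgood : GoodNames (tab s) g := by
    intro u v huv hu hv he
    have hlt := hinj u (hmem u hu) v (hmem v hv) huv he
    obtain ⟨j, hj, hgj⟩ | ⟨h4, -⟩ := hg u (hmem u hu)
    · obtain ⟨j', hj', hgj'⟩ | ⟨h4, -⟩ := hg v (hmem v hv)
      · obtain rfl : j = j' := Fin.ext (by omega)
        exact ⟨j, fun i hi => ⟨hj i hi, hj' i hi⟩⟩
      · omega
    · omega
  rw [numClasses_eq_length_components hgood C fun j => by rw [hC, hc]]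
  simp only [hC, excess]

lemma Built.insert_push {S : Finset (Fin n)} {s : Fin n → ℕ × ℕ × ℕ × ℕ} {c : Fin 4 → List ℕ}
    (h : Built S s c) {v : Fin n} (hv : v ∉ S) (p : ℕ × ℕ × ℕ × ℕ) :
    Built (insert v S) (Function.update s v p) (push p (labelName p S.card) c) := by
  obtain ⟨g, hc, hg, hinj⟩ := h.exists_names
  have hne : ∀ u ∈ S, u ≠ v := fun u hu => ne_of_mem_of_not_mem hu hv
  refine ⟨fun u hu => ?_, Function.update g v (labelName p S.card), fun j => ?_, ?_, ?_⟩
  · rw [Finset.mem_insert, not_or] at hu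
    rw [Function.update_of_ne hu.1, h.eq_zero u hu.2]
  · rw [column_update (h.eq_zero v hv), Multiset.map_add, Multiset.map_replicate,
      Function.update_self, push, coe_prepend, hc]
    refine congrArg _ (Multiset.map_congr rfl fun u hu => ?_)
    rw [Function.update_of_ne]
    rintro rfl
    exact mem_column.1 hu (by rw [tab, h.eq_zero u hv, coord_zero])
  · rw [Finset.card_insert_of_notMem hv]
    intro u hu
    obtain rfl | hu := Finset.mem_insert.1 hu
    · rw [Function.update_self, Function.update_self]
      exact (labelName_eq p S.card).imp_right fun h => by omega
    · rw [Function.update_of_ne (hne u hu), Function.update_of_ne (hne u hu)]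
      exact (hg u hu).imp_right fun h => by omega
  · have key : ∀ u ∈ S, g u = labelName p S.card → g u < 4 := by
      intro u hu he
      obtain ⟨j, -, hj⟩ | h4 := hg u hu
      · omega
      · obtain ⟨j, -, hj⟩ | h5 := labelName_eq p S.card
        · omega
        · omega
    intro u hu w hw huw he
    obtain rfl | huS := Finset.mem_insert.1 hu
    · have hwS := Finset.mem_of_mem_insert_of_ne hw huw.symm
      rw [Function.update_self, Function.update_of_ne (hne w hwS)] at he
      rw [Function.update_self, he]
      exact key w hwS he.symm
    · rw [Function.update_of_ne (hne u huS)] at he ⊢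
      obtain rfl | hwS := Finset.mem_insert.1 hw
      · rw [Function.update_self] at he
        exact key u huS he
      · rw [Function.update_of_ne (hne w hwS)] at he
        exact hinj u huS w hwS huw he

lemma Built.union_grow {S : Finset (Fin n)} {s : Fin n → ℕ × ℕ × ℕ × ℕ} {c : Fin 4 → List ℕ}
    (h : Built S s c) (p : ℕ × ℕ × ℕ × ℕ) {A : Finset (Fin n)} (hA : Disjoint S A) :
    Built (S ∪ A) (fun v => if v ∈ A then p else s v) (grow p S.card A.card c) := by
  induction A using Finset.induction_on with
  | empty => simpa [grow] using h
  | insert v A hv ih =>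
    rw [Finset.disjoint_insert_right] at hA
    have := (ih hA.2).insert_push (v := v) (by simp [hA.1, hv]) p
    rw [Finset.card_union_of_disjoint hA.2] at this
    rw [Finset.union_insert, Finset.card_insert_of_notMem hv, grow]
    convert this using 1
    funext u
    obtain rfl | hu := eq_or_ne u v
    · simp
    · simp [hu]

lemma sum_range_choose_mul {F : ℕ → ℕ} (m N : ℕ) (hF : ∀ i, m ≤ i → F i = 0) :
    ∑ i ∈ Finset.range (N + 1), N.choose i * F i = ∑ i ∈ Finset.range m, N.choose i * F i := by
  obtain h | h := le_total (N + 1) m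
  · refine Finset.sum_subset (Finset.range_mono h) fun i _ hi => ?_
    rw [Nat.choose_eq_zero_of_lt (by simpa using hi), zero_mul]
  · refine (Finset.sum_subset (Finset.range_mono h) fun i _ hi => ?_).symm
    rw [hF i (by simpa using hi), mul_zero]

/-- The total weight of the tables extending a given one is computed by `countWays`. -/
theorem Built.sum_tabWeight {S : Finset (Fin n)} {s₀ : Fin n → ℕ × ℕ × ℕ × ℕ}
    {c : Fin 4 → List ℕ} (h : Built S s₀ c) {ps : List (ℕ × ℕ × ℕ × ℕ)} (hps : ps.Nodup)
    (h0 : 0 ∉ ps) :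
    ∑ s ∈ Fintype.piFinset (fun v => if v ∈ S then {s₀ v} else insert 0 ps.toFinset),
      tabWeight s = countWays leafWeight ps c S.card (n - S.card) := by
  induction ps generalizing S s₀ c with
  | nil =>
    have : (fun v => if v ∈ S then {s₀ v} else insert 0 (List.toFinset [])) =
        fun v => ({s₀ v} : Finset (ℕ × ℕ × ℕ × ℕ)) := by
      funext v
      split_ifs with hv
      · rfl
      · rw [h.eq_zero v hv]
        rfl
    rw [this, Fintype.piFinset_singleton, Finset.sum_singleton, countWays]
    exact h.tabWeight_eq _ _
  | cons p ps ih =>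
    rw [List.nodup_cons] at hps
    rw [List.mem_cons, not_or] at h0
    have hfib : ∀ A ∈ Sᶜ.powerset,
        {s ∈ Fintype.piFinset
          (fun v => if v ∈ S then {s₀ v} else insert 0 (p :: ps).toFinset) |
          ({v | v ∉ S ∧ s v = p} : Finset (Fin n)) = A} =
        Fintype.piFinset (fun v => if v ∈ S ∪ A then {(if v ∈ A then p else s₀ v)} else
          insert 0 ps.toFinset) := by
      intro A hA
      rw [Finset.mem_powerset] at hA
      ext s
      simp only [Finset.mem_filter, Fintype.mem_piFinset, Finset.ext_iff, Finset.mem_univ,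
        true_and, ← forall_and]
      refine forall_congr' fun v => ?_
      have hAv : v ∈ A → v ∉ S := fun hv => Finset.mem_compl.1 (hA hv)
      by_cases hvS : v ∈ S
      · have : v ∉ A := fun hv => hAv hv hvS
        simp [hvS, this]
      · by_cases hvA : v ∈ A
        · simp +contextual [hvS, hvA]
        · have h1 : p ∉ ps := hps.1
          have h2 : 0 ≠ p := h0.1
          simp only [hvS, hvA, if_false, Finset.mem_union, or_self, not_false_eq_true, true_and,
            iff_false, Finset.mem_insert, List.mem_toFinset, List.mem_cons]
          constructor
          · rintro ⟨h | h | h, h'⟩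
            · exact Or.inl h
            · exact absurd h h'
            · exact Or.inr h
          · rintro (h | h)
            · exact ⟨Or.inl h, h ▸ h2⟩
            · exact ⟨Or.inr (Or.inr h), fun h' => h1 (h' ▸ h)⟩
    have hmaps : ∀ s ∈ Fintype.piFinset
        (fun v => if v ∈ S then {s₀ v} else insert 0 (p :: ps).toFinset),
        ({v | v ∉ S ∧ s v = p} : Finset (Fin n)) ∈ Sᶜ.powerset := by
      intro s _
      rw [Finset.mem_powerset]
      intro v hv
      simp only [Finset.mem_filter] at hv
      exact Finset.mem_compl.2 hv.2.1
    rw [← Finset.sum_fiberwise_of_maps_to hmaps]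
    have hterm : ∀ A ∈ Sᶜ.powerset, ∑ s ∈ Fintype.piFinset
          (fun v => if v ∈ S then {s₀ v} else insert 0 (p :: ps).toFinset) with
          ({v | v ∉ S ∧ s v = p} : Finset (Fin n)) = A, tabWeight s =
        countWays leafWeight ps (grow p S.card A.card c) (S.card + A.card)
          (n - S.card - A.card) := by
      intro A hA
      have hdisj : Disjoint S A :=
        Finset.disjoint_right.2 fun v hv => Finset.mem_compl.1 (Finset.mem_powerset.1 hA hv)
      rw [hfib A hA, ih (h.union_grow p hdisj) hps.2 h0.2, Finset.card_union_of_disjoint hdisj,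
        Nat.sub_sub]
    rw [Finset.sum_congr rfl hterm, Finset.sum_powerset_apply_card (fun a =>
      countWays leafWeight ps (grow p S.card a c) (S.card + a) (n - S.card - a)),
      Finset.card_compl, Fintype.card_fin, countWays]
    simp only [smul_eq_mul]
    refine sum_range_choose_mul 4 _ fun i hi => ?_
    refine (vanishesOnLong_ite _).countWays ps _ ?_ _ _
    have : ∃ j, coord p j ≠ 0 := by
      by_contra! hp
      exact h0.1 (coord_injective (funext fun j => by rw [hp, coord_zero]))
    obtain ⟨j, hj⟩ := this
    refine ⟨j, ?_⟩
    rw [length_grow]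
    have := Nat.mul_le_mul hi (Nat.one_le_iff_ne_zero.2 hj)
    omega

end Tables

section Moves

variable {n : ℕ}

/-- The column sums of the positive part of a move. -/
noncomputable def profile (z : (Fin 4 ↪ Fin n) → ℤ) (v : Fin n) : ℕ × ℕ × ℕ × ℕ :=
  (suffN n 4 (movePos z) (0, v), suffN n 4 (movePos z) (1, v), suffN n 4 (movePos z) (2, v),
    suffN n 4 (movePos z) (3, v))

lemma tab_profile (z : (Fin 4 ↪ Fin n) → ℤ) : tab (profile z) = suffN n 4 (movePos z) := by
  funext ⟨j, v⟩
  fin_cases j <;> rfl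

lemma profile_eq_iff {z : (Fin 4 ↪ Fin n) → ℤ} {s : Fin n → ℕ × ℕ × ℕ × ℕ} :
    profile z = s ↔ suffN n 4 (movePos z) = tab s := by
  refine ⟨fun h => h ▸ (tab_profile z).symm, fun h => ?_⟩
  rw [← tab_profile] at h
  exact funext fun v => coord_injective (funext fun j => congrFun h (j, v))

lemma sum_suffN_le {r : ℕ} (x : (Fin r ↪ Fin n) → ℕ) (v : Fin n) :
    ∑ j, suffN n r x (j, v) ≤ ∑ σ, x σ := by
  simp only [suffN]
  rw [Finset.sum_comm]
  refine Finset.sum_le_sum fun σ _ => ?_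
  by_cases h : ∃ j, σ j = v
  · obtain ⟨j, rfl⟩ := h
    simp [σ.injective.eq_iff]
  · push Not at h
    simp [h]

lemma mem_profiles : ∀ a b c d : Fin 4, a.1 + (b.1 + (c.1 + d.1)) ≤ 3 →
    (a.1, b.1, c.1, d.1) ∈
      (insert 0 (sharedProfiles ++ privateProfiles).toFinset : Finset (ℕ × ℕ × ℕ × ℕ)) := by
  decide +kernel

lemma profile_mem {z : (Fin 4 ↪ Fin n) → ℤ} (hz : moveDeg n 4 z = 3) (v : Fin n) :
    profile z v ∈ insert 0 (sharedProfiles ++ privateProfiles).toFinset := by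
  have h := (sum_suffN_le (movePos z) v).trans_eq hz
  simp only [Fin.sum_univ_four] at h
  rw [profile]
  generalize suffN n 4 (movePos z) (0, v) = a at h ⊢
  generalize suffN n 4 (movePos z) (1, v) = b at h ⊢
  generalize suffN n 4 (movePos z) (2, v) = c at h ⊢
  generalize suffN n 4 (movePos z) (3, v) = d at h ⊢
  exact mem_profiles ⟨a, by omega⟩ ⟨b, by omega⟩ ⟨c, by omega⟩ ⟨d, by omega⟩
    (show a + (b + (c + d)) ≤ 3 by omega)

/-- The number of moves of degree three with a given table in a minimal Markov basis. -/
theorem card_moves_profile {B : Finset ((Fin 4 ↪ Fin n) → ℤ)} (hB : IsMarkovBasis n 4 B)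
    (hmin : ∀ B' ⊂ B, ¬ IsMarkovBasis n 4 B') (s : Fin n → ℕ × ℕ × ℕ × ℕ) :
    ((B.filter fun z => moveDeg n 4 z = 3).filter fun z => profile z = s).card = tabWeight s := by
  simp only [Finset.filter_filter, profile_eq_iff, tabWeight]
  split_ifs with h
  · convert card_moves_fiber hB hmin (tab s) 3 fun x => ?_
    rw [← sum_suffN x.1 0, x.2, h]
  · rw [Finset.card_eq_zero, Finset.filter_eq_empty_iff]
    rintro z - ⟨h3, hz⟩
    exact h fun j => by rw [← hz, sum_suffN, ← h3, moveDeg]; rfl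

/-- The number of moves of degree three, evaluated in the basis of binomial coefficients. -/
theorem countCoeffs_sharedProfiles :
    countCoeffs completionCoeffs sharedProfiles [] [] [] [] 0 1 =
      [0, 0, 0, 0, 160, 28040, 86660, 102480, 57120, 10080] := by
  decide +kernel

lemma built_empty : Built (∅ : Finset (Fin n)) 0 fun _ => [] := by
  refine ⟨fun _ _ => rfl, 0, fun j => ?_, by simp, by simp⟩
  have : column (tab (0 : Fin n → ℕ × ℕ × ℕ × ℕ)) j = 0 := by
    simp [column, tab, coord_zero]
  simp [this]

/-- The total weight of all tables. -/
theorem sum_tabWeight (n : ℕ) :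
    ∑ s ∈ Fintype.piFinset fun _ : Fin n => insert 0 (sharedProfiles ++ privateProfiles).toFinset,
      tabWeight s = evalCoeffs n 0 [0, 0, 0, 0, 160, 28040, 86660, 102480, 57120, 10080] := by
  have h := (built_empty (n := n)).sum_tabWeight (ps := sharedProfiles ++ privateProfiles)
    (by decide) (by decide)
  simp only [Finset.notMem_empty, if_false, Finset.card_empty] at h
  rw [h, countWays_append, ← countCoeffs_sharedProfiles]
  refine Eq.symm <| (evalCoeffs_countCoeffs ((vanishesOnLong_ite _).countWays privateProfiles)
    (evalCoeffs_completionCoeffs n) sharedProfiles (fun _ => []) 0 1).trans ?_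
  rw [Nat.choose_zero_right, one_mul, one_mul]
  rfl

end Moves

/-- **Every minimal Markov basis for A_{n,4} contains exactly 160·C(n,4) + 28040·C(n,5) + 86660·C(n,6) + 102480·C(n,7) + 57120·C(n,8) + 10080·C(n,9) moves of degree three.** -/
theorem count_deg_three_moves_r4
    (n : ℕ) (hn : 4 ≤ n)
    (B : Finset ((Fin 4 ↪ Fin n) → ℤ))
    (hB : IsMarkovBasis n 4 B)
    (hmin : ∀ B' ⊂ B, ¬ IsMarkovBasis n 4 B') :
    (B.filter fun z => moveDeg n 4 z = 3).card = 160 * n.choose 4 + 28040 * n.choose 5 + 86660 * n.choose 6 + 102480 * n.choose 7 + 57120 * n.choose 8 + 10080 * n.choose 9 := by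
  rw [Finset.card_eq_sum_card_fiberwise (f := profile)
    (t := Fintype.piFinset fun _ => insert 0 (sharedProfiles ++ privateProfiles).toFinset)
    fun z hz => Fintype.mem_piFinset.2 (profile_mem (Finset.mem_filter.1 hz).2),
    Finset.sum_congr rfl fun s _ => card_moves_profile hB hmin s, sum_tabWeight]
  simp only [evalCoeffs]
  ring
end
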